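/- There exists a unique φ⁺ ∈ X such that φ⁺(0) = 1 and φ⁺ is a viscosity solution of F(D²φ⁺) − (1/2) y·Dφ⁺ = α⁺ φ⁺ in ℝⁿ, where α⁺ = α⁺(F) is the positive anomalous exponent. Moreover, φ⁺ > 0 everywhere and φ⁺ ∈ D, i.e., φ⁺(y) ≤ C e^{−b|y|²} for all y and some C > 0. -/

import Mathlib

noncomputable section

open Filter Matrix Real Set
open scoped Topology

/-- Euclidean `n`-space `ℝⁿ`. -/
abbrev En (n : ℕ) := EuclideanSpace ℝ (Fin n)

/-- `n × n` real matrices. -/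
abbrev Mat (n : ℕ) := Matrix (Fin n) (Fin n) ℝ

/-- The set of symmetric positive definite matrices whose eigenvalues all lie in `[lam, Lam]`. -/
def PucciMatrices (n : ℕ) (lam Lam : ℝ) : Set (Mat n) :=
  { A | ∃ hA : A.IsHermitian, ∀ i, hA.eigenvalues i ∈ Set.Icc lam Lam }

/-- The Pucci maximal operator `P⁺(M) = sup {-tr(AM) : A ∈ PucciMatrices}`. -/
def PucciPlus (n : ℕ) (lam Lam : ℝ) (M : Mat n) : ℝ :=
  sSup ((fun A => -(A * M).trace) '' PucciMatrices n lam Lam)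

/-- The Pucci minimal operator `P⁻(M) = inf {-tr(AM) : A ∈ PucciMatrices}`. -/
def PucciMinus (n : ℕ) (lam Lam : ℝ) (M : Mat n) : ℝ :=
  sInf ((fun A => -(A * M).trace) '' PucciMatrices n lam Lam)

/-- `F` is uniformly elliptic with ellipticity constants `lam ≤ Lam`. -/
def UniformlyElliptic (n : ℕ) (lam Lam : ℝ) (F : Mat n → ℝ) : Prop :=
  ∀ M N : Mat n, M.IsSymm → N.IsSymm →
    PucciMinus n lam Lam (M - N) ≤ F M - F N ∧ F M - F N ≤ PucciPlus n lam Lam (M - N)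

/-- `F` is positively homogeneous of order one. -/
def PositivelyHomogeneous (n : ℕ) (F : Mat n → ℝ) : Prop :=
  ∀ (M : Mat n), ∀ η : ℝ, 0 ≤ η → F (η • M) = η * F M

/-- The Hessian matrix of `φ : ℝⁿ → ℝ` at a point `y`. -/
def hess (n : ℕ) (φ : En n → ℝ) (y : En n) : Mat n :=
  Matrix.of fun i j =>
    fderiv ℝ (fun z => fderiv ℝ φ z (EuclideanSpace.single j 1)) y (EuclideanSpace.single i 1)

/-- Viscosity subsolution of the elliptic equation `G(D²u, Du, u, y) = 0` on `Ω`,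
i.e. `G[u] ≤ 0` in the viscosity sense. -/
def ViscSubE (n : ℕ) (Ω : Set (En n))
    (G : Mat n → (En n →L[ℝ] ℝ) → ℝ → En n → ℝ) (u : En n → ℝ) : Prop :=
  ∀ y ∈ Ω, ∀ φ : En n → ℝ, ContDiff ℝ 2 φ →
    IsLocalMaxOn (fun z => u z - φ z) Ω y →
    G (hess n φ y) (fderiv ℝ φ y) (u y) y ≤ 0

/-- Viscosity supersolution of the elliptic equation `G(D²u, Du, u, y) = 0` on `Ω`,
i.e. `G[u] ≥ 0` in the viscosity sense. -/
def ViscSupE (n : ℕ) (Ω : Set (En n))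
    (G : Mat n → (En n →L[ℝ] ℝ) → ℝ → En n → ℝ) (u : En n → ℝ) : Prop :=
  ∀ y ∈ Ω, ∀ φ : En n → ℝ, ContDiff ℝ 2 φ →
    IsLocalMinOn (fun z => u z - φ z) Ω y →
    0 ≤ G (hess n φ y) (fderiv ℝ φ y) (u y) y

/-- Viscosity solution of the elliptic equation `G(D²u, Du, u, y) = 0` on `Ω`. -/
def ViscSolE (n : ℕ) (Ω : Set (En n))
    (G : Mat n → (En n →L[ℝ] ℝ) → ℝ → En n → ℝ) (u : En n → ℝ) : Prop :=
  ViscSubE n Ω G u ∧ ViscSupE n Ω G u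

/-- Time derivative of `φ : ℝⁿ × ℝ → ℝ` at `p = (x, t)`. -/
def tderiv (n : ℕ) (φ : En n × ℝ → ℝ) (p : En n × ℝ) : ℝ :=
  deriv (fun s => φ (p.1, s)) p.2

/-- Spatial Hessian of `φ : ℝⁿ × ℝ → ℝ` at `p = (x, t)`. -/
def shess (n : ℕ) (φ : En n × ℝ → ℝ) (p : En n × ℝ) : Mat n :=
  hess n (fun z => φ (z, p.2)) p.1

/-- Spatial differential of `φ : ℝⁿ × ℝ → ℝ` at `p = (x, t)`. -/
def sgrad (n : ℕ) (φ : En n × ℝ → ℝ) (p : En n × ℝ) : En n →L[ℝ] ℝ :=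
  fderiv ℝ (fun z => φ (z, p.2)) p.1

/-- Viscosity subsolution of the parabolic equation `u_t + G(D²u, Du, u, (x,t)) = 0` on `Ω`. -/
def ViscSubP (n : ℕ) (Ω : Set (En n × ℝ))
    (G : Mat n → (En n →L[ℝ] ℝ) → ℝ → En n × ℝ → ℝ) (u : En n × ℝ → ℝ) : Prop :=
  ∀ p ∈ Ω, ∀ φ : En n × ℝ → ℝ, ContDiff ℝ 2 φ →
    IsLocalMaxOn (fun q => u q - φ q) Ω p →
    tderiv n φ p + G (shess n φ p) (sgrad n φ p) (u p) p ≤ 0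

/-- Viscosity supersolution of the parabolic equation `u_t + G(D²u, Du, u, (x,t)) = 0` on `Ω`. -/
def ViscSupP (n : ℕ) (Ω : Set (En n × ℝ))
    (G : Mat n → (En n →L[ℝ] ℝ) → ℝ → En n × ℝ → ℝ) (u : En n × ℝ → ℝ) : Prop :=
  ∀ p ∈ Ω, ∀ φ : En n × ℝ → ℝ, ContDiff ℝ 2 φ →
    IsLocalMinOn (fun q => u q - φ q) Ω p →
    0 ≤ tderiv n φ p + G (shess n φ p) (sgrad n φ p) (u p) p

/-- Viscosity solution of the parabolic equation `u_t + G(D²u, Du, u, (x,t)) = 0` on `Ω`. -/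
def ViscSolP (n : ℕ) (Ω : Set (En n × ℝ))
    (G : Mat n → (En n →L[ℝ] ℝ) → ℝ → En n × ℝ → ℝ) (u : En n × ℝ → ℝ) : Prop :=
  ViscSubP n Ω G u ∧ ViscSupP n Ω G u

/-- The parabolic domain `ℝⁿ × ℝ₊`. -/
def Qset (n : ℕ) : Set (En n × ℝ) := {p | 0 < p.2}

/-- The elliptic operator `F(D²u) - (1/2) y·Du - α u - f(y)`. -/
def Fop (n : ℕ) (F : Mat n → ℝ) (α : ℝ) (f : En n → ℝ) :
    Mat n → (En n →L[ℝ] ℝ) → ℝ → En n → ℝ :=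
  fun M p v y => F M - (1/2) * p y - α * v - f y

/-- Membership in the space `X` with weight `b`: continuity and finiteness of the norm. -/
def memX (n : ℕ) (b : ℝ) (u : En n → ℝ) : Prop :=
  Continuous u ∧ BddAbove (Set.range fun y : En n => |u y| * Real.exp (b * ‖y‖ ^ 2) / (1 + ‖y‖ ^ 2))

/-- The norm `‖u‖_X = sup_y |u(y)| e^{b|y|²} / (1 + |y|²)`. -/
def normX (n : ℕ) (b : ℝ) (u : En n → ℝ) : ℝ :=
  sSup (Set.range fun y : En n => |u y| * Real.exp (b * ‖y‖ ^ 2) / (1 + ‖y‖ ^ 2))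

/-- The positive anomalous exponent `α⁺(F)`. -/
def alphaPlus (n : ℕ) (lam Lam : ℝ) (F : Mat n → ℝ) : ℝ :=
  sSup { α : ℝ | ∃ φ : En n → ℝ, memX n (1/(8*Lam)) φ ∧ (∀ y, 0 ≤ φ y) ∧ φ ≠ 0 ∧
    ViscSupE n Set.univ (Fop n F α (fun _ => 0)) φ }

/-- `Φ` is a positive self-similar solution of `u_t + F(D²u) = 0` with exponent `α`,
with a Gaussian upper bound at time one. -/
def IsSelfSimilarPlus (n : ℕ) (F : Mat n → ℝ) (α : ℝ) (Φ : En n × ℝ → ℝ) : Prop :=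
  ContinuousOn Φ (Qset n) ∧
  (∀ p ∈ Qset n, 0 < Φ p) ∧
  ViscSolP n (Qset n) (fun M _ _ _ => F M) Φ ∧
  (∀ σ : ℝ, 0 < σ → ∀ x : En n, ∀ t : ℝ, 0 < t →
    Φ (x, t) = σ ^ α * Φ (Real.sqrt σ • x, σ * t)) ∧
  (∃ C : ℝ, 0 < C ∧ ∃ a : ℝ, 0 < a ∧ ∀ x : En n, Φ (x, 1) ≤ C * Real.exp (-a * ‖x‖ ^ 2))

/-- `Φ` is a negative self-similar solution of `u_t + F(D²u) = 0` with exponent `α`,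
with a Gaussian lower bound at time one. -/
def IsSelfSimilarMinus (n : ℕ) (F : Mat n → ℝ) (α : ℝ) (Φ : En n × ℝ → ℝ) : Prop :=
  ContinuousOn Φ (Qset n) ∧
  (∀ p ∈ Qset n, Φ p < 0) ∧
  ViscSolP n (Qset n) (fun M _ _ _ => F M) Φ ∧
  (∀ σ : ℝ, 0 < σ → ∀ x : En n, ∀ t : ℝ, 0 < t →
    Φ (x, t) = σ ^ α * Φ (Real.sqrt σ • x, σ * t)) ∧
  (∃ C : ℝ, 0 < C ∧ ∃ a : ℝ, 0 < a ∧ ∀ x : En n, -Φ (x, 1) ≤ C * Real.exp (-a * ‖x‖ ^ 2))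

/-- The set `S` of locally uniform sequential limits of the rescalings
`u^σ(x,t) = σ^α u(σ^{1/2} x, σ t)` as `σ → ∞`. -/
def limitSet (n : ℕ) (α : ℝ) (u : En n × ℝ → ℝ) : Set (En n × ℝ → ℝ) :=
  { U | ContinuousOn U (Qset n) ∧ ∃ σ : ℕ → ℝ,
      Tendsto σ atTop atTop ∧
      TendstoLocallyUniformlyOn
        (fun k (p : En n × ℝ) => (σ k) ^ α * u (Real.sqrt (σ k) • p.1, σ k * p.2))
        U atTop (Qset n) }

section SupConvolution

variable {E : Type*} [NormedAddCommGroup E] [InnerProductSpace ℝ E]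

/-- The sup-convolution of `u` over `K` with the paraboloid `c|·|²`. -/
def supConv (K : Set E) (u : E → ℝ) (c : ℝ) (x : E) : ℝ :=
  sSup ((fun y => u y - c * ‖x - y‖ ^ 2) '' K)

theorem exists_isMax_supConv {K : Set E} (hK : IsCompact K) (hne : K.Nonempty) {u : E → ℝ}
    (hu : UpperSemicontinuousOn u K) (c : ℝ) (x : E) :
    ∃ y ∈ K, supConv K u c x = u y - c * ‖x - y‖ ^ 2 ∧
      ∀ z ∈ K, u z - c * ‖x - z‖ ^ 2 ≤ supConv K u c x := by
  have h1 : UpperSemicontinuousOn (fun y => u y - c * ‖x - y‖ ^ 2) K := by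
    have h2 : ContinuousOn (fun y => - (c * ‖x - y‖ ^ 2)) K := by fun_prop
    simpa [sub_eq_add_neg] using hu.add h2.upperSemicontinuousOn
  obtain ⟨y, hy, hmax⟩ := UpperSemicontinuousOn.exists_isMaxOn hne hK h1
  have hg : IsGreatest ((fun y => u y - c * ‖x - y‖ ^ 2) '' K) (u y - c * ‖x - y‖ ^ 2) :=
    ⟨⟨y, hy, rfl⟩, by rintro _ ⟨z, hz, rfl⟩; exact hmax hz⟩
  refine ⟨y, hy, hg.csSup_eq, fun z hz => ?_⟩
  rw [supConv, hg.csSup_eq]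
  exact hmax hz

theorem supConv_sub_le {K : Set E} (hK : IsCompact K) (hne : K.Nonempty) {u : E → ℝ}
    (hu : UpperSemicontinuousOn u K) {c : ℝ} (hc : 0 ≤ c) (x z : E) :
    supConv K u c z - c * ‖x - z‖ ^ 2 ≤ supConv K u (c / 2) x := by
  obtain ⟨y, hy, h1, -⟩ := exists_isMax_supConv hK hne hu c z
  obtain ⟨-, -, -, h2⟩ := exists_isMax_supConv hK hne hu (c / 2) x
  have h3 := h2 y hy
  have h4 := parallelogram_law_with_norm ℝ (x - z) (z - y)
  have h5 : x - z + (z - y) = x - y := by abel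
  rw [h5] at h4
  have h6 : ‖x - y‖ ^ 2 ≤ 2 * (‖x - z‖ ^ 2 + ‖z - y‖ ^ 2) := by
    nlinarith [mul_self_nonneg ‖x - z - (z - y)‖]
  rw [h1]
  nlinarith

theorem exists_supConv_half_le {K : Set E} (hK : IsCompact K) (hne : K.Nonempty) {u : E → ℝ}
    (hu : UpperSemicontinuousOn u K) (c : ℝ) (x : E) :
    ∃ z, supConv K u (c / 2) x ≤ supConv K u c z - c * ‖x - z‖ ^ 2 := by
  obtain ⟨y, hy, h1, -⟩ := exists_isMax_supConv hK hne hu (c / 2) x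
  refine ⟨(1 / 2 : ℝ) • (x + y), ?_⟩
  obtain ⟨-, -, -, h2⟩ := exists_isMax_supConv hK hne hu c ((1 / 2 : ℝ) • (x + y))
  have h3 := h2 y hy
  have h4 : ‖(1 / 2 : ℝ) • (x + y) - y‖ = 1 / 2 * ‖x - y‖ := by
    rw [show (1 / 2 : ℝ) • (x + y) - y = (1 / 2 : ℝ) • (x - y) by module, norm_smul]; norm_num
  have h5 : ‖x - (1 / 2 : ℝ) • (x + y)‖ = 1 / 2 * ‖x - y‖ := by
    rw [show x - (1 / 2 : ℝ) • (x + y) = (1 / 2 : ℝ) • (x - y) by module, norm_smul]; norm_num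
  rw [h4] at h3
  rw [h5, h1]
  nlinarith

theorem supConv_midpoint_le {K : Set E} (hK : IsCompact K) (hne : K.Nonempty) {u : E → ℝ}
    (hu : UpperSemicontinuousOn u K) (c : ℝ) (x z : E) :
    supConv K u c ((1 / 2 : ℝ) • (x + z)) ≤
      (supConv K u c x + supConv K u c z) / 2 + c / 4 * ‖x - z‖ ^ 2 := by
  obtain ⟨y, hy, h1, -⟩ := exists_isMax_supConv hK hne hu c ((1 / 2 : ℝ) • (x + z))
  obtain ⟨-, -, -, h2⟩ := exists_isMax_supConv hK hne hu c x
  obtain ⟨-, -, -, h3⟩ := exists_isMax_supConv hK hne hu c z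
  have h2 := h2 y hy
  have h3 := h3 y hy
  have h4 := parallelogram_law_with_norm ℝ (x - y) (z - y)
  have h5 : ‖(1 / 2 : ℝ) • (x + z) - y‖ = 1 / 2 * ‖x - y + (z - y)‖ := by
    rw [show (1 / 2 : ℝ) • (x + z) - y = (1 / 2 : ℝ) • (x - y + (z - y)) by module, norm_smul]
    norm_num
  have h6 : x - y - (z - y) = x - z := by abel
  rw [h6] at h4
  have h7 : ‖(1 / 2 : ℝ) • (x + z) - y‖ ^ 2 =
      (‖x - y‖ ^ 2 + ‖z - y‖ ^ 2) / 2 - ‖x - z‖ ^ 2 / 4 := by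
    rw [h5]; nlinarith
  rw [h1, h7]
  nlinarith

theorem supConv_continuous {K : Set E} (hK : IsCompact K) (hne : K.Nonempty) {u : E → ℝ}
    (hu : UpperSemicontinuousOn u K) {c : ℝ} (hc : 0 ≤ c) : Continuous (supConv K u c) := by
  obtain ⟨R, hR⟩ := hK.isBounded.exists_norm_le
  have key : ∀ x z, supConv K u c x - supConv K u c z ≤ c * (‖x - z‖ * (‖x‖ + ‖z‖ + 2 * R)) := by
    intro x z
    obtain ⟨y, hy, h1, -⟩ := exists_isMax_supConv hK hne hu c x
    obtain ⟨-, -, -, h2⟩ := exists_isMax_supConv hK hne hu c z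
    have h2 := h2 y hy
    have h3 : ‖z - y‖ ≤ ‖x - z‖ + ‖x - y‖ := by
      have := norm_sub_le (x - y) (x - z)
      rw [show x - y - (x - z) = z - y by abel] at this; linarith
    have h4 : ‖x - y‖ ≤ ‖x‖ + R := (norm_sub_le _ _).trans (by linarith [hR y hy])
    have h5 : ‖z - y‖ ≤ ‖z‖ + R := (norm_sub_le _ _).trans (by linarith [hR y hy])
    have h6 : ‖z - y‖ ^ 2 - ‖x - y‖ ^ 2 ≤ ‖x - z‖ * (‖x‖ + ‖z‖ + 2 * R) := by
      have : ‖z - y‖ ^ 2 - ‖x - y‖ ^ 2 = (‖z - y‖ - ‖x - y‖) * (‖z - y‖ + ‖x - y‖) := by ring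
      rw [this]
      exact mul_le_mul (by linarith) (by linarith) (by positivity) (by positivity)
    rw [h1]
    nlinarith
  rw [continuous_iff_continuousAt]
  intro x
  rw [ContinuousAt, tendsto_iff_norm_sub_tendsto_zero]
  have hlim : Tendsto (fun z => c * (‖z - x‖ * (‖z‖ + ‖x‖ + 2 * R))) (𝓝 x) (𝓝 0) := by
    have : Continuous (fun z => c * (‖z - x‖ * (‖z‖ + ‖x‖ + 2 * R))) := by fun_prop
    simpa using this.tendsto x
  refine squeeze_zero (fun _ => norm_nonneg _) (fun z => ?_) hlim
  rw [Real.norm_eq_abs, abs_le]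
  have h1 := key z x
  have h2 := key x z
  rw [norm_sub_rev x z, show ‖x‖ + ‖z‖ = ‖z‖ + ‖x‖ by ring] at h2
  constructor <;> linarith

/-- The function `x ↦ V x + c|x - z|²`, `V` the half-opening sup-convolution of `u`, has a minimizer,
quantitatively. -/
theorem exists_prox [FiniteDimensional ℝ E] {K : Set E} (hK : IsCompact K) (hne : K.Nonempty)
    {u : E → ℝ} (hu : UpperSemicontinuousOn u K) {c : ℝ} (hc : 0 < c) (z : E) :
    ∃ x, ∀ w, supConv K u (c / 2) x + c * ‖x - z‖ ^ 2 + c / 4 * ‖x - w‖ ^ 2 ≤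
      supConv K u (c / 2) w + c * ‖w - z‖ ^ 2 := by
  have hcont : Continuous (fun w => supConv K u (c / 2) w + c * ‖w - z‖ ^ 2) := by
    have := supConv_continuous hK hne hu (c := c / 2) (by positivity)
    fun_prop
  obtain ⟨y0, hy0⟩ := hne
  have hne : K.Nonempty := ⟨y0, hy0⟩
  have hlow : ∀ w, u y0 - c / 2 * ‖w - y0‖ ^ 2 ≤ supConv K u (c / 2) w := by
    intro w
    obtain ⟨-, -, -, h2⟩ := exists_isMax_supConv hK hne hu (c / 2) w
    exact h2 y0 hy0
  have hcoer : Tendsto (fun w => supConv K u (c / 2) w + c * ‖w - z‖ ^ 2) (cocompact E) atTop := by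
    have h1 : Tendsto (fun w => u y0 - 2 * c * ‖z - y0‖ ^ 2 + c / 4 * ‖w - z‖ ^ 2)
        (cocompact E) atTop := by
      apply tendsto_atTop_add_const_left
      apply Tendsto.const_mul_atTop (by positivity)
      have h3 : Tendsto (fun w : E => ‖w - z‖) (cocompact E) atTop := by
        have h4 := tendsto_norm_cocompact_atTop (E := E)
        have h5 : Tendsto (fun w : E => ‖w‖ - ‖z‖) (cocompact E) atTop :=
          tendsto_atTop_add_const_right _ _ h4
        exact tendsto_atTop_mono (fun w => norm_sub_norm_le w z) h5
      exact (tendsto_pow_atTop (two_ne_zero)).comp h3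
    refine tendsto_atTop_mono (fun w => ?_) h1
    have h2 := hlow w
    have h3 : ‖w - y0‖ ≤ ‖w - z‖ + ‖z - y0‖ := by
      simpa using norm_add_le (w - z) (z - y0)
    have h4 : ‖w - y0‖ ^ 2 ≤ (‖w - z‖ + ‖z - y0‖) ^ 2 := by gcongr
    nlinarith [sq_nonneg (‖w - z‖ - 2 * ‖z - y0‖), sq_nonneg (‖w - z‖), sq_nonneg (‖z - y0‖)]
  obtain ⟨x, hx⟩ := hcont.exists_forall_le hcoer
  refine ⟨x, fun w => ?_⟩
  have h1 := hx ((1 / 2 : ℝ) • (x + w))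
  have h2 := supConv_midpoint_le hK hne hu (c / 2) x w
  have h4 := parallelogram_law_with_norm ℝ (x - z) (w - z)
  have h5 : ‖(1 / 2 : ℝ) • (x + w) - z‖ = 1 / 2 * ‖x - z + (w - z)‖ := by
    rw [show (1 / 2 : ℝ) • (x + w) - z = (1 / 2 : ℝ) • (x - z + (w - z)) by module, norm_smul]
    norm_num
  have h6 : x - z - (w - z) = x - w := by abel
  rw [h6] at h4
  have h7 : ‖(1 / 2 : ℝ) • (x + w) - z‖ ^ 2 =
      (‖x - z‖ ^ 2 + ‖w - z‖ ^ 2) / 2 - ‖x - w‖ ^ 2 / 4 := by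
    rw [h5]; nlinarith
  rw [h7] at h1
  nlinarith

/-- The semiconvex sup-convolution of `u` lies below a `C^{1,1}` function with the minimality property
stated in the last clause. -/
theorem exists_regularization [FiniteDimensional ℝ E] {K : Set E} (hK : IsCompact K)
    (hne : K.Nonempty) {u : E → ℝ} (hu : UpperSemicontinuousOn u K) {c : ℝ} (hc : 0 < c) :
    ∃ (k : E → ℝ) (J : E → E), LipschitzWith 4 J ∧
      (∀ z, HasFDerivAt k ((2 * c) • innerSL ℝ (z - J z)) z) ∧
      (∀ z, supConv K u c z ≤ k z) ∧
      ∀ z w, ∃ w', k z ≤ supConv K u c w' - c * ‖w - w'‖ ^ 2 + c * ‖w - z‖ ^ 2 := by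
  choose J hJ using exists_prox hK hne hu hc
  have hdist : ∀ z z', ‖J z - J z'‖ ≤ 4 * ‖z - z'‖ := by
    intro z z'
    have h1 := hJ z (J z')
    have h2 := hJ z' (J z)
    rw [norm_sub_rev (J z') (J z)] at h2
    have h3 : ‖J z' - z‖ ^ 2 - ‖J z - z‖ ^ 2 + ‖J z - z'‖ ^ 2 - ‖J z' - z'‖ ^ 2 =
        2 * inner ℝ (J z - J z') (z - z') := by
      simp only [← real_inner_self_eq_norm_sq, inner_sub_left, inner_sub_right,
        real_inner_comm z (J z), real_inner_comm z' (J z), real_inner_comm z (J z'),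
        real_inner_comm z' (J z')]
      ring
    have h4 := real_inner_le_norm (J z - J z') (z - z')
    have h5 : c * (‖J z - J z'‖ * ‖J z - J z'‖) ≤ c * (‖J z - J z'‖ * (4 * ‖z - z'‖)) := by
      nlinarith
    have h6 := le_of_mul_le_mul_left h5 hc
    rcases eq_or_lt_of_le (norm_nonneg (J z - J z')) with h | h
    · rw [← h]; positivity
    · exact le_of_mul_le_mul_left h6 h
  refine ⟨fun z => supConv K u (c / 2) (J z) + c * ‖J z - z‖ ^ 2, J, ?_, ?_, ?_, ?_⟩
  · refine LipschitzWith.of_dist_le_mul fun z z' => ?_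
    simpa [dist_eq_norm] using hdist z z'
  · intro z
    set k := fun z => supConv K u (c / 2) (J z) + c * ‖J z - z‖ ^ 2 with hk
    have hub : ∀ z z', k z' - k z ≤ 2 * c * inner ℝ (z - J z) (z' - z) + c * ‖z' - z‖ ^ 2 := by
      intro z z'
      have h1 := hJ z' (J z)
      have h2 : ‖J z - z'‖ ^ 2 - ‖J z - z‖ ^ 2 = 2 * inner ℝ (z - J z) (z' - z) + ‖z' - z‖ ^ 2 := by
        simp only [← real_inner_self_eq_norm_sq, inner_sub_left, inner_sub_right,
          real_inner_comm z (J z), real_inner_comm z' (J z), real_inner_comm z z']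
        ring
      simp only [hk]
      have : 0 ≤ c / 4 * ‖J z' - J z‖ ^ 2 := by positivity
      nlinarith
    have hbd : ∀ z', |k z' - k z - 2 * c * inner ℝ (z - J z) (z' - z)| ≤ 9 * c * ‖z' - z‖ ^ 2 := by
      intro z'
      have h1 := hub z z'
      have h2 := hub z' z
      rw [norm_sub_rev z z'] at h2
      have h3 : inner ℝ (z' - J z') (z - z') = - inner ℝ (z - J z) (z' - z) - ‖z' - z‖ ^ 2
          + inner ℝ (J z' - J z) (z' - z) := by
        simp only [← real_inner_self_eq_norm_sq, inner_sub_left, inner_sub_right]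
        ring
      have h4 := real_inner_le_norm (J z' - J z) (z' - z)
      have h5 := mul_le_mul_of_nonneg_right (hdist z' z) (norm_nonneg (z' - z))
      rw [h3] at h2
      have h6 : 0 ≤ c * ‖z' - z‖ ^ 2 := by positivity
      have h7 : c * inner ℝ (J z' - J z) (z' - z) ≤ c * (4 * ‖z' - z‖ ^ 2) := by
        gcongr; nlinarith
      rw [abs_le]
      constructor <;> nlinarith
    rw [hasFDerivAt_iff_isLittleO]
    refine Asymptotics.IsBigO.trans_isLittleO (g := fun z' => ‖z' - z‖ ^ 2) ?_ ?_
    · refine Asymptotics.IsBigO.of_bound (9 * c) (Eventually.of_forall fun z' => ?_)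
      have := hbd z'
      simp only [_root_.smul_apply, innerSL_apply_apply, smul_eq_mul, Real.norm_eq_abs,
        abs_pow, abs_norm]
      exact this
    · have h := (Asymptotics.isLittleO_norm_pow_id (E' := E) (n := 2) one_lt_two)
      have h2 : Tendsto (fun z' => z' - z) (𝓝 z) (𝓝 0) := by
        have : Continuous (fun z' => z' - z) := by fun_prop
        simpa using this.tendsto z
      exact h.comp_tendsto h2
  · intro z
    have := supConv_sub_le hK hne hu hc.le (J z) z
    linarith
  · intro z w
    obtain ⟨w', hw'⟩ := exists_supConv_half_le hK hne hu c w
    refine ⟨w', ?_⟩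
    have := hJ z w
    have h2 : 0 ≤ c / 4 * ‖J z - w‖ ^ 2 := by positivity
    linarith

end SupConvolution

theorem taylor_two_of_hasFDerivAt {E : Type*} [NormedAddCommGroup E] [NormedSpace ℝ E]
    {f : E → ℝ} {g : E → E →L[ℝ] ℝ} {H : E →L[ℝ] E →L[ℝ] ℝ} {x : E}
    (hf : ∀ᶠ z in 𝓝 x, HasFDerivAt f (g z) z) (hg : HasFDerivAt g H x) {ε : ℝ} (hε : 0 < ε) :
    ∀ᶠ d in 𝓝 (0 : E), |f (x + d) - f x - g x d - 1 / 2 * H d d| ≤ ε * ‖d‖ ^ 2 := by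
  have h1 := (hasFDerivAt_iff_isLittleO_nhds_zero.1 hg).def hε
  have h2 : ∀ᶠ d in 𝓝 (0 : E), HasFDerivAt f (g (x + d)) (x + d) := by
    have h3 : Tendsto (fun d => x + d) (𝓝 (0 : E)) (𝓝 x) := by
      have : Continuous (fun d : E => x + d) := by fun_prop
      simpa using this.tendsto 0
    exact h3.eventually hf
  obtain ⟨r, hr, hball⟩ := Metric.eventually_nhds_iff_ball.1 (h1.and h2)
  filter_upwards [Metric.ball_mem_nhds (0 : E) hr] with d hd
  rw [mem_ball_zero_iff] at hd
  have hmem : ∀ t ∈ Icc (0 : ℝ) 1, t • d ∈ Metric.ball (0 : E) r := by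
    intro t ht
    rw [mem_ball_zero_iff, norm_smul, Real.norm_eq_abs, abs_of_nonneg ht.1]
    nlinarith [ht.2, norm_nonneg d]
  have hder : ∀ t ∈ Icc (0 : ℝ) 1, HasDerivWithinAt
      (fun t : ℝ => f (x + t • d) - f x - t * g x d - 1 / 2 * t ^ 2 * H d d)
      (g (x + t • d) d - g x d - t * H d d) (Icc 0 1) t := by
    intro t ht
    have h3 : HasDerivAt (fun t : ℝ => x + t • d) d t := by
      simpa using ((hasDerivAt_id t).smul_const d).const_add x
    have h4 := (hball _ (hmem t ht)).2.comp_hasDerivAt t h3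
    have h5 := ((h4.sub_const (f x)).sub ((hasDerivAt_id t).mul_const (g x d))).sub
      ((((hasDerivAt_id t).pow 2).const_mul (1 / 2)).mul_const (H d d))
    refine (h5.congr_deriv ?_).hasDerivWithinAt
    simp
  have hb := norm_image_sub_le_of_norm_deriv_le_segment_01' hder (C := ε * ‖d‖ ^ 2) (by
    intro t ht
    have ht' : t ∈ Icc (0 : ℝ) 1 := ⟨ht.1, ht.2.le⟩
    have h3 := (hball _ (hmem t ht')).1
    have h4 : g (x + t • d) d - g x d - t * H d d = (g (x + t • d) - g x - H (t • d)) d := by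
      simp
    rw [h4]
    refine (ContinuousLinearMap.le_opNorm _ _).trans ?_
    have h5 : ‖t • d‖ ≤ ‖d‖ := by
      rw [norm_smul, Real.norm_eq_abs, abs_of_nonneg ht.1]
      nlinarith [ht.2, norm_nonneg d]
    calc _ ≤ (ε * ‖t • d‖) * ‖d‖ := by gcongr
      _ ≤ (ε * ‖d‖) * ‖d‖ := by gcongr
      _ = _ := by ring)
  simpa using hb

theorem LipschitzWith.hausdorffMeasure_image_eq_zero {V : Type*} [NormedAddCommGroup V] [NormedSpace ℝ V]
    [FiniteDimensional ℝ V] [MeasurableSpace V] [BorelSpace V] {C : NNReal} {f : V → V}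
    (hf : LipschitzWith C f) {s : Set V}
    (hs : MeasureTheory.Measure.hausdorffMeasure (X := V) (Module.finrank ℝ V) s = 0) :
    MeasureTheory.Measure.hausdorffMeasure (X := V) (Module.finrank ℝ V) (f '' s) = 0 := by
  have h1 := hf.hausdorffMeasure_image_le (d := Module.finrank ℝ V) (by positivity) s
  rw [hs, mul_zero] at h1
  exact le_antisymm h1 zero_le

/-- A Lipschitz perturbation argument: arbitrarily small values `p` avoid the image of the
non-differentiability set of a Lipschitz map. -/
theorem exists_small_forall_differentiableAt {V W : Type*} [NormedAddCommGroup V] [NormedSpace ℝ V]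
    [FiniteDimensional ℝ V] [MeasurableSpace V] [BorelSpace V] [NormedAddCommGroup W]
    [NormedSpace ℝ W] [FiniteDimensional ℝ W] {C D : NNReal} {T : V → V}
    (hT : LipschitzWith C T) {J : V → W} (hJ : LipschitzWith D J) {ρ : ℝ} (hρ : 0 < ρ) :
    ∃ p : V, ‖p‖ < ρ ∧ ∀ ξ, T ξ = p → DifferentiableAt ℝ J ξ := by
  let μ : MeasureTheory.Measure V :=
    MeasureTheory.Measure.hausdorffMeasure (X := V) (Module.finrank ℝ V)
  have h1 : μ {ξ | ¬ DifferentiableAt ℝ J ξ} = 0 := hJ.ae_differentiableAt (μ := μ)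
  have h2 := hT.hausdorffMeasure_image_eq_zero h1
  have h3 : 0 < μ (Metric.ball (0 : V) ρ) := Metric.measure_ball_pos μ _ hρ
  by_contra! hcon
  have h4 : Metric.ball (0 : V) ρ ⊆ T '' {ξ | ¬ DifferentiableAt ℝ J ξ} := by
    intro p hp
    obtain ⟨ξ, h5, h6⟩ := hcon p (by simpa using hp)
    exact ⟨ξ, h6, h5⟩
  exact h3.ne' (MeasureTheory.measure_mono_null h4 h2)

section Sums

variable {E : Type*} [NormedAddCommGroup E] [InnerProductSpace ℝ E]

theorem hasFDerivAt_eq_of_forall_le {k : E → ℝ} {g g' : E →L[ℝ] ℝ} {x : E} {C : ℝ}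
    (hk : HasFDerivAt k g x) (h : ∀ d, k (x + d) ≤ k x + g' d + C * ‖d‖ ^ 2) : g = g' := by
  have h0 : HasFDerivAt (fun d => k (x + d)) g (0 : E) := by
    have h1 : HasFDerivAt (fun d : E => x + d) (ContinuousLinearMap.id ℝ E) 0 :=
      (hasFDerivAt_id _).const_add x
    have h2 : HasFDerivAt k g (x + 0) := by simpa using hk
    have h3 := h2.comp (0 : E) h1
    rwa [ContinuousLinearMap.comp_id] at h3
  have h2 : HasFDerivAt (fun d : E => C * ‖d‖ ^ 2) (0 : E →L[ℝ] ℝ) 0 := by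
    have := ((hasStrictFDerivAt_norm_sq (0 : E)).hasFDerivAt).const_mul C
    simpa using this
  have h3 := (h0.sub g'.hasFDerivAt).sub h2
  have h4 : IsLocalMax (((fun d => k (x + d)) - ⇑g') - fun d : E => C * ‖d‖ ^ 2) 0 := by
    refine Filter.Eventually.of_forall fun d => ?_
    have := h d
    simp only [Pi.sub_apply, add_zero, map_zero, norm_zero]
    nlinarith
  have h5 := h4.hasFDerivAt_eq_zero h3
  rw [sub_zero, sub_eq_zero] at h5
  exact h5

theorem second_order_le_of_forall_le {k₁ k₂ : E → ℝ} {g₁ g₂ : E → E →L[ℝ] ℝ}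
    {H₁ H₂ : E →L[ℝ] E →L[ℝ] ℝ} {x y h l : E} (hk₁ : ∀ z, HasFDerivAt k₁ (g₁ z) z)
    (hk₂ : ∀ z, HasFDerivAt k₂ (g₂ z) z) (hg₁ : HasFDerivAt g₁ H₁ x) (hg₂ : HasFDerivAt g₂ H₂ y)
    {Q : ℝ} (hQ : ∀ t : ℝ, 0 < t → k₁ (x + t • h) + k₂ (y + t • l) ≤
      k₁ x + k₂ y + t * (g₁ x h + g₂ y l) + t ^ 2 / 2 * Q) :
    H₁ h h + H₂ l l ≤ Q := by
  have hlim : ∀ v : E, Tendsto (fun t : ℝ => t • v) (𝓝[>] 0) (𝓝 (0 : E)) := by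
    intro v
    have h1 : Continuous (fun t : ℝ => t • v) := by fun_prop
    simpa using (h1.tendsto 0).mono_left nhdsWithin_le_nhds
  refine le_of_forall_pos_le_add fun δ hδ => ?_
  set ε : ℝ := δ / (2 * (‖h‖ ^ 2 + ‖l‖ ^ 2 + 1)) with hε
  have hεp : 0 < ε := by positivity
  have h1 := (hlim h).eventually
    (taylor_two_of_hasFDerivAt (Filter.Eventually.of_forall hk₁) hg₁ hεp)
  have h2 := (hlim l).eventually
    (taylor_two_of_hasFDerivAt (Filter.Eventually.of_forall hk₂) hg₂ hεp)
  obtain ⟨t, ⟨h3, h4⟩, h5⟩ := ((h1.and h2).and self_mem_nhdsWithin).exists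
  have ht : 0 < t := h5
  have h6 := hQ t ht
  simp only [map_smul, smul_eq_mul, norm_smul, Real.norm_eq_abs, mul_pow, sq_abs,
    _root_.smul_apply] at h3 h4
  have h7 := (abs_le.1 h3).1
  have h8 := (abs_le.1 h4).1
  have h9 : t ^ 2 * (H₁ h h + H₂ l l) ≤ t ^ 2 * (Q + 2 * ε * (‖h‖ ^ 2 + ‖l‖ ^ 2)) := by nlinarith
  have h10 := le_of_mul_le_mul_left h9 (by positivity)
  have h11 : 2 * ε * (‖h‖ ^ 2 + ‖l‖ ^ 2) ≤ δ := by
    have : 2 * ε * (‖h‖ ^ 2 + ‖l‖ ^ 2 + 1) = δ := by rw [hε]; field_simp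
    nlinarith
  linarith

theorem exists_jet_of_supConv_touch {a : E → ℝ} {c r : ℝ} (hc : 0 < c) (hr : 0 ≤ r)
    (hK : IsCompact (Metric.closedBall (0 : E) r))
    (ha : UpperSemicontinuousOn a (Metric.closedBall (0 : E) r)) (ha0 : a 0 = 0)
    (hac : ∀ x ∈ Metric.closedBall (0 : E) r, a x ≤ c / 4 * ‖x‖ ^ 2)
    {k : E → ℝ} {g : E → E →L[ℝ] ℝ} {H : E →L[ℝ] E →L[ℝ] ℝ} {x : E}
    (hk : ∀ z, HasFDerivAt k (g z) z) (hg : HasFDerivAt g H x)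
    (hle : ∀ z, supConv (Metric.closedBall (0 : E) r) a c z ≤ k z)
    (heq : k x = supConv (Metric.closedBall (0 : E) r) a c x) (hx : 3 * ‖x‖ < r)
    {ε : ℝ} (hε : 0 < ε) :
    ∃ x', ‖x'‖ ≤ 3 * ‖x‖ ∧ |a x'| ≤ 2 * c * ‖x‖ ^ 2 ∧
      ∀ᶠ d in 𝓝 (0 : E), a (x' + d) ≤ a x' + g x d + 1 / 2 * H d d + ε * ‖d‖ ^ 2 := by
  have h0 : (0 : E) ∈ Metric.closedBall (0 : E) r := by simpa using hr
  obtain ⟨x', hx', h1, h2⟩ := exists_isMax_supConv hK ⟨0, h0⟩ ha c x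
  have h3 := h2 0 h0
  have h4 := hac x' hx'
  rw [ha0, h1, sub_zero, zero_sub] at h3
  have h5 : ‖x'‖ ≤ ‖x‖ + ‖x - x'‖ := by
    have := norm_sub_le x (x - x')
    simpa using this
  have h6 : ‖x'‖ ^ 2 ≤ 2 * ‖x‖ ^ 2 + 2 * ‖x - x'‖ ^ 2 := by
    nlinarith [norm_nonneg x', sq_nonneg (‖x‖ - ‖x - x'‖)]
  have h7 : ‖x - x'‖ ^ 2 ≤ 3 * ‖x‖ ^ 2 := by
    have : c * ‖x - x'‖ ^ 2 ≤ c * (3 * ‖x‖ ^ 2) := by nlinarith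
    exact le_of_mul_le_mul_left this hc
  have h8 : ‖x'‖ ≤ 3 * ‖x‖ := by
    refine abs_le_of_sq_le_sq' ?_ (by positivity) |>.2
    nlinarith [sq_nonneg ‖x‖]
  refine ⟨x', h8, ?_, ?_⟩
  · rw [abs_le]
    constructor
    · nlinarith [mul_nonneg hc.le (sq_nonneg ‖x - x'‖), mul_nonneg hc.le (sq_nonneg ‖x‖)]
    · nlinarith
  · have h9 : ∀ᶠ d in 𝓝 (0 : E), x' + d ∈ Metric.closedBall (0 : E) r := by
      have h10 : Tendsto (fun d => x' + d) (𝓝 (0 : E)) (𝓝 x') := by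
        have : Continuous (fun d : E => x' + d) := by fun_prop
        simpa using this.tendsto 0
      refine h10.eventually (Metric.closedBall_mem_nhds_of_mem ?_)
      rw [mem_ball_zero_iff]; linarith
    filter_upwards [h9, taylor_two_of_hasFDerivAt (Filter.Eventually.of_forall hk) hg hε]
      with d hd1 hd2
    obtain ⟨-, -, -, h10⟩ := exists_isMax_supConv hK ⟨0, h0⟩ ha c (x + d)
    have h11 := h10 _ hd1
    rw [show x + d - (x' + d) = x - x' by abel] at h11
    have h12 := hle (x + d)
    have h13 := (abs_le.1 hd2).2
    linarith


theorem lipschitz_sums_map {J₁ J₂ : E → E} (h₁ : LipschitzWith 4 J₁) (h₂ : LipschitzWith 4 J₂)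
    (c : ℝ) (L : E × E →L[ℝ] E × E) :
    ∃ C, LipschitzWith C (fun ξ : E × E => L ξ - c • (J₁ ξ.1, J₂ ξ.2)) := by
  have hJ : LipschitzWith 4 (fun ξ : E × E => (J₁ ξ.1, J₂ ξ.2)) := by
    have := (h₁.comp LipschitzWith.prod_fst).prodMk (h₂.comp LipschitzWith.prod_snd)
    simpa using this
  exact ⟨_, L.lipschitz.sub ((lipschitzWith_smul c).comp hJ)⟩

theorem quadratic_expand {B : E →L[ℝ] E} (hB : ∀ x y, inner ℝ (B x) y = inner ℝ x (B y))
    (η : ℝ) (p₁ p₂ x y h l : E) :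
    1 / 2 * inner ℝ (B (x + h - (y + l))) (x + h - (y + l)) +
        η / 2 * (‖x + h‖ ^ 2 + ‖y + l‖ ^ 2) + inner ℝ p₁ (x + h) + inner ℝ p₂ (y + l) =
      (1 / 2 * inner ℝ (B (x - y)) (x - y) + η / 2 * (‖x‖ ^ 2 + ‖y‖ ^ 2) + inner ℝ p₁ x +
        inner ℝ p₂ y) + (inner ℝ (B (x - y) + η • x + p₁) h +
        inner ℝ (-B (x - y) + η • y + p₂) l) +
        1 / 2 * (inner ℝ (B (h - l)) (h - l) + η * (‖h‖ ^ 2 + ‖l‖ ^ 2)) := by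
  have h1 : x + h - (y + l) = (x - y) + (h - l) := by abel
  rw [h1, map_add]
  have h2 : inner ℝ (B (h - l)) (x - y) = inner ℝ (B (x - y)) (h - l) := by
    rw [hB, real_inner_comm]
  simp only [inner_add_left, inner_add_right, ← real_inner_self_eq_norm_sq, inner_neg_left,
    real_inner_smul_left, real_inner_comm h x, real_inner_comm l y]
  rw [h2]
  rw [inner_sub_right (B (x - y)) h l]
  ring

theorem prox_shift {c : ℝ} (hc : 0 < c) (v v' G : E) :
    c * ‖v - (1 / (2 * c)) • G - v'‖ ^ 2 =
      c * ‖v - (1 / (2 * c)) • G - v‖ ^ 2 + inner ℝ G (v' - v) + c * ‖v' - v‖ ^ 2 := by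
  have e1 : v - (1 / (2 * c)) • G - v' = -((1 / (2 * c)) • G + (v' - v)) := by abel
  have e2 : v - (1 / (2 * c)) • G - v = -((1 / (2 * c)) • G) := by abel
  have e3 : c * (2 * (1 / (2 * c) * inner ℝ G (v' - v))) = inner ℝ G (v' - v) := by
    field_simp
  rw [e1, e2, norm_neg, norm_neg, norm_add_sq_real, real_inner_smul_left]
  linear_combination e3

set_option maxHeartbeats 1000000 in
/-- The theorem on sums near a strict touching point, with a quadratic bound on the penalty. -/
theorem exists_sums_jets [FiniteDimensional ℝ E] {a b : E → ℝ} {c r : ℝ} (hc : 0 < c) (hr : 0 < r)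
    (ha : UpperSemicontinuousOn a (Metric.closedBall (0 : E) r))
    (hb : UpperSemicontinuousOn b (Metric.closedBall (0 : E) r)) (ha0 : a 0 = 0) (hb0 : b 0 = 0)
    {β : E → ℝ} (hab : ∀ x ∈ Metric.closedBall (0 : E) r, ∀ y ∈ Metric.closedBall (0 : E) r,
      a x + b y ≤ β (x - y))
    {B : E →L[ℝ] E} (hB : ∀ x y, inner ℝ (B x) y = inner ℝ x (B y))
    (hβB : ∀ z z', β z' ≤ 1 / 2 * inner ℝ (B z) z + c / 2 * ‖z - z'‖ ^ 2)
    (hβc : ∀ z, β z ≤ c / 4 * ‖z‖ ^ 2) (hBc : ∀ z, inner ℝ (B z) z ≤ c / 2 * ‖z‖ ^ 2)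
    {τ : ℝ} (hτ : 0 < τ) :
    ∃ (x y : E) (p q : E →L[ℝ] ℝ) (X Y : E →L[ℝ] E →L[ℝ] ℝ),
      ‖x‖ < τ ∧ ‖y‖ < τ ∧ |a x| < τ ∧ |b y| < τ ∧ ‖p‖ < τ ∧ ‖q‖ < τ ∧
      (∀ h l, X h l = X l h) ∧ (∀ h l, Y h l = Y l h) ∧
      (∀ᶠ d in 𝓝 (0 : E), a (x + d) ≤ a x + p d + 1 / 2 * X d d) ∧
      (∀ᶠ d in 𝓝 (0 : E), b (y + d) ≤ b y + q d + 1 / 2 * Y d d) ∧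
      ∀ h l, X h h + Y l l ≤ inner ℝ (B (h - l)) (h - l) + τ * (‖h‖ ^ 2 + ‖l‖ ^ 2) := by
  set K := Metric.closedBall (0 : E) r with hKdef
  have hK : IsCompact K := isCompact_closedBall 0 r
  have h0 : (0 : E) ∈ K := by simpa [K] using hr.le
  have hne : K.Nonempty := ⟨0, h0⟩
  obtain ⟨k₁, J₁, hJ₁, hk₁, hU₁, hV₁⟩ := exists_regularization hK hne ha hc
  obtain ⟨k₂, J₂, hJ₂, hk₂, hU₂, hV₂⟩ := exists_regularization hK hne hb hc
  set U₁ := supConv K a c with hU₁def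
  set U₂ := supConv K b c with hU₂def
  have hsum : ∀ x y, U₁ x + U₂ y ≤ 1 / 2 * inner ℝ (B (x - y)) (x - y) := by
    intro x y
    obtain ⟨x', hx', h1, -⟩ := exists_isMax_supConv hK hne ha c x
    obtain ⟨y', hy', h2, -⟩ := exists_isMax_supConv hK hne hb c y
    have h3 := hab x' hx' y' hy'
    have h4 := hβB (x - y) (x' - y')
    have h5 : ‖x - y - (x' - y')‖ ^ 2 ≤ 2 * (‖x - x'‖ ^ 2 + ‖y - y'‖ ^ 2) := by
      have h6 := norm_sub_le (x - x') (y - y')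
      rw [show x - y - (x' - y') = x - x' - (y - y') by abel]
      nlinarith [norm_nonneg (x - x' - (y - y')), sq_nonneg (‖x - x'‖ - ‖y - y'‖)]
    have h1' : U₁ x = a x' - c * ‖x - x'‖ ^ 2 := h1
    have h2' : U₂ y = b y' - c * ‖y - y'‖ ^ 2 := h2
    rw [h1', h2']
    linarith [mul_le_mul_of_nonneg_left h5 hc.le]
  have hU0 : 0 ≤ U₁ 0 + U₂ 0 := by
    obtain ⟨-, -, -, h1⟩ := exists_isMax_supConv hK hne ha c 0
    obtain ⟨-, -, -, h2⟩ := exists_isMax_supConv hK hne hb c 0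
    have h1 := h1 0 h0
    have h2 := h2 0 h0
    simp only [sub_self, norm_zero, ha0, hb0] at h1 h2
    have h1' : (0 : ℝ) ≤ U₁ 0 := by simpa using h1
    have h2' : (0 : ℝ) ≤ U₂ 0 := by simpa using h2
    linarith
  have hUc₁ : Continuous U₁ := supConv_continuous hK hne ha hc.le
  have hUc₂ : Continuous U₂ := supConv_continuous hK hne hb hc.le
  -- choice of the small parameters
  obtain ⟨η, hη, hηc, hητ⟩ : ∃ η : ℝ, 0 < η ∧ η ≤ c ∧ 2 * η ≤ τ :=
    ⟨min c (τ / 2), by positivity, min_le_left _ _, by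
      have := min_le_right c (τ / 2); linarith⟩
  obtain ⟨s, hs, hs1, hs2, hs3, hs4⟩ : ∃ s : ℝ, 0 < s ∧ 3 * s < τ ∧ 3 * s < r ∧
      2 * c * s ^ 2 < τ ∧ (‖B‖ + 2 * η) * s < τ := by
    have e1 : ∀ᶠ s in 𝓝[>] (0 : ℝ), 3 * s < τ := by
      have : Tendsto (fun s : ℝ => 3 * s) (𝓝[>] 0) (𝓝 (3 * 0)) :=
        (Continuous.tendsto (by fun_prop) 0).mono_left nhdsWithin_le_nhds
      exact this.eventually (gt_mem_nhds (by linarith))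
    have e2 : ∀ᶠ s in 𝓝[>] (0 : ℝ), 3 * s < r := by
      have : Tendsto (fun s : ℝ => 3 * s) (𝓝[>] 0) (𝓝 (3 * 0)) :=
        (Continuous.tendsto (by fun_prop) 0).mono_left nhdsWithin_le_nhds
      exact this.eventually (gt_mem_nhds (by linarith))
    have e3 : ∀ᶠ s in 𝓝[>] (0 : ℝ), 2 * c * s ^ 2 < τ := by
      have : Tendsto (fun s : ℝ => 2 * c * s ^ 2) (𝓝[>] 0) (𝓝 (2 * c * 0 ^ 2)) :=
        (Continuous.tendsto (by fun_prop) 0).mono_left nhdsWithin_le_nhds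
      exact this.eventually (gt_mem_nhds (by linarith))
    have e4 : ∀ᶠ s in 𝓝[>] (0 : ℝ), (‖B‖ + 2 * η) * s < τ := by
      have : Tendsto (fun s : ℝ => (‖B‖ + 2 * η) * s) (𝓝[>] 0) (𝓝 ((‖B‖ + 2 * η) * 0)) :=
        (Continuous.tendsto (by fun_prop) 0).mono_left nhdsWithin_le_nhds
      exact this.eventually (gt_mem_nhds (by linarith))
    obtain ⟨s, ⟨⟨⟨h1, h2⟩, h3⟩, h4⟩, h5⟩ :=
      ((((e1.and e2).and e3).and e4).and self_mem_nhdsWithin).exists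
    exact ⟨s, h5, h1, h2, h3, h4⟩
  -- the perturbation
  let π₁ : E × E →L[ℝ] E := ContinuousLinearMap.fst ℝ E E
  let π₂ : E × E →L[ℝ] E := ContinuousLinearMap.snd ℝ E E
  let L : E × E →L[ℝ] E × E :=
    ((2 * c) • π₁ - B.comp (π₁ - π₂) - η • π₁).prod ((2 * c) • π₂ + B.comp (π₁ - π₂) - η • π₂)
  obtain ⟨CT, hT⟩ := lipschitz_sums_map hJ₁ hJ₂ (2 * c) L
  let _ : MeasurableSpace (E × E) := borel (E × E)
  have : BorelSpace (E × E) := ⟨rfl⟩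
  have hJ : LipschitzWith 4 (fun ξ : E × E => (J₁ ξ.1, J₂ ξ.2)) := by
    have := (hJ₁.comp LipschitzWith.prod_fst).prodMk (hJ₂.comp LipschitzWith.prod_snd)
    simpa using this
  obtain ⟨⟨p₁, p₂⟩, hp, hdiff⟩ := exists_small_forall_differentiableAt hT hJ
    (ρ := η * s / 4) (by positivity)
  have hp₁ : ‖p₁‖ < η * s / 4 := (norm_fst_le (p₁, p₂)).trans_lt hp
  have hp₂ : ‖p₂‖ < η * s / 4 := (norm_snd_le (p₁, p₂)).trans_lt hp
  set q : E → E → ℝ := fun x y => 1 / 2 * inner ℝ (B (x - y)) (x - y) +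
    η / 2 * (‖x‖ ^ 2 + ‖y‖ ^ 2) + inner ℝ p₁ x + inner ℝ p₂ y with hq
  have hsmall : ∀ x y, U₁ 0 + U₂ 0 ≤ U₁ x + U₂ y - q x y → ‖x‖ + ‖y‖ ≤ s := by
    intro x y h1
    have h2 := hsum x y
    have h3 := (abs_le.1 (abs_real_inner_le_norm p₁ x)).1
    have h4 := (abs_le.1 (abs_real_inner_le_norm p₂ y)).1
    simp only [hq] at h1
    have h5 : ‖p₁‖ * ‖x‖ ≤ η * s / 4 * ‖x‖ := by gcongr
    have h6 : ‖p₂‖ * ‖y‖ ≤ η * s / 4 * ‖y‖ := by gcongr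
    have h7 : η / 2 * (‖x‖ ^ 2 + ‖y‖ ^ 2) ≤ η * s / 4 * (‖x‖ + ‖y‖) := by linarith
    have h8 : η / 4 * (‖x‖ + ‖y‖) ^ 2 ≤ η / 2 * (‖x‖ ^ 2 + ‖y‖ ^ 2) := by
      nlinarith [mul_nonneg hη.le (sq_nonneg (‖x‖ - ‖y‖))]
    by_contra! h9
    have h10 : 0 < η * (‖x‖ + ‖y‖) := mul_pos hη (hs.trans h9)
    linarith [mul_lt_mul_of_pos_left h9 h10]
  have hq0 : q 0 0 = 0 := by simp [hq]
  obtain ⟨⟨x, y⟩, hmax⟩ : ∃ ξ : E × E, ∀ z : E × E,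
      U₁ z.1 + U₂ z.2 - q z.1 z.2 ≤ U₁ ξ.1 + U₂ ξ.2 - q ξ.1 ξ.2 := by
    have hcont : Continuous (fun z : E × E => U₁ z.1 + U₂ z.2 - q z.1 z.2) := by
      simp only [hq]
      fun_prop
    refine hcont.exists_forall_ge' (0 : E × E) ?_
    filter_upwards [(isCompact_closedBall (0 : E × E) s).compl_mem_cocompact] with z hz
    by_contra! h1
    simp only [Prod.fst_zero, Prod.snd_zero, hq0, sub_zero] at h1
    have h2 := hsmall z.1 z.2 h1.le
    refine hz ?_
    rw [mem_closedBall_zero_iff, Prod.norm_def]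
    exact max_le (by linarith [norm_nonneg z.2]) (by linarith [norm_nonneg z.1])
  have hxy : ‖x‖ + ‖y‖ ≤ s := by
    refine hsmall x y ?_
    have := hmax 0
    simpa [hq0] using this
  have hxs : ‖x‖ ≤ s := by linarith [norm_nonneg y]
  have hys : ‖y‖ ≤ s := by linarith [norm_nonneg x]
  set M := U₁ x + U₂ y - q x y with hM
  have hUq : ∀ z w, U₁ z + U₂ w ≤ q z w + M := fun z w => by
    have := hmax (z, w)
    simp only at this
    linarith
  have hexp := fun x y h l => quadratic_expand hB η p₁ p₂ x y h l
  have hkq : ∀ z w, k₁ z + k₂ w ≤ q z w + M := by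
    intro z w
    set G₁ := B (z - w) + η • z + p₁ with hG₁
    set G₂ := -B (z - w) + η • w + p₂ with hG₂
    obtain ⟨z', hz'⟩ := hV₁ z (z - (1 / (2 * c)) • G₁)
    obtain ⟨w', hw'⟩ := hV₂ w (w - (1 / (2 * c)) • G₂)
    have h1 := hUq z' w'
    have h2 : q z' w' = q z w + (inner ℝ G₁ (z' - z) + inner ℝ G₂ (w' - w)) +
        1 / 2 * (inner ℝ (B (z' - z - (w' - w))) (z' - z - (w' - w)) +
          η * (‖z' - z‖ ^ 2 + ‖w' - w‖ ^ 2)) := by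
      have := hexp z w (z' - z) (w' - w)
      rw [add_sub_cancel, add_sub_cancel] at this
      exact this
    have h3 := hBc (z' - z - (w' - w))
    have h4 : ‖z' - z - (w' - w)‖ ^ 2 ≤ 2 * (‖z' - z‖ ^ 2 + ‖w' - w‖ ^ 2) := by
      have h6 := norm_sub_le (z' - z) (w' - w)
      nlinarith [norm_nonneg (z' - z - (w' - w)), sq_nonneg (‖z' - z‖ - ‖w' - w‖)]
    rw [prox_shift hc] at hz' hw'
    have h6 : η * (‖z' - z‖ ^ 2 + ‖w' - w‖ ^ 2) ≤ c * (‖z' - z‖ ^ 2 + ‖w' - w‖ ^ 2) := by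
      gcongr
    have h7 := mul_le_mul_of_nonneg_left h4 hc.le
    linarith
  have hkx : k₁ x = U₁ x ∧ k₂ y = U₂ y := by
    have h1 := hU₁ x
    have h2 := hU₂ y
    have h3 := hkq x y
    constructor <;> linarith
  set g₁ : E → E →L[ℝ] ℝ := fun z => (2 * c) • innerSL ℝ (z - J₁ z) with hg₁
  set g₂ : E → E →L[ℝ] ℝ := fun z => (2 * c) • innerSL ℝ (z - J₂ z) with hg₂
  have hexpk : ∀ h l, k₁ (x + h) + k₂ (y + l) ≤ k₁ x + k₂ y +
      (inner ℝ (B (x - y) + η • x + p₁) h + inner ℝ (-B (x - y) + η • y + p₂) l) +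
        1 / 2 * (inner ℝ (B (h - l)) (h - l) + η * (‖h‖ ^ 2 + ‖l‖ ^ 2)) := by
    intro h l
    have h1 := hkq (x + h) (y + l)
    have h2 : q (x + h) (y + l) = _ := hexp x y h l
    have h3 : q x y = 1 / 2 * inner ℝ (B (x - y)) (x - y) +
      η / 2 * (‖x‖ ^ 2 + ‖y‖ ^ 2) + inner ℝ p₁ x + inner ℝ p₂ y := rfl
    rw [← h3] at h2
    rw [hkx.1, hkx.2]
    linarith
  have hgr₁ : g₁ x = innerSL ℝ (B (x - y) + η • x + p₁) := by
    refine hasFDerivAt_eq_of_forall_le (hk₁ x) (C := 1 / 2 * (c / 2 + η)) fun d => ?_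
    have h1 := hexpk d 0
    have h2 := hBc d
    simp only [add_zero, sub_zero, inner_zero_right, norm_zero] at h1
    rw [innerSL_apply_apply]
    linarith
  have hgr₂ : g₂ y = innerSL ℝ (-B (x - y) + η • y + p₂) := by
    refine hasFDerivAt_eq_of_forall_le (hk₂ y) (C := 1 / 2 * (c / 2 + η)) fun d => ?_
    have h1 := hexpk 0 d
    have h2 := hBc (0 - d)
    simp only [add_zero, zero_sub, inner_zero_right, norm_zero, norm_neg] at h1 h2
    rw [innerSL_apply_apply]
    linarith
  have hinj : ∀ v w : E, (2 * c) • innerSL ℝ v = innerSL ℝ w → (2 * c) • v = w := by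
    intro v w h
    refine ext_inner_right ℝ fun z => ?_
    have := congrArg (fun f : E →L[ℝ] ℝ => f z) h
    simpa [real_inner_smul_left] using this
  have hTξ : L (x, y) - (2 * c) • (J₁ x, J₂ y) = (p₁, p₂) := by
    have e1 := hinj _ _ hgr₁
    have e2 := hinj _ _ hgr₂
    rw [smul_sub] at e1 e2
    refine Prod.ext ?_ ?_
    · simp only [L, π₁, π₂, ContinuousLinearMap.prod_apply, Prod.fst_sub, Prod.smul_fst,
        _root_.sub_apply, _root_.smul_apply, ContinuousLinearMap.comp_apply,
        ContinuousLinearMap.coe_fst', ContinuousLinearMap.coe_snd']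
      rw [← sub_eq_zero] at e1 ⊢
      rw [← e1]
      module
    · simp only [L, π₁, π₂, ContinuousLinearMap.prod_apply, Prod.snd_sub, Prod.smul_snd,
        _root_.sub_apply, _root_.add_apply, _root_.smul_apply, ContinuousLinearMap.comp_apply,
        ContinuousLinearMap.coe_fst', ContinuousLinearMap.coe_snd']
      rw [← sub_eq_zero] at e2 ⊢
      rw [← e2]
      module
  have hd := hdiff (x, y) hTξ
  have hd₁ : DifferentiableAt ℝ J₁ x := by
    have h1 : DifferentiableAt ℝ (fun z : E => (z, y)) x := by fun_prop
    exact (DifferentiableAt.comp x hd h1).fst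
  have hd₂ : DifferentiableAt ℝ J₂ y := by
    have h1 : DifferentiableAt ℝ (fun z : E => (x, z)) y := by fun_prop
    exact (DifferentiableAt.comp y hd h1).snd
  have hgd : ∀ (J : E → E) (x : E), DifferentiableAt ℝ J x →
      DifferentiableAt ℝ (fun z => (2 * c) • innerSL ℝ (z - J z)) x := by
    intro J x hJ
    have h1 : DifferentiableAt ℝ (fun z => z - J z) x := differentiableAt_id.sub hJ
    have h2 : DifferentiableAt ℝ (fun z => innerSL ℝ (z - J z)) x :=
      (innerSL ℝ (E := E)).differentiableAt.comp x h1
    exact h2.fun_const_smul (2 * c)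
  obtain ⟨H₁, hH₁⟩ := hgd J₁ x hd₁
  obtain ⟨H₂, hH₂⟩ := hgd J₂ y hd₂
  have hH : ∀ h l, H₁ h h + H₂ l l ≤ inner ℝ (B (h - l)) (h - l) + η * (‖h‖ ^ 2 + ‖l‖ ^ 2) := by
    intro h l
    refine second_order_le_of_forall_le hk₁ hk₂ hH₁ hH₂ fun t ht => ?_
    have h1 := hexpk (t • h) (t • l)
    have e1 : g₁ x h = inner ℝ (B (x - y) + η • x + p₁) h := by rw [hgr₁, innerSL_apply_apply]
    have e2 : g₂ y l = inner ℝ (-B (x - y) + η • y + p₂) l := by rw [hgr₂, innerSL_apply_apply]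
    have e1' : ((2 * c) • innerSL ℝ (x - J₁ x)) h = _ := e1
    have e2' : ((2 * c) • innerSL ℝ (y - J₂ y)) l = _ := e2
    rw [e1', e2']
    rw [← smul_sub, map_smul, real_inner_smul_left, real_inner_smul_right, real_inner_smul_right,
      real_inner_smul_right, norm_smul, norm_smul, mul_pow, mul_pow, Real.norm_eq_abs,
      sq_abs] at h1
    linarith
  have hac : ∀ x ∈ K, a x ≤ c / 4 * ‖x‖ ^ 2 := fun x hx => by
    have h1 := hab x hx 0 h0
    have h2 := hβc (x - 0)
    rw [sub_zero] at h1 h2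
    linarith
  have hbc : ∀ x ∈ K, b x ≤ c / 4 * ‖x‖ ^ 2 := fun x hx => by
    have h1 := hab 0 h0 x hx
    have h2 := hβc (0 - x)
    rw [zero_sub, norm_neg] at h2
    rw [zero_sub] at h1
    linarith
  obtain ⟨x', hx1, hx2, hx3⟩ := exists_jet_of_supConv_touch hc hr.le hK ha ha0 hac hk₁ hH₁ hU₁
    hkx.1 (by linarith) (ε := η / 2) (by positivity)
  obtain ⟨y', hy1, hy2, hy3⟩ := exists_jet_of_supConv_touch hc hr.le hK hb hb0 hbc hk₂ hH₂ hU₂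
    hkx.2 (by linarith) (ε := η / 2) (by positivity)
  have hxsq : ‖x‖ ^ 2 ≤ s ^ 2 := by gcongr
  have hysq : ‖y‖ ^ 2 ≤ s ^ 2 := by gcongr
  have hBxy : ‖B (x - y)‖ ≤ ‖B‖ * s := by
    refine (B.le_opNorm _).trans ?_
    gcongr
    exact (norm_sub_le x y).trans hxy
  let I : E →L[ℝ] E →L[ℝ] ℝ :=
    (isBoundedBilinearMap_inner (𝕜 := ℝ) (E := E)).toContinuousLinearMap
  have hI : ∀ h l, I h l = inner ℝ h l := fun h l => rfl
  let X : E →L[ℝ] E →L[ℝ] ℝ := (1 / 2 : ℝ) • (H₁ + H₁.flip) + η • I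
  let Y : E →L[ℝ] E →L[ℝ] ℝ := (1 / 2 : ℝ) • (H₂ + H₂.flip) + η • I
  have hX : ∀ h l, X h l = 1 / 2 * (H₁ h l + H₁ l h) + η * inner ℝ h l := by
    intro h l; simp only [X, hI, _root_.add_apply, _root_.smul_apply, ContinuousLinearMap.flip_apply,
      smul_eq_mul]
  have hY : ∀ h l, Y h l = 1 / 2 * (H₂ h l + H₂ l h) + η * inner ℝ h l := by
    intro h l; simp only [Y, hI, _root_.add_apply, _root_.smul_apply, ContinuousLinearMap.flip_apply,
      smul_eq_mul]
  refine ⟨x', y', g₁ x, g₂ y, X, Y, by linarith, by linarith, ?_, ?_, ?_, ?_, ?_, ?_, ?_, ?_, ?_⟩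
  · linarith [mul_le_mul_of_nonneg_left hxsq (mul_pos two_pos hc).le]
  · linarith [mul_le_mul_of_nonneg_left hysq (mul_pos two_pos hc).le]
  · rw [hgr₁, innerSL_apply_norm]
    have h1 := norm_add₃_le (a := B (x - y)) (b := η • x) (c := p₁)
    rw [norm_smul, Real.norm_eq_abs, abs_of_pos hη] at h1
    linarith [mul_le_mul_of_nonneg_left hxs hη.le, mul_pos hη hs]
  · rw [hgr₂, innerSL_apply_norm]
    have h1 := norm_add₃_le (a := -B (x - y)) (b := η • y) (c := p₂)
    rw [norm_smul, Real.norm_eq_abs, abs_of_pos hη, norm_neg] at h1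
    linarith [mul_le_mul_of_nonneg_left hys hη.le, mul_pos hη hs]
  · intro h l; rw [hX, hX, real_inner_comm]; ring
  · intro h l; rw [hY, hY, real_inner_comm]; ring
  · filter_upwards [hx3] with d hd
    rw [hX, real_inner_self_eq_norm_sq]
    linarith
  · filter_upwards [hy3] with d hd
    rw [hY, real_inner_self_eq_norm_sq]
    linarith
  · intro h l
    rw [hX, hY, real_inner_self_eq_norm_sq, real_inner_self_eq_norm_sq]
    have h1 := hH h l
    have h2 : 2 * η * (‖h‖ ^ 2 + ‖l‖ ^ 2) ≤ τ * (‖h‖ ^ 2 + ‖l‖ ^ 2) := by gcongr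
    linarith

end Sums

section PucciAlgebra

variable {n : ℕ} {lam Lam : ℝ}

/-- The matrix of a bilinear form on `ℝⁿ`. -/
def bmat (H : En n →L[ℝ] En n →L[ℝ] ℝ) : Mat n :=
  Matrix.of fun i j => H (EuclideanSpace.single i 1) (EuclideanSpace.single j 1)

/-- `m` is a lower bound of the Pucci minimal operator at the bilinear form `H`. -/
def PucciLB (lam Lam : ℝ) (H : En n →L[ℝ] En n →L[ℝ] ℝ) (m : ℝ) : Prop :=
  ∀ (v : OrthonormalBasis (Fin n) ℝ (En n)) (μ : Fin n → ℝ), (∀ k, μ k ∈ Icc lam Lam) →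
    m ≤ -∑ k, μ k * H (v k) (v k)

theorem bmat_sub (H K : En n →L[ℝ] En n →L[ℝ] ℝ) : bmat (H - K) = bmat H - bmat K := by
  ext i j; simp [bmat]

theorem bmat_neg (H : En n →L[ℝ] En n →L[ℝ] ℝ) : bmat (-H) = -bmat H := by
  ext i j; simp [bmat]

theorem bmat_smul (t : ℝ) (H : En n →L[ℝ] En n →L[ℝ] ℝ) : bmat (t • H) = t • bmat H := by
  ext i j; simp [bmat]

theorem bmat_isSymm {H : En n →L[ℝ] En n →L[ℝ] ℝ} (hH : ∀ x y, H x y = H y x) :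
    (bmat H).IsSymm := by
  ext i j; simp [bmat, hH (EuclideanSpace.single i 1)]

theorem apply_eq_sum_bmat (H : En n →L[ℝ] En n →L[ℝ] ℝ) (v w : En n) :
    H v w = ∑ i, ∑ j, v i * w j * bmat H i j := by
  have h : ∀ v : En n, v = ∑ i, v i • EuclideanSpace.single i (1 : ℝ) := by
    intro v
    have := (EuclideanSpace.basisFun (Fin n) ℝ).sum_repr v
    simpa using this.symm
  conv_lhs => rw [h v, h w]
  simp only [map_sum, map_smul, _root_.sum_apply, _root_.smul_apply, smul_eq_mul,
    bmat, Matrix.of_apply, Finset.mul_sum]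
  rw [Finset.sum_comm]
  refine Finset.sum_congr rfl fun i _ => Finset.sum_congr rfl fun j _ => by ring

theorem exists_trace_eq_sum {A : Mat n} (hA : A ∈ PucciMatrices n lam Lam) :
    ∃ (v : OrthonormalBasis (Fin n) ℝ (En n)) (μ : Fin n → ℝ), (∀ k, μ k ∈ Icc lam Lam) ∧
      ∀ H : En n →L[ℝ] En n →L[ℝ] ℝ, (A * bmat H).trace = ∑ k, μ k * H (v k) (v k) := by
  obtain ⟨hA, hμ⟩ := hA
  refine ⟨hA.eigenvectorBasis, hA.eigenvalues, hμ, fun H => ?_⟩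
  have h1 : ∀ i j, A i j = ∑ k, hA.eigenvalues k * (hA.eigenvectorBasis k i *
      hA.eigenvectorBasis k j) := by
    intro i j
    have h2 := congrFun (congrFun hA.spectral_theorem i) j
    rw [h2]
    simp [Matrix.mul_apply, Matrix.diagonal_apply, Unitary.conjStarAlgAut_apply,
      Matrix.IsHermitian.eigenvectorUnitary_apply]
    refine Finset.sum_congr rfl fun k _ => by ring
  simp only [Matrix.trace, Matrix.diag, Matrix.mul_apply, h1, apply_eq_sum_bmat H,
    Finset.mul_sum, Finset.sum_mul]
  rw [Finset.sum_comm]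
  have h3 : ∀ i, ∑ j, ∑ k, hA.eigenvalues k * (hA.eigenvectorBasis k j *
      hA.eigenvectorBasis k i) * bmat H i j = ∑ k, ∑ j, hA.eigenvalues k *
      (hA.eigenvectorBasis k j * hA.eigenvectorBasis k i) * bmat H i j :=
    fun i => Finset.sum_comm
  simp only [h3]
  rw [Finset.sum_comm]
  refine Finset.sum_congr rfl fun k _ => Finset.sum_congr rfl fun i _ =>
    Finset.sum_congr rfl fun j _ => by ring

theorem pucciMatrices_nonempty (h : lam ≤ Lam) : (PucciMatrices n lam Lam).Nonempty := by
  have hA : (lam • (1 : Mat n)).IsHermitian := by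
    rw [Matrix.IsHermitian, Matrix.conjTranspose_smul, Matrix.conjTranspose_one, star_trivial]
  refine ⟨lam • (1 : Mat n), hA, fun i => ?_⟩
  have h1 := hA.mulVec_eigenvectorBasis i
  have h2 : lam = hA.eigenvalues i := by
    have h3 : hA.eigenvectorBasis i ≠ 0 := hA.eigenvectorBasis.orthonormal.ne_zero i
    have h4 : (lam - hA.eigenvalues i) • hA.eigenvectorBasis i = 0 := by
      ext j
      have := congrFun h1 j
      simp [Matrix.smul_mulVec] at this
      simp only [PiLp.smul_apply, smul_eq_mul, PiLp.zero_apply]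
      rcases this with h | h
      · rw [sub_eq_zero.2 h, zero_mul]
      · rw [h, mul_zero]
    rcases smul_eq_zero.1 h4 with h | h
    · linarith
    · exact absurd h h3
  rw [← h2]
  exact ⟨le_rfl, h⟩

theorem UniformlyElliptic.le_sub (hle : lam ≤ Lam) {F : Mat n → ℝ}
    (hF : UniformlyElliptic n lam Lam F) {X Y : En n →L[ℝ] En n →L[ℝ] ℝ}
    (hX : ∀ h l, X h l = X l h) (hY : ∀ h l, Y h l = Y l h) {m : ℝ}
    (hm : PucciLB lam Lam (X - Y) m) : m ≤ F (bmat X) - F (bmat Y) := by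
  refine le_trans ?_ (hF (bmat X) (bmat Y) (bmat_isSymm hX) (bmat_isSymm hY)).1
  rw [← bmat_sub]
  refine le_csInf ((pucciMatrices_nonempty hle).image _) ?_
  rintro _ ⟨A, hA, rfl⟩
  obtain ⟨v, μ, hμ, h⟩ := exists_trace_eq_sum hA
  simp only [h]
  exact hm v μ hμ


theorem PucciLB.add {H K : En n →L[ℝ] En n →L[ℝ] ℝ} {m m' : ℝ} (h : PucciLB lam Lam H m)
    (h' : PucciLB lam Lam K m') : PucciLB lam Lam (H + K) (m + m') := by
  intro v μ hμ
  have h1 := h v μ hμ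
  have h2 := h' v μ hμ
  simp only [_root_.add_apply, mul_add, Finset.sum_add_distrib]
  linarith

theorem PucciLB.smul {H : En n →L[ℝ] En n →L[ℝ] ℝ} {m t : ℝ} (h : PucciLB lam Lam H m)
    (ht : 0 ≤ t) : PucciLB lam Lam (t • H) (t * m) := by
  intro v μ hμ
  have h1 := mul_le_mul_of_nonneg_left (h v μ hμ) ht
  simp only [_root_.smul_apply, smul_eq_mul]
  rw [mul_neg, Finset.mul_sum] at h1
  refine h1.trans_eq ?_
  congr 1
  refine Finset.sum_congr rfl fun k _ => by ring

theorem PucciLB.congr {H K : En n →L[ℝ] En n →L[ℝ] ℝ} {m : ℝ} (h : PucciLB lam Lam H m)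
    (hHK : ∀ x, K x x ≤ H x x) (hlam : 0 ≤ lam) : PucciLB lam Lam K m := by
  intro v μ hμ
  refine (h v μ hμ).trans (neg_le_neg (Finset.sum_le_sum fun k _ => ?_))
  exact mul_le_mul_of_nonneg_left (hHK _) (hlam.trans (hμ k).1)

theorem psd_apply_le_sum {P : En n →L[ℝ] En n →L[ℝ] ℝ} (hs : ∀ x y, P x y = P y x)
    (hP : ∀ x, 0 ≤ P x x) (v : OrthonormalBasis (Fin n) ℝ (En n)) (e : En n) :
    P e e ≤ ‖e‖ ^ 2 * ∑ k, P (v k) (v k) := by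
  set c : Fin n → ℝ := fun k => v.repr e k with hc
  have h1 : e = ∑ k, c k • v k := (v.sum_repr e).symm
  have h2 : ‖e‖ ^ 2 = ∑ k, c k ^ 2 := by
    rw [← v.repr.norm_map e, EuclideanSpace.norm_sq_eq]
    simp [hc]
  have h3 : P e e = ∑ j, ∑ k, c j * c k * P (v j) (v k) := by
    conv_lhs => rw [h1]
    simp only [map_sum, map_smul, _root_.sum_apply, _root_.smul_apply, smul_eq_mul,
      Finset.mul_sum]
    rw [Finset.sum_comm]
    refine Finset.sum_congr rfl fun i _ => Finset.sum_congr rfl fun j _ => by ring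
  have h4 : 0 ≤ ∑ j, ∑ k, (c k ^ 2 * P (v j) (v j) + c j ^ 2 * P (v k) (v k) -
      2 * (c j * c k * P (v j) (v k))) := by
    refine Finset.sum_nonneg fun j _ => Finset.sum_nonneg fun k _ => ?_
    have h5 := hP (c k • v j - c j • v k)
    simp only [map_sub, map_smul, _root_.sub_apply, _root_.smul_apply, smul_eq_mul,
      hs (v k) (v j)] at h5
    nlinarith
  have h5 : ∑ j, ∑ k, c k ^ 2 * P (v j) (v j) = ‖e‖ ^ 2 * ∑ k, P (v k) (v k) := by
    rw [h2, Finset.sum_mul_sum, Finset.sum_comm]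
  have h6 : ∑ j, ∑ k, c j ^ 2 * P (v k) (v k) = ‖e‖ ^ 2 * ∑ k, P (v k) (v k) := by
    rw [h2, Finset.sum_mul_sum]
  simp only [Finset.sum_add_distrib, Finset.sum_sub_distrib, ← Finset.mul_sum] at h4
  simp only [← Finset.mul_sum] at h3 h5 h6
  rw [h5, h6] at h4
  linarith

theorem pucciLB_of_dir (hlam : 0 < lam) {H : En n →L[ℝ] En n →L[ℝ] ℝ}
    (hs : ∀ x y, H x y = H y x) {κ : ℝ} (hκ : 0 ≤ κ) (hH : ∀ x, H x x ≤ κ * ‖x‖ ^ 2)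
    {e : En n} (he : ‖e‖ ≤ 1) : PucciLB lam Lam H (-lam * H e e - κ * (Lam * n)) := by
  intro v μ hμ
  let I : En n →L[ℝ] En n →L[ℝ] ℝ :=
    (isBoundedBilinearMap_inner (𝕜 := ℝ) (E := En n)).toContinuousLinearMap
  have hI : ∀ h l, I h l = inner ℝ h l := fun h l => rfl
  have hPa : ∀ x y, (κ • I - H) x y = κ * inner ℝ x y - H x y := fun x y => by simp [hI]
  have h1 := psd_apply_le_sum (P := κ • I - H) (fun x y => by
    rw [hPa, hPa, hs, real_inner_comm]) (fun x => by
    rw [hPa, real_inner_self_eq_norm_sq]; linarith [hH x]) v e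
  have h2 : ∀ k, (κ • I - H) (v k) (v k) = κ - H (v k) (v k) := fun k => by
    rw [hPa, real_inner_self_eq_norm_sq, v.norm_eq_one]; ring
  have h3 : ∀ k, 0 ≤ κ - H (v k) (v k) := fun k => by
    have := hH (v k)
    rw [v.norm_eq_one] at this
    linarith
  simp only [h2] at h1
  rw [hPa, real_inner_self_eq_norm_sq] at h1
  have h4 : 0 ≤ ∑ k, (κ - H (v k) (v k)) := Finset.sum_nonneg fun k _ => h3 k
  have h5 : ‖e‖ ^ 2 * ∑ k, (κ - H (v k) (v k)) ≤ ∑ k, (κ - H (v k) (v k)) := by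
    have : ‖e‖ ^ 2 ≤ 1 := by nlinarith [norm_nonneg e]
    nlinarith
  have h6 : lam * ∑ k, (κ - H (v k) (v k)) ≤ ∑ k, μ k * (κ - H (v k) (v k)) := by
    rw [Finset.mul_sum]
    exact Finset.sum_le_sum fun k _ => mul_le_mul_of_nonneg_right (hμ k).1 (h3 k)
  have h7 : ∑ k, μ k * (κ - H (v k) (v k)) = (∑ k, μ k) * κ - ∑ k, μ k * H (v k) (v k) := by
    rw [Finset.sum_mul, ← Finset.sum_sub_distrib]
    exact Finset.sum_congr rfl fun k _ => by ring
  have h8 : ∑ k, μ k ≤ Lam * n := by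
    refine (Finset.sum_le_sum fun k _ => (hμ k).2).trans ?_
    simp [mul_comm]
  have h9 := mul_le_mul_of_nonneg_right h8 hκ
  have h10 : lam * (κ * ‖e‖ ^ 2 - H e e) ≤ lam * ∑ k, (κ - H (v k) (v k)) :=
    mul_le_mul_of_nonneg_left (h1.trans h5) hlam.le
  have h11 : 0 ≤ lam * (κ * ‖e‖ ^ 2) := by positivity
  linarith

theorem pucciLB_of_le (hlam : 0 < lam) {H : En n →L[ℝ] En n →L[ℝ] ℝ} {κ : ℝ} (hκ : 0 ≤ κ)
    (hH : ∀ x, H x x ≤ κ * ‖x‖ ^ 2) : PucciLB lam Lam H (-(κ * (Lam * n))) := by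
  intro v μ hμ
  refine neg_le_neg ?_
  calc ∑ k, μ k * H (v k) (v k) ≤ ∑ k, Lam * κ := by
        refine Finset.sum_le_sum fun k _ => ?_
        have h1 := hH (v k)
        rw [v.norm_eq_one, one_pow, mul_one] at h1
        have h2 := (hμ k)
        nlinarith [h2.1, h2.2]
    _ = κ * (Lam * n) := by simp; ring

/-- The inner product as a bilinear form. -/
def idForm (n : ℕ) : En n →L[ℝ] En n →L[ℝ] ℝ :=
  (isBoundedBilinearMap_inner (𝕜 := ℝ) (E := En n)).toContinuousLinearMap

theorem idForm_apply (x y : En n) : idForm n x y = inner ℝ x y := rfl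

/-- The reflected operator `M ↦ -F(-M)`. -/
def Frefl (F : Mat n → ℝ) : Mat n → ℝ := fun M => -F (-M)

theorem Frefl_Frefl (F : Mat n → ℝ) : Frefl (Frefl F) = F := by
  funext M; simp [Frefl]

theorem UniformlyElliptic.refl {F : Mat n → ℝ} (hF : UniformlyElliptic n lam Lam F) :
    UniformlyElliptic n lam Lam (Frefl F) := by
  intro M N hM hN
  have h := hF (-N) (-M) hN.neg hM.neg
  have e1 : -N - -M = M - N := by abel
  have e2 : Frefl F M - Frefl F N = F (-N) - F (-M) := by simp only [Frefl]; ring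
  rw [e1] at h
  rw [e2]
  exact h

theorem PositivelyHomogeneous.refl {F : Mat n → ℝ} (hF : PositivelyHomogeneous n F) :
    PositivelyHomogeneous n (Frefl F) := by
  intro M η hη
  simp only [Frefl]
  rw [← smul_neg, hF _ _ hη]
  ring

/-- Subsolutions of `F(D²u) - (1/2) y·Du - α u - f = 0` in `ℝⁿ`, formulated with second-order
superjets. -/
def JSub (F : Mat n → ℝ) (α : ℝ) (f u : En n → ℝ) : Prop :=
  ∀ (y : En n) (p : En n →L[ℝ] ℝ) (X : En n →L[ℝ] En n →L[ℝ] ℝ), (∀ h l, X h l = X l h) →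
    (∀ᶠ d in 𝓝 (0 : En n), u (y + d) ≤ u y + p d + 1 / 2 * X d d) →
    F (bmat X) - 1 / 2 * p y - α * u y - f y ≤ 0

/-- Supersolutions, by reflection. -/
def JSup (F : Mat n → ℝ) (α : ℝ) (f u : En n → ℝ) : Prop :=
  JSub (Frefl F) α (fun y => -f y) (fun y => -u y)

theorem jSup_iff {F : Mat n → ℝ} {α : ℝ} {f u : En n → ℝ} : JSup F α f u ↔
    ∀ (y : En n) (p : En n →L[ℝ] ℝ) (X : En n →L[ℝ] En n →L[ℝ] ℝ), (∀ h l, X h l = X l h) →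
    (∀ᶠ d in 𝓝 (0 : En n), u y + p d + 1 / 2 * X d d ≤ u (y + d)) →
    0 ≤ F (bmat X) - 1 / 2 * p y - α * u y - f y := by
  constructor
  · intro h y p X hX hj
    have h1 := h y (-p) (-X) (fun a b => by simp [hX a b]) (by
      filter_upwards [hj] with d hd
      simp only [_root_.neg_apply]
      linarith)
    simp only [Frefl, bmat_neg, neg_neg, _root_.neg_apply] at h1
    linarith
  · intro h y p X hX hj
    have h1 := h y (-p) (-X) (fun a b => by simp [hX a b]) (by
      filter_upwards [hj] with d hd
      simp only [_root_.neg_apply]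
      linarith)
    simp only [Frefl, bmat_neg, _root_.neg_apply] at h1 ⊢
    linarith

theorem hess_eq_bmat {φ : En n → ℝ} (hφ : ContDiff ℝ 2 φ) (y : En n) :
    hess n φ y = bmat (fderiv ℝ (fderiv ℝ φ) y) := by
  have hd : DifferentiableAt ℝ (fderiv ℝ φ) y :=
    ((hφ.fderiv_right (m := 1) (by norm_num)).differentiable (by norm_num)).differentiableAt
  ext i j
  simp only [hess, bmat, Matrix.of_apply]
  have h1 : HasFDerivAt (fun z => fderiv ℝ φ z (EuclideanSpace.single j 1))
      ((fderiv ℝ (fderiv ℝ φ) y).flip (EuclideanSpace.single j 1)) y := by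
    have h2 := hd.hasFDerivAt.clm_apply (hasFDerivAt_const (EuclideanSpace.single j (1 : ℝ)) y)
    refine h2.congr_fderiv ?_
    ext z
    simp
  rw [h1.fderiv]
  rfl

theorem quad_hasFDerivAt {p : En n →L[ℝ] ℝ} {X : En n →L[ℝ] En n →L[ℝ] ℝ}
    (hX : ∀ h l, X h l = X l h) (c : ℝ) (y z : En n) :
    HasFDerivAt (fun z => c + p (z - y) + 1 / 2 * X (z - y) (z - y)) (p + X (z - y)) z := by
  have h0 : HasFDerivAt (fun z : En n => z - y) (ContinuousLinearMap.id ℝ (En n)) z :=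
    (hasFDerivAt_id z).sub_const y
  have h1 : HasFDerivAt (fun z => p (z - y)) p z := by
    have h2 := p.hasFDerivAt.comp z h0
    rwa [ContinuousLinearMap.comp_id] at h2
  have h2 : HasFDerivAt (fun z => X (z - y)) X z := by
    have h2 := X.hasFDerivAt.comp z h0
    rwa [ContinuousLinearMap.comp_id] at h2
  have h3 := h2.clm_apply h0
  have h4 := (h1.const_add c).add (h3.const_mul (1 / 2))
  refine h4.congr_fderiv ?_
  ext w
  have e1 := hX z w
  have e2 := hX y w
  simp
  linarith

theorem ViscSubE.jSub {F : Mat n → ℝ} {α : ℝ} {f u : En n → ℝ}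
    (h : ViscSubE n univ (Fop n F α f) u) : JSub F α f u := by
  intro y p X hX hj
  set φ : En n → ℝ := fun z => u y + p (z - y) + 1 / 2 * X (z - y) (z - y) with hφdef
  have hφ : ContDiff ℝ 2 φ := by
    have h1 : ContDiff ℝ 2 (fun z : En n => X (z - y)) := X.contDiff.comp (by fun_prop)
    have h2 : ContDiff ℝ 2 (fun z : En n => X (z - y) (z - y)) := h1.clm_apply (by fun_prop)
    have h3 : ContDiff ℝ 2 (fun z : En n => p (z - y)) := p.contDiff.comp (by fun_prop)
    exact (contDiff_const.add h3).add (contDiff_const.mul h2)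
  have h1 := fun z => quad_hasFDerivAt (p := p) hX (u y) y z
  have h2 : fderiv ℝ φ = fun z => p + X (z - y) := funext fun z => (h1 z).fderiv
  have h3 : fderiv ℝ (fderiv ℝ φ) y = X := by
    rw [h2]
    have h0 : HasFDerivAt (fun z : En n => z - y) (ContinuousLinearMap.id ℝ (En n)) y :=
      (hasFDerivAt_id y).sub_const y
    have h4 := (X.hasFDerivAt.comp y h0).const_add p
    rw [ContinuousLinearMap.comp_id] at h4
    exact h4.fderiv
  have h4 := h y (mem_univ y) φ hφ (by
    rw [isLocalMaxOn_univ_iff]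
    have h5 : Tendsto (fun z => z - y) (𝓝 y) (𝓝 0) := by
      have : Continuous fun z : En n => z - y := by fun_prop
      simpa using this.tendsto y
    filter_upwards [h5.eventually hj] with z hz
    simp only [add_sub_cancel] at hz
    simp only [hφdef, sub_self, map_zero, mul_zero, add_zero]
    linarith)
  rw [hess_eq_bmat hφ, h3, h2] at h4
  simpa [Fop] using h4

theorem ellip_add_id_le (hlam : 0 < lam) (hle : lam ≤ Lam) {F : Mat n → ℝ}
    (hF : UniformlyElliptic n lam Lam F) {X : En n →L[ℝ] En n →L[ℝ] ℝ}
    (hX : ∀ h l, X h l = X l h) {κ : ℝ} (hκ : 0 ≤ κ) :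
    F (bmat X) ≤ F (bmat (X + κ • idForm n)) + κ * (Lam * n) := by
  have h1 := hF.le_sub hle (X := X + κ • idForm n) (Y := X) (m := -(κ * (Lam * n)))
    (fun h l => by simp [hX h l, idForm_apply, real_inner_comm]) hX (by
      have e : X + κ • idForm n - X = κ • idForm n := by ext; simp
      rw [e]
      refine pucciLB_of_le hlam hκ fun x => ?_
      simp [idForm_apply])
  linarith

theorem jet_of_isLocalMax {u φ : En n → ℝ} {φ' : En n → En n →L[ℝ] ℝ}
    {H : En n →L[ℝ] En n →L[ℝ] ℝ} {y : En n} (hφ : ∀ᶠ z in 𝓝 y, HasFDerivAt φ (φ' z) z)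
    (hH : HasFDerivAt φ' H y) (hmax : IsLocalMax (fun z => u z - φ z) y) {ε : ℝ} (hε : 0 < ε) :
    ∀ᶠ d in 𝓝 (0 : En n), u (y + d) ≤ u y + φ' y d + 1 / 2 * (H + ε • idForm n) d d := by
  have h5 : Tendsto (fun d => y + d) (𝓝 (0 : En n)) (𝓝 y) := by
    have : Continuous fun z : En n => y + z := by fun_prop
    simpa using this.tendsto 0
  filter_upwards [h5.eventually hmax, taylor_two_of_hasFDerivAt hφ hH (half_pos hε)] with d h1 h2
  have h3 := (abs_le.1 h2).2
  simp only [_root_.add_apply, _root_.smul_apply, idForm_apply, smul_eq_mul,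
    real_inner_self_eq_norm_sq]
  linarith

theorem JSub.viscSubE (hlam : 0 < lam) (hle : lam ≤ Lam) {F : Mat n → ℝ}
    (hF : UniformlyElliptic n lam Lam F) {α : ℝ} {f u : En n → ℝ} (h : JSub F α f u) :
    ViscSubE n univ (Fop n F α f) u := by
  intro y _ φ hφ hmax
  rw [isLocalMaxOn_univ_iff] at hmax
  rw [hess_eq_bmat hφ]
  have hsym : ∀ a b, fderiv ℝ (fderiv ℝ φ) y a b = fderiv ℝ (fderiv ℝ φ) y b a := fun a b =>
    hφ.contDiffAt.isSymmSndFDerivAt (by simp) a b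
  set X := fderiv ℝ (fderiv ℝ φ) y with hXdef
  have hd : DifferentiableAt ℝ (fderiv ℝ φ) y :=
    ((hφ.fderiv_right (m := 1) (by norm_num)).differentiable (by norm_num)).differentiableAt
  have hd' : ∀ z, HasFDerivAt φ (fderiv ℝ φ z) z := fun z =>
    (hφ.differentiable (by norm_num)).differentiableAt.hasFDerivAt
  have key : ∀ ε : ℝ, 0 < ε → Fop n F α f (bmat X) (fderiv ℝ φ y) (u y) y ≤ ε * (Lam * n) := by
    intro ε hε
    have h1 := h y (fderiv ℝ φ y) (X + ε • idForm n)
      (fun a b => by simp [hsym a b, idForm_apply, real_inner_comm])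
      (jet_of_isLocalMax (Eventually.of_forall hd') hd.hasFDerivAt hmax hε)
    have h2 := ellip_add_id_le hlam hle hF hsym hε.le
    simp only [Fop]
    linarith
  have hc : Tendsto (fun ε : ℝ => ε * (Lam * n)) (𝓝[>] 0) (𝓝 0) := by
    have : Continuous fun ε : ℝ => ε * (Lam * n) := by fun_prop
    have h1 := this.tendsto 0
    rw [zero_mul] at h1
    exact h1.mono_left nhdsWithin_le_nhds
  refine ge_of_tendsto hc ?_
  filter_upwards [self_mem_nhdsWithin] with ε hε using key ε hε

theorem hess_neg {φ : En n → ℝ} (y : En n) : hess n (fun z => -φ z) y = -hess n φ y := by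
  have h1 : fderiv ℝ (fun z => -φ z) = fun z => -fderiv ℝ φ z := by
    funext z
    exact fderiv_fun_neg
  ext i j
  simp only [hess, Matrix.of_apply, Matrix.neg_apply]
  have h2 : (fun z => fderiv ℝ (fun z => -φ z) z (EuclideanSpace.single j 1)) =
      fun z => -(fderiv ℝ φ z (EuclideanSpace.single j 1)) := by
    funext z
    rw [h1]
    rfl
  rw [h2, fderiv_fun_neg]
  rfl

theorem viscSupE_iff_refl {F : Mat n → ℝ} {α : ℝ} {f u : En n → ℝ} :
    ViscSupE n univ (Fop n F α f) u ↔
      ViscSubE n univ (Fop n (Frefl F) α (fun y => -f y)) (fun y => -u y) := by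
  have h1 : ∀ (φ : En n → ℝ) (y : En n), fderiv ℝ (fun z => -φ z) y = -fderiv ℝ φ y :=
    fun φ y => fderiv_fun_neg
  constructor
  · intro h y hy φ hφ hmax
    have h2 := h y hy (fun z => -φ z) hφ.neg (by
      filter_upwards [hmax] with z hz
      linarith)
    rw [hess_neg, h1] at h2
    simp only [Fop, Frefl, _root_.neg_apply] at h2 ⊢
    linarith
  · intro h y hy φ hφ hmin
    have h2 := h y hy (fun z => -φ z) hφ.neg (by
      filter_upwards [hmin] with z hz
      linarith)
    rw [hess_neg, h1] at h2
    simp only [Fop, Frefl, _root_.neg_apply, neg_neg] at h2 ⊢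
    linarith

theorem viscSubE_iff_jSub (hlam : 0 < lam) (hle : lam ≤ Lam) {F : Mat n → ℝ}
    (hF : UniformlyElliptic n lam Lam F) {α : ℝ} {f u : En n → ℝ} :
    ViscSubE n univ (Fop n F α f) u ↔ JSub F α f u :=
  ⟨fun h => h.jSub, fun h => h.viscSubE hlam hle hF⟩

theorem viscSupE_iff_jSup (hlam : 0 < lam) (hle : lam ≤ Lam) {F : Mat n → ℝ}
    (hF : UniformlyElliptic n lam Lam F) {α : ℝ} {f u : En n → ℝ} :
    ViscSupE n univ (Fop n F α f) u ↔ JSup F α f u := by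
  rw [viscSupE_iff_refl, viscSubE_iff_jSub hlam hle hF.refl, JSup]

end PucciAlgebra

section PSubSection

variable {n : ℕ} {lam Lam : ℝ}

/-- Subsolutions of `P⁻(D²w) - (1/2) y·Dw - α w = f`, formulated with superjets. -/
def PSub (lam Lam α : ℝ) (f w : En n → ℝ) : Prop :=
  ∀ (y : En n) (p : En n →L[ℝ] ℝ) (X : En n →L[ℝ] En n →L[ℝ] ℝ), (∀ h l, X h l = X l h) →
    (∀ᶠ d in 𝓝 (0 : En n), w (y + d) ≤ w y + p d + 1 / 2 * X d d) →
    ∀ m, PucciLB lam Lam X m → m - 1 / 2 * p y - α * w y ≤ f y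

theorem PositivelyHomogeneous.zero {F : Mat n → ℝ} (hF : PositivelyHomogeneous n F) :
    F 0 = 0 := by
  have := hF 0 0 le_rfl
  simpa using this

theorem UniformlyElliptic.le_apply (hle : lam ≤ Lam) {F : Mat n → ℝ}
    (hF : UniformlyElliptic n lam Lam F) (hFh : PositivelyHomogeneous n F)
    {X : En n →L[ℝ] En n →L[ℝ] ℝ} (hX : ∀ h l, X h l = X l h) {m : ℝ}
    (hm : PucciLB lam Lam X m) : m ≤ F (bmat X) := by
  have h1 := hF.le_sub hle (X := X) (Y := 0) (m := m) hX (fun _ _ => rfl) (by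
    have e : X - 0 = X := by ext; simp
    rwa [e])
  have h2 : bmat (0 : En n →L[ℝ] En n →L[ℝ] ℝ) = 0 := by ext; simp [bmat]
  rw [h2, hFh.zero] at h1
  linarith

theorem JSub.pSub (hle : lam ≤ Lam) {F : Mat n → ℝ}
    (hF : UniformlyElliptic n lam Lam F) (hFh : PositivelyHomogeneous n F) {α : ℝ}
    {f u : En n → ℝ} (h : JSub F α f u) : PSub lam Lam α f u := by
  intro y p X hX hj m hm
  have h1 := h y p X hX hj
  have h2 := hF.le_apply hle hFh hX hm
  linarith

theorem le_of_forall_add_mul {a b c : ℝ} (h : ∀ ε : ℝ, 0 < ε → a ≤ b + ε * c) : a ≤ b := by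
  have hc : Tendsto (fun ε : ℝ => b + ε * c) (𝓝[>] 0) (𝓝 b) := by
    have : Continuous fun ε : ℝ => b + ε * c := by fun_prop
    have h1 := this.tendsto 0
    rw [zero_mul, add_zero] at h1
    exact h1.mono_left nhdsWithin_le_nhds
  refine ge_of_tendsto hc ?_
  filter_upwards [self_mem_nhdsWithin] with ε hε using h ε hε

theorem PucciLB.add_smul_id (hlam : 0 < lam) {X : En n →L[ℝ] En n →L[ℝ] ℝ} {m κ : ℝ}
    (h : PucciLB lam Lam X m) (hκ : 0 ≤ κ) :
    PucciLB lam Lam (X + κ • idForm n) (m - κ * (Lam * n)) := by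
  rw [sub_eq_add_neg]
  refine h.add (pucciLB_of_le hlam hκ fun x => ?_)
  simp [idForm_apply]

theorem PSub.touch (hlam : 0 < lam) {α : ℝ} {f w : En n → ℝ} (h : PSub lam Lam α f w)
    {φ : En n → ℝ} {φ' : En n → En n →L[ℝ] ℝ}
    {H : En n →L[ℝ] En n →L[ℝ] ℝ} (hHs : ∀ h l, H h l = H l h) {y : En n}
    (hφ : ∀ᶠ z in 𝓝 y, HasFDerivAt φ (φ' z) z)
    (hH : HasFDerivAt φ' H y) (hmax : IsLocalMax (fun z => w z - φ z) y) {m : ℝ}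
    (hm : PucciLB lam Lam H m) : m - 1 / 2 * φ' y y - α * w y ≤ f y := by
  refine le_of_forall_add_mul (c := Lam * n) fun ε hε => ?_
  have h1 := h y (φ' y) (H + ε • idForm n)
    (fun a b => by simp [hHs a b, idForm_apply, real_inner_comm])
    (jet_of_isLocalMax hφ hH hmax hε) _ (hm.add_smul_id hlam hε.le)
  linarith

theorem JSub.smul {F : Mat n → ℝ} (hFh : PositivelyHomogeneous n F) {α : ℝ}
    {f u : En n → ℝ} (h : JSub F α f u) {t : ℝ} (ht : 0 < t) :
    JSub F α (fun y => t * f y) (fun y => t * u y) := by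
  intro y p X hX hj
  have h1 := h y (t⁻¹ • p) (t⁻¹ • X) (fun a b => by simp [hX a b]) (by
    filter_upwards [hj] with d hd
    have h2 := mul_le_mul_of_nonneg_left hd (inv_pos.2 ht).le
    rw [inv_mul_cancel_left₀ ht.ne', mul_add, mul_add, inv_mul_cancel_left₀ ht.ne'] at h2
    simp only [_root_.smul_apply, smul_eq_mul]
    linarith)
  rw [bmat_smul, hFh _ _ (inv_pos.2 ht).le] at h1
  have h3 := mul_le_mul_of_nonneg_left h1 ht.le
  simp only [_root_.smul_apply, smul_eq_mul] at h3
  rw [mul_zero, mul_sub, mul_sub, mul_sub, mul_inv_cancel_left₀ ht.ne'] at h3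
  have e : t * (1 / 2 * (t⁻¹ * p y)) = 1 / 2 * p y := by
    field_simp
  rw [e] at h3
  linarith

theorem JSup.smul {F : Mat n → ℝ} (hFh : PositivelyHomogeneous n F) {α : ℝ}
    {f u : En n → ℝ} (h : JSup F α f u) {t : ℝ} (ht : 0 < t) :
    JSup F α (fun y => t * f y) (fun y => t * u y) := by
  have h1 := JSub.smul hFh.refl h ht
  simp only [mul_neg] at h1
  exact h1

theorem JSub.congr {F : Mat n → ℝ} {α α' : ℝ} {f f' u : En n → ℝ} (h : JSub F α f u)
    (hf : ∀ y, α * u y + f y ≤ α' * u y + f' y) : JSub F α' f' u := by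
  intro y p X hX hj
  have h1 := h y p X hX hj
  have h2 := hf y
  linarith

theorem JSup.congr {F : Mat n → ℝ} {α α' : ℝ} {f f' u : En n → ℝ} (h : JSup F α f u)
    (hf : ∀ y, α' * u y + f' y ≤ α * u y + f y) : JSup F α' f' u :=
  JSub.congr h fun y => by linarith [hf y]

theorem JSup.add_classical (hlam : 0 < lam) (hle : lam ≤ Lam) {F : Mat n → ℝ}
    (hF : UniformlyElliptic n lam Lam F) {α : ℝ}
    {f v : En n → ℝ} (h : JSup F α f v) {g : En n → ℝ} {g' : En n → En n →L[ℝ] ℝ}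
    {H : En n → En n →L[ℝ] En n →L[ℝ] ℝ} (hg : ∀ z, HasFDerivAt g (g' z) z)
    (hg' : ∀ z, HasFDerivAt g' (H z) z) (hHs : ∀ z h l, H z h l = H z l h) {m : En n → ℝ}
    (hm : ∀ z, PucciLB lam Lam (H z) (m z)) :
    JSup F α (fun y => f y + (m y - 1 / 2 * g' y y - α * g y)) (fun y => v y + g y) := by
  rw [jSup_iff] at h ⊢
  intro y p X hX hj
  suffices hs : f y ≤ F (bmat X) - m y - 1 / 2 * (p y - g' y y) - α * v y by linarith
  refine le_of_forall_add_mul (c := Lam * n) fun ε hε => ?_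
  have hZ : ∀ a b, (X - H y - ε • idForm n) a b = (X - H y - ε • idForm n) b a := fun a b => by
    simp [hX a b, hHs y a b, idForm_apply, real_inner_comm]
  have h1 := h y (p - g' y) (X - H y - ε • idForm n) hZ (by
    filter_upwards [hj, taylor_two_of_hasFDerivAt (Eventually.of_forall hg) (hg' y) (half_pos hε)]
      with d h1 h2
    have h3 := (abs_le.1 h2).2
    simp only [_root_.sub_apply, _root_.smul_apply, idForm_apply, smul_eq_mul,
      real_inner_self_eq_norm_sq]
    linarith)
  have h2 := hF.le_sub hle hX hZ (m := m y - ε * (Lam * n)) (by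
    have e : X - (X - H y - ε • idForm n) = H y + ε • idForm n := by abel
    rw [e]
    exact (hm y).add_smul_id hlam hε.le)
  simp only [_root_.sub_apply] at h1
  linarith

theorem le_zero_of_jet {p : En n →L[ℝ] ℝ} {X : En n →L[ℝ] En n →L[ℝ] ℝ}
    (h : ∀ᶠ d in 𝓝 (0 : En n), p d + 1 / 2 * X d d ≤ 0) (x : En n) : p x = 0 ∧ X x x ≤ 0 := by
  have key : ∀ x : En n, ∀ᶠ t in 𝓝[>] (0 : ℝ), t * p x + 1 / 2 * (t ^ 2 * X x x) ≤ 0 := by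
    intro x
    have h1 : Tendsto (fun t : ℝ => t • x) (𝓝[>] 0) (𝓝 0) := by
      have : Continuous fun t : ℝ => t • x := by fun_prop
      have h1 := this.tendsto 0
      rw [zero_smul] at h1
      exact h1.mono_left nhdsWithin_le_nhds
    filter_upwards [h1.eventually h] with t ht
    simp only [map_smul, _root_.smul_apply, smul_eq_mul] at ht
    linarith
  have h2 : ∀ x : En n, p x ≤ 0 := by
    intro x
    have hc : Tendsto (fun t : ℝ => p x + 1 / 2 * (t * X x x)) (𝓝[>] 0) (𝓝 (p x)) := by
      have : Continuous fun t : ℝ => p x + 1 / 2 * (t * X x x) := by fun_prop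
      have h1 := this.tendsto 0
      rw [zero_mul, mul_zero, add_zero] at h1
      exact h1.mono_left nhdsWithin_le_nhds
    refine le_of_tendsto hc ?_
    filter_upwards [key x, self_mem_nhdsWithin] with t ht ht0
    have ht0 : 0 < t := ht0
    by_contra hcon
    have := mul_pos ht0 (not_le.1 hcon)
    linarith
  have h3 := h2 (-x)
  rw [map_neg] at h3
  have h4 : p x = 0 := le_antisymm (h2 x) (by linarith)
  refine ⟨h4, ?_⟩
  obtain ⟨t, ht, ht0⟩ := ((key x).and self_mem_nhdsWithin).exists
  have ht0 : 0 < t := ht0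
  by_contra hcon
  have := mul_pos (pow_pos ht0 2) (not_le.1 hcon)
  rw [h4] at ht
  linarith

theorem jSup_zero (hlam : 0 < lam) (hle : lam ≤ Lam) {F : Mat n → ℝ}
    (hF : UniformlyElliptic n lam Lam F) (hFh : PositivelyHomogeneous n F) {α : ℝ} :
    JSup F α (fun _ => 0) (fun _ : En n => (0 : ℝ)) := by
  rw [jSup_iff]
  intro y p X hX hj
  have hj' := le_zero_of_jet (p := p) (X := X) (by simpa using hj)
  have h1 := hF.le_apply hle hFh hX (m := 0) (by
    have := pucciLB_of_le (Lam := Lam) hlam (H := X) le_rfl (fun x => by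
      rw [zero_mul]; exact (hj' x).2)
    simpa using this)
  have h2 := (hj' y).1
  linarith

/-- The differential of the Gaussian `exp (-γ |y - c|²)`. -/
def gaussD (γ : ℝ) (c y : En n) : En n →L[ℝ] ℝ :=
  (-2 * γ * Real.exp (-γ * ‖y - c‖ ^ 2)) • idForm n (y - c)

/-- The second differential of the Gaussian `exp (-γ |y - c|²)`. -/
def gaussH (γ : ℝ) (c y : En n) : En n →L[ℝ] En n →L[ℝ] ℝ :=
  (4 * γ ^ 2 * Real.exp (-γ * ‖y - c‖ ^ 2)) • (idForm n (y - c)).smulRight (idForm n (y - c)) +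
    (-2 * γ * Real.exp (-γ * ‖y - c‖ ^ 2)) • idForm n

theorem gaussH_apply (γ : ℝ) (c y h l : En n) : gaussH γ c y h l =
    Real.exp (-γ * ‖y - c‖ ^ 2) * (4 * γ ^ 2 * inner ℝ (y - c) h * inner ℝ (y - c) l -
      2 * γ * inner ℝ h l) := by
  simp only [gaussH, _root_.add_apply, _root_.smul_apply, ContinuousLinearMap.smulRight_apply,
    idForm_apply, smul_eq_mul]
  ring

theorem gaussH_symm (γ : ℝ) (c y h l : En n) : gaussH γ c y h l = gaussH γ c y l h := by
  rw [gaussH_apply, gaussH_apply, real_inner_comm h l]; ring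

theorem gaussD_apply (γ : ℝ) (c y h : En n) : gaussD γ c y h =
    -2 * γ * Real.exp (-γ * ‖y - c‖ ^ 2) * inner ℝ (y - c) h := by
  simp [gaussD, idForm_apply, inner_sub_left]

theorem hasFDerivAt_gauss (γ : ℝ) (c y : En n) :
    HasFDerivAt (fun z : En n => Real.exp (-γ * ‖z - c‖ ^ 2)) (gaussD γ c y) y := by
  have h0 : HasFDerivAt (fun z : En n => z - c) (ContinuousLinearMap.id ℝ (En n)) y :=
    (hasFDerivAt_id y).sub_const c
  have h1 := ((h0.norm_sq).const_mul (-γ)).exp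
  refine h1.congr_fderiv ?_
  ext w
  simp [gaussD_apply, inner_sub_left]
  ring

theorem hasFDerivAt_gaussD (γ : ℝ) (c y : En n) :
    HasFDerivAt (gaussD γ c) (gaussH γ c y) y := by
  have h0 : HasFDerivAt (fun z : En n => z - c) (ContinuousLinearMap.id ℝ (En n)) y :=
    (hasFDerivAt_id y).sub_const c
  have h2 := (idForm n).hasFDerivAt.comp y h0
  have h1 := ((hasFDerivAt_gauss γ c y).const_mul (-2 * γ)).smul h2
  refine h1.congr_fderiv ?_
  ext w z
  simp [gaussH_apply, gaussD_apply, idForm_apply, inner_sub_left]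
  ring

end PSubSection

theorem UpperSemicontinuousOn.exists_penalized_maximizers {T : Type*} [TopologicalSpace T]
    {K : Set T} (hK : IsCompact K) {Ψ θ : T → ℝ} (hΨ : UpperSemicontinuousOn Ψ K)
    (hθ : Continuous θ) (hθ0 : ∀ z, 0 ≤ θ z) {z₀ : T} (hz₀ : z₀ ∈ K) (hθz₀ : θ z₀ = 0)
    (hmax : ∀ z ∈ K, θ z = 0 → z ≠ z₀ → Ψ z < Ψ z₀) :
    ∃ z : ℕ → T, (∀ k, z k ∈ K) ∧
      (∀ k : ℕ, ∀ x ∈ K, Ψ x - k * θ x ≤ Ψ (z k) - k * θ (z k)) ∧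
      Tendsto z atTop (𝓝 z₀) ∧ Tendsto (fun k : ℕ => (k : ℝ) * θ (z k)) atTop (𝓝 0) ∧
      Tendsto (fun k => Ψ (z k)) atTop (𝓝 (Ψ z₀)) := by
  have h1 : ∀ k : ℕ, ∃ z ∈ K, IsMaxOn (fun x => Ψ x - k * θ x) K z := fun k =>
    UpperSemicontinuousOn.exists_isMaxOn ⟨z₀, hz₀⟩ hK (by
      have hc : Continuous fun x => -((k : ℝ) * θ x) := by fun_prop
      simpa only [sub_eq_add_neg] using
        hΨ.add (hc.upperSemicontinuous.upperSemicontinuousOn K))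
  choose z hzK hz using h1
  have h2 : ∀ k : ℕ, Ψ z₀ ≤ Ψ (z k) - k * θ (z k) := fun k => by
    have := hz k hz₀
    simpa [hθz₀] using this
  have h3 : Tendsto z atTop (𝓝 z₀) := by
    refine hK.tendsto_nhds_of_unique_mapClusterPt (Eventually.of_forall hzK) fun y hy hcl => ?_
    have hle : ∀ k : ℕ, Ψ z₀ ≤ Ψ (z k) := fun k => by
      have := mul_nonneg (Nat.cast_nonneg (α := ℝ) k) (hθ0 (z k))
      linarith [h2 k]
    have hfreq : ∀ U ∈ 𝓝[K] y, ∃ᶠ k in atTop, z k ∈ U := by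
      intro U hU
      rw [mem_nhdsWithin_iff_exists_mem_nhds_inter] at hU
      obtain ⟨V, hV, hVU⟩ := hU
      exact (hcl.frequently hV).mono fun k hk => hVU ⟨hk, hzK k⟩
    have hΨy : Ψ z₀ ≤ Ψ y := by
      by_contra hcon
      obtain ⟨k, hk⟩ := (hfreq _ (hΨ y hy _ (not_le.1 hcon))).exists
      exact absurd (hle k) (not_le.2 hk)
    have hθy : θ y = 0 := by
      by_contra hcon
      have hpos : 0 < θ y := lt_of_le_of_ne (hθ0 y) (Ne.symm hcon)
      have hU1 := hΨ y hy (Ψ y + 1) (by linarith)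
      have hU2 : ∀ᶠ x in 𝓝[K] y, θ y / 2 < θ x :=
        nhdsWithin_le_nhds (hθ.continuousAt.eventually (lt_mem_nhds (by linarith)))
      obtain ⟨N, hN⟩ := exists_nat_gt ((Ψ y + 1 - Ψ z₀) / (θ y / 2))
      obtain ⟨k, ⟨hk1, hk2⟩, hk3⟩ :=
        ((hfreq _ (hU1.and hU2)).and_eventually (eventually_ge_atTop N)).exists
      have h4 : (N : ℝ) * (θ y / 2) ≤ k * θ (z k) :=
        mul_le_mul (by exact_mod_cast hk3) hk2.le (by linarith) (Nat.cast_nonneg k)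
      rw [div_lt_iff₀ (by linarith)] at hN
      linarith [h2 k]
    by_contra hne
    exact absurd hΨy (not_le.2 (hmax y hy hθy hne))
  have h4 : ∀ η : ℝ, 0 < η → ∀ᶠ k in atTop, Ψ (z k) < Ψ z₀ + η := by
    intro η hη
    have h5 : Tendsto z atTop (𝓝[K] z₀) :=
      tendsto_nhdsWithin_iff.2 ⟨h3, Eventually.of_forall hzK⟩
    exact h5.eventually (hΨ z₀ hz₀ _ (by linarith))
  have h5 : ∀ k : ℕ, 0 ≤ (k : ℝ) * θ (z k) := fun k =>
    mul_nonneg (Nat.cast_nonneg (α := ℝ) k) (hθ0 (z k))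
  refine ⟨z, hzK, fun k x hx => hz k hx, h3, ?_, ?_⟩
  · rw [Metric.tendsto_nhds]
    intro η hη
    filter_upwards [h4 η hη] with k hk
    rw [Real.dist_eq, sub_zero, abs_of_nonneg (h5 k)]
    linarith [h2 k]
  · rw [Metric.tendsto_nhds]
    intro η hη
    filter_upwards [h4 η hη] with k hk
    rw [Real.dist_eq, abs_lt]
    constructor <;> linarith [h2 k, h5 k]

theorem Filter.Tendsto.clm_apply_apply {ι E G : Type*} [NormedAddCommGroup E] [NormedSpace ℝ E]
    [NormedAddCommGroup G] [NormedSpace ℝ G] {l : Filter ι} {L : ι → E →L[ℝ] G} {L₀ : E →L[ℝ] G}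
    {x : ι → E} {x₀ : E} (hL : Tendsto L l (𝓝 L₀)) (hx : Tendsto x l (𝓝 x₀)) :
    Tendsto (fun k => L k (x k)) l (𝓝 (L₀ x₀)) :=
  ((isBoundedBilinearMap_apply (𝕜 := ℝ) (E := E) (F := G)).continuous.tendsto (L₀, x₀)).comp
    (hL.prodMk_nhds hx)

theorem UpperSemicontinuous.add_continuous {T : Type*} [TopologicalSpace T] {f g : T → ℝ}
    (hf : UpperSemicontinuous f) (hg : Continuous g) : UpperSemicontinuous fun x => f x + g x :=
  hf.add hg.upperSemicontinuous

theorem LowerSemicontinuous.neg_usc {T : Type*} [TopologicalSpace T] {f : T → ℝ}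
    (hf : LowerSemicontinuous f) : UpperSemicontinuous fun x => -f x := by
  intro x c hc
  filter_upwards [hf x (-c) (by linarith)] with z hz
  linarith

section Doubling

variable {n : ℕ} {lam Lam : ℝ}

theorem doubling_ineq (hlam : 0 < lam) (hle : lam ≤ Lam) {F : Mat n → ℝ}
    (hF : UniformlyElliptic n lam Lam F) {α : ℝ} {f g u v : En n → ℝ}
    (hu : JSub F α f u) (hv : JSup F α g v) (hf : Continuous f) (hg : Continuous g)
    (husc : UpperSemicontinuous u) (hlsc : LowerSemicontinuous v)
    {x₀ y₀ : En n} {px py : En n →L[ℝ] ℝ} {H₀ : En n →L[ℝ] En n →L[ℝ] ℝ}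
    (hH₀ : ∀ h l, H₀ h l = H₀ l h) {m₀ : ℝ} (hm₀ : PucciLB lam Lam H₀ m₀)
    {r c : ℝ} (hr : 0 < r) (hc : 0 < c) {β : En n → ℝ} {B : En n →L[ℝ] En n}
    (hab : ∀ x ∈ Metric.closedBall (0 : En n) r, ∀ y ∈ Metric.closedBall (0 : En n) r,
      (u (x₀ + x) - u x₀ - px x - 1 / 2 * H₀ x x) + (-v (y₀ + y) + v y₀ + py y) ≤ β (x - y))
    (hB : ∀ x y, inner ℝ (B x) y = inner ℝ x (B y))
    (hβB : ∀ z z', β z' ≤ 1 / 2 * inner ℝ (B z) z + c / 2 * ‖z - z'‖ ^ 2)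
    (hβc : ∀ z, β z ≤ c / 4 * ‖z‖ ^ 2) (hBc : ∀ z, inner ℝ (B z) z ≤ c / 2 * ‖z‖ ^ 2)
    {e : En n} (he : ‖e‖ ≤ 1) :
    m₀ - 4 * lam * inner ℝ (B e) e - 1 / 2 * px x₀ + 1 / 2 * py y₀ - α * (u x₀ - v y₀) ≤
      f x₀ - g y₀ := by
  set a : En n → ℝ := fun x => u (x₀ + x) - u x₀ - px x - 1 / 2 * H₀ x x with ha
  set b : En n → ℝ := fun y => -v (y₀ + y) + v y₀ + py y with hb
  have hca : Continuous fun x : En n => -u x₀ - px x - 1 / 2 * H₀ x x := by fun_prop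
  have hcb : Continuous fun y : En n => v y₀ + py y := by fun_prop
  have hua : UpperSemicontinuous a := by
    have h1 : UpperSemicontinuous fun x => u (x₀ + x) := husc.comp (by fun_prop)
    have h2 : a = fun x => u (x₀ + x) + (-u x₀ - px x - 1 / 2 * H₀ x x) := by
      funext x; simp only [ha]; ring
    rw [h2]
    exact h1.add_continuous hca
  have hub : UpperSemicontinuous b := by
    have h1 : UpperSemicontinuous fun y => -v (y₀ + y) := hlsc.neg_usc.comp (by fun_prop)
    have h2 : b = fun y => -v (y₀ + y) + (v y₀ + py y) := by
      funext x; simp only [hb]; ring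
    rw [h2]
    exact h1.add_continuous hcb
  have key : ∀ τ : ℝ, 0 < τ → ∃ x y : En n, ∃ p q : En n →L[ℝ] ℝ, ‖x‖ < τ ∧ ‖y‖ < τ ∧ |a x| < τ ∧ |b y| < τ ∧ ‖p‖ < τ ∧ ‖q‖ < τ ∧
      m₀ - 4 * lam * inner ℝ (B e) e - lam * (2 * τ) - 2 * τ * (Lam * n)
        - 1 / 2 * (px + H₀ x + p) (x₀ + x) + 1 / 2 * (py - q) (y₀ + y)
        - α * (u (x₀ + x) - v (y₀ + y)) ≤ f (x₀ + x) - g (y₀ + y) := by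
    intro τ hτ
    obtain ⟨x, y, p, q, X, Y, hx, hy, hax, hby, hp, hq, hX, hY, hjx, hjy, hXY⟩ :=
      exists_sums_jets hc hr (hua.upperSemicontinuousOn _) (hub.upperSemicontinuousOn _)
        (by simp [ha]) (by simp [hb]) hab hB hβB hβc hBc hτ
    refine ⟨x, y, p, q, hx, hy, hax, hby, hp, hq, ?_⟩
    have h1 := hu (x₀ + x) (px + H₀ x + p) (H₀ + X) (fun h l => by simp [hH₀ h l, hX h l]) (by
      filter_upwards [hjx] with d hd
      simp only [ha, map_add, _root_.add_apply, hH₀ d x, ← add_assoc] at hd ⊢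
      linarith)
    have h2 := (jSup_iff.1 hv) (y₀ + y) (py - q) (-Y) (fun h l => by simp [hY h l]) (by
      filter_upwards [hjy] with d hd
      simp only [hb, map_add, _root_.sub_apply, _root_.neg_apply, ← add_assoc] at hd ⊢
      linarith)
    have hXYs : ∀ h l, (X + Y) h l = (X + Y) l h := fun h l => by simp [hX h l, hY h l]
    have h3 := pucciLB_of_dir (Lam := Lam) hlam (H := X + Y) hXYs (κ := 2 * τ) (by linarith) (fun h => by
      have := hXY h h
      simp only [sub_self, map_zero, inner_zero_left] at this
      simp only [_root_.add_apply]
      linarith) he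
    have h4 := hF.le_sub hle (X := H₀ + X) (Y := -Y) (fun h l => by simp [hH₀ h l, hX h l])
      (fun h l => by simp [hY h l]) (m := m₀ + (-lam * (X + Y) e e - 2 * τ * (Lam * n))) (by
      have e1 : H₀ + X - -Y = H₀ + (X + Y) := by abel
      rw [e1]
      exact hm₀.add h3)
    have h5 : (X + Y) e e ≤ 4 * inner ℝ (B e) e + 2 * τ := by
      have := hXY e (-e)
      have e2 : e - -e = (2 : ℝ) • e := by module
      rw [e2] at this
      simp only [map_smul, map_neg, _root_.neg_apply, neg_neg, inner_smul_left, inner_smul_right,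
        norm_neg] at this
      have h6 : ‖e‖ ^ 2 ≤ 1 := pow_le_one₀ (norm_nonneg _) he
      have h7 := mul_le_mul_of_nonneg_left h6 hτ.le
      simp only [_root_.add_apply]
      simp at this
      linarith
    have h6 := mul_le_mul_of_nonneg_left h5 hlam.le
    linarith
  have hτ : ∀ k : ℕ, (0 : ℝ) < 1 / ((k : ℝ) + 1) := fun k => Nat.one_div_pos_of_nat
  have hτ0 : Tendsto (fun k : ℕ => 1 / ((k : ℝ) + 1)) atTop (𝓝 0) :=
    tendsto_one_div_add_atTop_nhds_zero_nat
  choose x y p q hx hy hax hby hp hq hk using fun k : ℕ => key _ (hτ k)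
  have hx0 : Tendsto x atTop (𝓝 0) := squeeze_zero_norm (fun k => (hx k).le) hτ0
  have hy0 : Tendsto y atTop (𝓝 0) := squeeze_zero_norm (fun k => (hy k).le) hτ0
  have hp0 : Tendsto p atTop (𝓝 0) := squeeze_zero_norm (fun k => (hp k).le) hτ0
  have hq0 : Tendsto q atTop (𝓝 0) := squeeze_zero_norm (fun k => (hq k).le) hτ0
  have ha0 : Tendsto (fun k => a (x k)) atTop (𝓝 0) :=
    squeeze_zero_norm (fun k => by rw [Real.norm_eq_abs]; exact (hax k).le) hτ0
  have hb0 : Tendsto (fun k => b (y k)) atTop (𝓝 0) :=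
    squeeze_zero_norm (fun k => by rw [Real.norm_eq_abs]; exact (hby k).le) hτ0
  have hx1 : Tendsto (fun k => x₀ + x k) atTop (𝓝 x₀) := by simpa using hx0.const_add x₀
  have hy1 : Tendsto (fun k => y₀ + y k) atTop (𝓝 y₀) := by simpa using hy0.const_add y₀
  have hpx0 : Tendsto (fun k => px (x k)) atTop (𝓝 0) := by
    simpa using (tendsto_const_nhds (x := px)).clm_apply_apply hx0
  have hpy0 : Tendsto (fun k => py (y k)) atTop (𝓝 0) := by
    simpa using (tendsto_const_nhds (x := py)).clm_apply_apply hy0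
  have hHx : Tendsto (fun k => H₀ (x k)) atTop (𝓝 0) := by
    simpa using (tendsto_const_nhds (x := H₀)).clm_apply_apply hx0
  have hHxx : Tendsto (fun k => H₀ (x k) (x k)) atTop (𝓝 0) := by
    simpa using hHx.clm_apply_apply hx0
  have hu1 : Tendsto (fun k => u (x₀ + x k)) atTop (𝓝 (u x₀)) := by
    have := ((ha0.add (hpx0.add (hHxx.const_mul (1 / 2)))).const_add (u x₀))
    simp only [mul_zero, add_zero] at this
    refine this.congr fun k => ?_
    simp only [ha]
    ring
  have hv1 : Tendsto (fun k => v (y₀ + y k)) atTop (𝓝 (v y₀)) := by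
    have := (hpy0.sub hb0).const_add (v y₀)
    simp only [sub_zero, add_zero] at this
    refine this.congr fun k => ?_
    simp only [hb]
    ring
  have h1 : Tendsto (fun k => (px + H₀ (x k) + p k) (x₀ + x k)) atTop (𝓝 (px x₀)) := by
    have := ((hHx.const_add px).add hp0).clm_apply_apply hx1
    simpa using this
  have h2 : Tendsto (fun k => (py - q k) (y₀ + y k)) atTop (𝓝 (py y₀)) := by
    have := (hq0.const_sub py).clm_apply_apply hy1
    simpa using this
  have h3 : Tendsto (fun k : ℕ => lam * (2 * (1 / ((k : ℝ) + 1)))) atTop (𝓝 0) := by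
    simpa using (hτ0.const_mul 2).const_mul lam
  have h4 : Tendsto (fun k : ℕ => 2 * (1 / ((k : ℝ) + 1)) * (Lam * n)) atTop (𝓝 0) := by
    simpa using (hτ0.const_mul 2).mul_const (Lam * n)
  have h5 := (((((tendsto_const_nhds (x := m₀ - 4 * lam * inner ℝ (B e) e)).sub h3).sub h4).sub
    (h1.const_mul (1 / 2))).add (h2.const_mul (1 / 2))).sub ((hu1.sub hv1).const_mul α)
  have h6 := ((hf.tendsto x₀).comp hx1).sub ((hg.tendsto y₀).comp hy1)
  have h7 := le_of_tendsto_of_tendsto' h5 h6 hk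
  linarith

end Doubling

section Comparison

variable {n : ℕ} {lam Lam : ℝ}

theorem quad_expand {X : En n →L[ℝ] En n →L[ℝ] ℝ} (hX : ∀ h l, X h l = X l h) (z x : En n) :
    X (z + x) (z + x) = X z z + 2 * X z x + X x x := by
  simp only [map_add, _root_.add_apply, hX x z]
  ring

theorem JSub.sub_pSub (hlam : 0 < lam) (hle : lam ≤ Lam) {F : Mat n → ℝ}
    (hF : UniformlyElliptic n lam Lam F) {α : ℝ} {f g u v : En n → ℝ}
    (hu : JSub F α f u) (hv : JSup F α g v) (hf : Continuous f) (hg : Continuous g)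
    (husc : UpperSemicontinuous u) (hlsc : LowerSemicontinuous v) :
    PSub lam Lam α (fun y => f y - g y) (fun y => u y - v y) := by
  intro ŷ p X hX hj m hm
  refine le_of_forall_add_mul (c := 2 * (Lam * n)) fun ε hε => ?_
  obtain ⟨r, hr, hball⟩ := Metric.eventually_nhds_iff_ball.1 hj
  set H₀ : En n →L[ℝ] En n →L[ℝ] ℝ := X + (2 * ε) • idForm n with hH₀def
  have hH₀ : ∀ h l, H₀ h l = H₀ l h := fun h l => by
    simp [hH₀def, hX h l, idForm_apply, real_inner_comm]
  set q : En n → ℝ := fun x => p (x - ŷ) + 1 / 2 * H₀ (x - ŷ) (x - ŷ) with hq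
  have hqc : Continuous q := by fun_prop
  set K : Set (En n) := Metric.closedBall ŷ (r / 2) with hK
  have hŷK : ŷ ∈ K := Metric.mem_closedBall_self (by linarith)
  set Ψ : En n × En n → ℝ := fun z => u z.1 - v z.2 - q z.1 with hΨ
  set θ : En n × En n → ℝ := fun z => 1 / 2 * ‖z.1 - z.2‖ ^ 2 with hθ
  have hΨusc : UpperSemicontinuous Ψ := by
    have h1 : UpperSemicontinuous fun z : En n × En n => u z.1 := husc.comp continuous_fst
    have h2 : UpperSemicontinuous fun z : En n × En n => -v z.2 :=
      hlsc.neg_usc.comp continuous_snd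
    have h3 := (h1.add h2).add_continuous (g := fun z : En n × En n => -q z.1) (by fun_prop)
    have e : Ψ = fun z : En n × En n => u z.1 + -v z.2 + -q z.1 := by
      funext z; simp only [hΨ]; ring
    rw [e]
    exact h3
  obtain ⟨z, hzK, hzmax, hz0, hzθ, hzΨ⟩ :=
    UpperSemicontinuousOn.exists_penalized_maximizers (K := K ×ˢ K) (Ψ := Ψ) (θ := θ)
      (z₀ := (ŷ, ŷ))
      ((isCompact_closedBall ŷ (r / 2)).prod (isCompact_closedBall ŷ (r / 2)))
      (hΨusc.upperSemicontinuousOn _) (by fun_prop) (fun z => by positivity)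
      ⟨hŷK, hŷK⟩ (by simp [hθ]) (by
        rintro ⟨x, y⟩ ⟨hx, hy⟩ hxy hne
        have h1 : x = y := by
          simp only [hθ, one_div, mul_eq_zero, inv_eq_zero, OfNat.ofNat_ne_zero, false_or,
            pow_eq_zero_iff, ne_eq, not_false_eq_true, norm_eq_zero] at hxy
          exact sub_eq_zero.1 hxy
        subst h1
        have hx' : x ≠ ŷ := fun h => hne (by rw [h])
        have h2 := hball (x - ŷ) (by
          rw [mem_ball_zero_iff, ← dist_eq_norm]
          exact lt_of_le_of_lt hx (by linarith))
        rw [add_sub_cancel] at h2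
        beta_reduce at h2
        have h3 : 0 < ‖x - ŷ‖ := norm_pos_iff.2 (sub_ne_zero.2 hx')
        have h4 : 0 < ε * ‖x - ŷ‖ ^ 2 := by positivity
        simp only [hΨ, hq, hH₀def, sub_self, map_zero, mul_zero, add_zero, _root_.add_apply,
          _root_.smul_apply, idForm_apply, smul_eq_mul, real_inner_self_eq_norm_sq, norm_zero, ne_eq,
          OfNat.ofNat_ne_zero, not_false_eq_true, zero_pow]
        linarith)
  have hx1 : Tendsto (fun k => (z k).1) atTop (𝓝 ŷ) := (continuous_fst.tendsto (ŷ, ŷ)).comp hz0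
  have hy1 : Tendsto (fun k => (z k).2) atTop (𝓝 ŷ) := (continuous_snd.tendsto (ŷ, ŷ)).comp hz0
  have key : ∀ᶠ k : ℕ in atTop, m - (2 * ε) * (Lam * n) - 1 / 2 * (p (z k).1 +
      H₀ ((z k).1 - ŷ) (z k).1 + 2 * (k * θ (z k))) - α * (Ψ (z k) + q (z k).1) ≤
      f (z k).1 - g (z k).2 := by
    filter_upwards [hx1.eventually (Metric.ball_mem_nhds ŷ (by linarith : 0 < r / 4)),
      hy1.eventually (Metric.ball_mem_nhds ŷ (by linarith : 0 < r / 4)),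
      eventually_gt_atTop 0] with k hxk hyk hk0
    have hk : (0 : ℝ) < k := by exact_mod_cast hk0
    set x₀ := (z k).1 with hx₀
    set y₀ := (z k).2 with hy₀
    have h1 := doubling_ineq hlam hle hF hu hv hf hg husc hlsc (x₀ := x₀) (y₀ := y₀)
      (px := p + H₀ (x₀ - ŷ) + (k : ℝ) • idForm n (x₀ - y₀)) (py := (k : ℝ) • idForm n (x₀ - y₀))
      (H₀ := H₀) hH₀ (m₀ := m - (2 * ε) * (Lam * n)) (hm.add_smul_id hlam (by linarith))
      (r := r / 4) (c := 4 * k) (by linarith) (by linarith)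
      (β := fun z => (k : ℝ) / 2 * ‖z‖ ^ 2) (B := (2 * (k : ℝ)) • ContinuousLinearMap.id ℝ (En n))
      (by
        intro x hx y hy
        have h2 := hzmax k (x₀ + x, y₀ + y) ⟨by
          rw [hK, Metric.mem_closedBall, dist_eq_norm]
          rw [dist_eq_norm] at hxk
          rw [mem_closedBall_zero_iff] at hx
          have e : x₀ + x - ŷ = (x₀ - ŷ) + x := by abel
          rw [e]
          exact (norm_add_le _ _).trans (by linarith), by
          rw [hK, Metric.mem_closedBall, dist_eq_norm]
          rw [dist_eq_norm] at hyk
          rw [mem_closedBall_zero_iff] at hy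
          have e : y₀ + y - ŷ = (y₀ - ŷ) + y := by abel
          rw [e]
          exact (norm_add_le _ _).trans (by linarith)⟩
        have e1 : x₀ + x - (y₀ + y) = (x₀ - y₀) + (x - y) := by abel
        have e2 : x₀ + x - ŷ = (x₀ - ŷ) + x := by abel
        simp only [hΨ, hθ, hq, ← hx₀, ← hy₀, e1, e2, quad_expand hH₀, norm_add_sq_real,
          map_add p] at h2
        simp only [_root_.add_apply, _root_.smul_apply, idForm_apply, smul_eq_mul]
        have e3 : inner ℝ (x₀ - y₀) (x - y) = inner ℝ (x₀ - y₀) x - inner ℝ (x₀ - y₀) y :=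
          inner_sub_right _ _ _
        rw [e3] at h2
        linarith)
      (fun x y => by simp [inner_smul_left, inner_smul_right]) (by
        intro w w'
        have h3 : 0 ≤ ‖(2 : ℝ) • w - w'‖ ^ 2 := by positivity
        have h4 := norm_sub_sq_real w w'
        rw [norm_sub_sq_real, norm_smul, inner_smul_left] at h3
        simp only [_root_.smul_apply, ContinuousLinearMap.id_apply, inner_smul_left, conj_trivial,
          real_inner_self_eq_norm_sq, h4]
        simp at h3
        have h5 := mul_le_mul_of_nonneg_left h3 hk.le
        nlinarith [sq_nonneg ‖w'‖, sq_nonneg ‖w‖]) (by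
        intro w
        have : 0 ≤ (k : ℝ) * ‖w‖ ^ 2 := by positivity
        linarith) (by
        intro w
        simp only [_root_.smul_apply, ContinuousLinearMap.id_apply, inner_smul_left, conj_trivial,
          real_inner_self_eq_norm_sq]
        linarith) (e := 0) (by simp)
    simp only [map_zero, inner_zero_left, mul_zero, sub_zero, _root_.add_apply,
      _root_.smul_apply, idForm_apply, smul_eq_mul] at h1
    have e3 : inner ℝ (x₀ - y₀) x₀ - inner ℝ (x₀ - y₀) y₀ = ‖x₀ - y₀‖ ^ 2 := by
      rw [← inner_sub_right, real_inner_self_eq_norm_sq]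
    have e4 : (k : ℝ) * inner ℝ (x₀ - y₀) x₀ - k * inner ℝ (x₀ - y₀) y₀ = k * ‖x₀ - y₀‖ ^ 2 := by
      rw [← mul_sub, e3]
    have e5 : Ψ (z k) + q (z k).1 = u x₀ - v y₀ := by simp only [hΨ]; ring
    have e6 : θ (z k) = 1 / 2 * ‖x₀ - y₀‖ ^ 2 := rfl
    rw [e5, e6]
    linarith
  have h1 : Tendsto (fun k => p (z k).1) atTop (𝓝 (p ŷ)) := (p.continuous.tendsto ŷ).comp hx1
  have h2 : Tendsto (fun k => H₀ ((z k).1 - ŷ) (z k).1) atTop (𝓝 0) := by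
    have := ((tendsto_const_nhds (x := H₀)).clm_apply_apply (hx1.sub_const ŷ)).clm_apply_apply hx1
    simpa using this
  have h3 : Tendsto (fun k => q (z k).1) atTop (𝓝 0) := by
    have := (hqc.tendsto ŷ).comp hx1
    have e : q ŷ = 0 := by simp [hq]
    rwa [e] at this
  have h4 : Ψ (ŷ, ŷ) = u ŷ - v ŷ := by simp [hΨ, hq]
  have h5 := ((tendsto_const_nhds (x := m - (2 * ε) * (Lam * n))).sub
    (((h1.add h2).add (hzθ.const_mul 2)).const_mul (1 / 2))).sub ((hzΨ.add h3).const_mul α)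
  have h6 := ((hf.tendsto ŷ).comp hx1).sub ((hg.tendsto ŷ).comp hy1)
  have h7 := le_of_tendsto_of_tendsto h5 h6 key
  rw [h4] at h7
  linarith

end Comparison

section LipschitzEstimate

variable {n : ℕ} {lam Lam : ℝ}

theorem norm_add_le_of_dir {z₀ z e : En n} {r : ℝ} (hr : 0 < r) (hr0 : ‖z₀‖ = r)
    (he : z₀ = r • e) (hz : ‖z‖ ≤ r / 2) :
    ‖z₀ + z‖ ≤ r + inner ℝ e z + (‖z‖ ^ 2 - inner ℝ e z ^ 2) / r := by
  have he1 : ‖e‖ = 1 := by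
    rw [he, norm_smul, Real.norm_eq_abs, abs_of_pos hr] at hr0
    exact (mul_eq_left₀ hr.ne').1 hr0
  set s := inner ℝ e z with hs
  have hsz : |s| ≤ ‖z‖ := by simpa [he1] using abs_real_inner_le_norm e z
  have hq : 0 ≤ ‖z‖ ^ 2 - s ^ 2 := by
    have := sq_le_sq' (abs_le.1 hsz).1 (abs_le.1 hsz).2
    linarith
  have hs1 : -(r / 2) ≤ s := by linarith [(abs_le.1 hsz).1]
  have hdiv : 0 ≤ (‖z‖ ^ 2 - s ^ 2) / r := div_nonneg hq hr.le
  refine abs_le_of_sq_le_sq' ?_ (by linarith) |>.2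
  rw [norm_add_sq_real, hr0, he, inner_smul_left]
  simp only [conj_trivial, ← hs]
  set Q := (‖z‖ ^ 2 - s ^ 2) / r with hQ
  have h1 : ‖z‖ ^ 2 = s ^ 2 + r * Q := by rw [hQ]; field_simp; ring
  have h2 : 0 ≤ (2 * s + r) * Q := mul_nonneg (by linarith) hdiv
  rw [h1]
  nlinarith [sq_nonneg Q]

/-- Lipschitz estimate for bounded decaying solutions. -/
theorem lipschitz_of_solution (hlam : 0 < lam) (hle : lam ≤ Lam) {F : Mat n → ℝ}
    (hF : UniformlyElliptic n lam Lam F) {A α : ℝ} (hα0 : 0 ≤ α) (hαA : α ≤ A)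
    {f u : En n → ℝ} (hu : JSub F α f u) (hv : JSup F α f u) (hf : Continuous f)
    (hcu : Continuous u) (hu0 : ∀ y, 0 ≤ u y) (hu1 : ∀ y, u y ≤ 1)
    (hosc : ∀ x y, f x - f y ≤ 1)
    (hdec : ∀ η : ℝ, 0 < η → ∃ R : ℝ, ∀ y, R ≤ ‖y‖ → u y < η) (x y : En n) :
    u x - u y ≤ (A + 2) / lam * Real.sqrt (2 * lam) * ‖x - y‖ := by
  set r₀ := Real.sqrt (2 * lam) with hr₀
  have hr₀pos : 0 < r₀ := Real.sqrt_pos.2 (by linarith)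
  have hr₀sq : r₀ ^ 2 = 2 * lam := Real.sq_sqrt (by linarith)
  set κ := (A + 2) / (2 * lam) with hκ
  have hκpos : 0 < κ := by
    have : 0 ≤ A := hα0.trans hαA
    positivity
  have hκlam : 2 * (κ * lam) = A + 2 := by rw [hκ]; field_simp
  set K := 2 * κ * r₀ with hK
  have hKpos : 0 < K := by positivity
  have eK : (A + 2) / lam * r₀ = K := by rw [hK, hκ]; field_simp
  rw [eK]
  by_contra hcon
  have hcon := not_le.1 hcon
  set ω : ℝ → ℝ := fun s => K * s - κ * s ^ 2 with hω
  have hω0 : ∀ s, 0 ≤ s → s ≤ r₀ → 0 ≤ ω s := by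
    intro s hs hs'
    have h1 : ω s = κ * (s * (2 * r₀ - s)) := by simp only [hω, hK]; ring
    rw [h1]
    exact mul_nonneg hκpos.le (mul_nonneg hs (by linarith))
  have hωr₀ : 1 ≤ ω r₀ := by
    have h1 : ω r₀ = κ * r₀ ^ 2 := by simp only [hω, hK]; ring
    rw [h1, hr₀sq]
    linarith [hα0.trans hαA]
  set Φ : En n × En n → ℝ := fun z => u z.1 - u z.2 - ω ‖z.1 - z.2‖ with hΦ
  have hΦc : Continuous Φ := by fun_prop
  set η := Φ (x, y) with hη
  have hηpos : 0 < η := by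
    have h1 : 0 ≤ κ * ‖x - y‖ ^ 2 := by positivity
    simp only [hη, hΦ, hω]
    linarith
  have hxy : ‖x - y‖ ≤ r₀ := by
    by_contra h
    have h1 := mul_lt_mul_of_pos_left (not_le.1 h) hKpos
    have h2 : K * r₀ = 2 * (κ * r₀ ^ 2) := by rw [hK]; ring
    rw [h2, hr₀sq] at h1
    linarith [hu0 y, hu1 x, hα0.trans hαA]
  obtain ⟨R, hR⟩ := hdec η hηpos
  set S : Set (En n × En n) := (Metric.closedBall 0 R ×ˢ Metric.closedBall 0 (R + r₀)) ∩
    {z | ‖z.1 - z.2‖ ≤ r₀} with hS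
  have hScpt : IsCompact S := ((isCompact_closedBall _ _).prod (isCompact_closedBall _ _)).inter_right
    (isClosed_le (by fun_prop) continuous_const)
  have hmemS : ∀ a b : En n, ‖a‖ ≤ R → ‖a - b‖ ≤ r₀ → (a, b) ∈ S := by
    intro a b ha hab
    refine ⟨⟨by simpa using ha, ?_⟩, hab⟩
    rw [mem_closedBall_zero_iff]
    have e : b = a - (a - b) := by abel
    calc ‖b‖ = ‖a - (a - b)‖ := by rw [← e]
      _ ≤ ‖a‖ + ‖a - b‖ := norm_sub_le _ _
      _ ≤ R + r₀ := add_le_add ha hab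
  have hRof : ∀ a b : En n, ‖a - b‖ ≤ r₀ → η ≤ Φ (a, b) → ‖a‖ < R := by
    intro a b hab h
    by_contra hcon
    have h1 := hR a (not_lt.1 hcon)
    have h2 := hω0 _ (norm_nonneg _) hab
    simp only [hΦ] at h
    linarith [hu0 b]
  obtain ⟨⟨x₀, y₀⟩, hzS, hzmax⟩ := hScpt.exists_isMaxOn
    ⟨(x, y), hmemS x y (hRof x y hxy le_rfl).le hxy⟩ hΦc.continuousOn
  have hη0 : η ≤ Φ (x₀, y₀) := hzmax (hmemS x y (hRof x y hxy le_rfl).le hxy)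
  have hxy₀ : ‖x₀ - y₀‖ ≤ r₀ := hzS.2
  have hx₀R := hRof x₀ y₀ hxy₀ hη0
  set z₀ := x₀ - y₀ with hz₀
  set r := ‖z₀‖ with hr
  have hΦ0 : η ≤ u x₀ - u y₀ - ω r := hη0
  have hrpos : 0 < r := by
    refine lt_of_le_of_ne (norm_nonneg _) fun h => ?_
    have h1 : x₀ = y₀ := sub_eq_zero.1 (norm_eq_zero.1 h.symm)
    have h2 : ω r = 0 := by simp [hω, ← h]
    rw [h1, h2] at hΦ0
    linarith
  have hrr₀ : r < r₀ := by
    refine lt_of_le_of_ne hxy₀ fun h => ?_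
    rw [h] at hΦ0
    linarith [hu0 y₀, hu1 x₀]
  set e := r⁻¹ • z₀ with he
  have hz₀e : z₀ = r • e := by rw [he, smul_smul, mul_inv_cancel₀ hrpos.ne', one_smul]
  have he1 : ‖e‖ = 1 := by
    rw [he, norm_smul, norm_inv, Real.norm_eq_abs, abs_of_pos hrpos]
    exact inv_mul_cancel₀ hrpos.ne'
  have hee : inner ℝ e e = 1 := by rw [real_inner_self_eq_norm_sq, he1, one_pow]
  have hsle : ∀ z : En n, inner ℝ e z ^ 2 ≤ ‖z‖ ^ 2 := fun z => by
    have h1 : |inner ℝ e z| ≤ ‖z‖ := by simpa [he1] using abs_real_inner_le_norm e z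
    exact sq_le_sq' (abs_le.1 h1).1 (abs_le.1 h1).2
  obtain ⟨ρ, hρ, hρ1, hρ2, hρ3⟩ : ∃ ρ : ℝ, 0 < ρ ∧ ρ ≤ R - ‖x₀‖ ∧ 2 * ρ ≤ r₀ - r ∧
      2 * ρ ≤ r / 2 := by
    refine ⟨min (R - ‖x₀‖) (min ((r₀ - r) / 2) (r / 4)), ?_, min_le_left _ _, ?_, ?_⟩
    · exact lt_min (by linarith) (lt_min (by linarith) (by linarith))
    · have := (min_le_right (R - ‖x₀‖) _).trans (min_le_left ((r₀ - r) / 2) (r / 4))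
      linarith
    · have := (min_le_right (R - ‖x₀‖) _).trans (min_le_right ((r₀ - r) / 2) (r / 4))
      linarith
  set M := K / r with hM
  have hMpos : 0 < M := by positivity
  set β : En n → ℝ := fun z => M * (‖z‖ ^ 2 - inner ℝ e z ^ 2) - κ * inner ℝ e z ^ 2 with hβ
  set B : En n →L[ℝ] En n := (4 * M) • ContinuousLinearMap.id ℝ (En n) -
    (4 * M + κ) • (innerSL ℝ e).smulRight e with hB
  have hBa : ∀ z w, inner ℝ (B z) w = 4 * M * inner ℝ z w -
      (4 * M + κ) * (inner ℝ e z * inner ℝ e w) := fun z w => by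
    simp [hB, inner_sub_left, inner_smul_left]
  have hBz : ∀ z, inner ℝ (B z) z = 4 * M * (‖z‖ ^ 2 - inner ℝ e z ^ 2) -
      κ * inner ℝ e z ^ 2 := fun z => by
    rw [hBa, real_inner_self_eq_norm_sq]; ring
  have h := doubling_ineq hlam hle hF hu hv hf hf hcu.upperSemicontinuous hcu.lowerSemicontinuous
    (x₀ := x₀) (y₀ := y₀) (px := (K - 2 * κ * r) • innerSL ℝ e)
    (py := (K - 2 * κ * r) • innerSL ℝ e) (H₀ := 0) (fun _ _ => rfl) (m₀ := 0)
    (fun v μ hμ => by simp) (r := ρ) (c := 8 * M + 2 * κ) hρ (by positivity) (β := β) (B := B)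
    (by
      intro a ha b hb
      rw [mem_closedBall_zero_iff] at ha hb
      have hab : ‖a - b‖ ≤ 2 * ρ := (norm_sub_le _ _).trans (by linarith)
      have e1 : x₀ + a - (y₀ + b) = z₀ + (a - b) := by rw [hz₀]; abel
      have h1 : Φ (x₀ + a, y₀ + b) ≤ Φ (x₀, y₀) := hzmax (hmemS _ _
        ((norm_add_le _ _).trans (by linarith)) (by
          rw [e1]
          exact (norm_add_le _ _).trans (by linarith)))
      simp only [hΦ, e1] at h1
      have h2 := norm_add_le_of_dir hrpos rfl hz₀e (hab.trans hρ3)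
      have h3 : ‖z₀ + (a - b)‖ ^ 2 = r ^ 2 + 2 * (r * inner ℝ e (a - b)) + ‖a - b‖ ^ 2 := by
        rw [norm_add_sq_real, ← hr]
        conv_lhs => rw [hz₀e]
        rw [inner_smul_left]
        simp
      have h4 := mul_le_mul_of_nonneg_left h2 hKpos.le
      have h5 : K * (r + inner ℝ e (a - b) + (‖a - b‖ ^ 2 - inner ℝ e (a - b) ^ 2) / r) =
        K * r + K * inner ℝ e (a - b) + M * (‖a - b‖ ^ 2 - inner ℝ e (a - b) ^ 2) := by
        rw [hM]; field_simp
      rw [h5] at h4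
      have h6 := mul_nonneg hκpos.le (sub_nonneg.2 (hsle (a - b)))
      simp only [hω, h3, ← hz₀, ← hr] at h1
      have h7 : inner ℝ e (a - b) = inner ℝ e a - inner ℝ e b := inner_sub_right _ _ _
      have h8 : (K - 2 * κ * r) * inner ℝ e (a - b) =
        (K - 2 * κ * r) * inner ℝ e a - (K - 2 * κ * r) * inner ℝ e b := by rw [h7]; ring
      simp only [hβ, _root_.smul_apply, innerSL_apply_apply, smul_eq_mul, _root_.zero_apply,
        mul_zero, sub_zero]
      linarith)
    (fun z w => by rw [hBa, real_inner_comm (B w) z, hBa, real_inner_comm w z]; ring)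
    (by
      intro z w
      have h7 : inner ℝ e (z - w) = inner ℝ e z - inner ℝ e w := inner_sub_right _ _ _
      have h8 : inner ℝ e ((2 : ℝ) • z - w) = 2 * inner ℝ e z - inner ℝ e w := by
        rw [inner_sub_right, inner_smul_right]
      have n1 := norm_sub_sq_real z w
      have n2 : ‖(2 : ℝ) • z - w‖ ^ 2 = 4 * ‖z‖ ^ 2 - 4 * inner ℝ z w + ‖w‖ ^ 2 := by
        rw [norm_sub_sq_real, norm_smul, inner_smul_left, Real.norm_eq_abs, mul_pow, sq_abs]
        simp only [conj_trivial]
        ring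
      have a1 := mul_nonneg hMpos.le (sub_nonneg.2 (hsle ((2 : ℝ) • z - w)))
      have a2 := mul_nonneg hκpos.le (sub_nonneg.2 (hsle (z - w)))
      have a3 := mul_nonneg hMpos.le (sq_nonneg (inner ℝ e z - inner ℝ e w))
      have a4 := mul_nonneg hMpos.le (sq_nonneg ‖z - w‖)
      have a5 := mul_nonneg hκpos.le (sq_nonneg (inner ℝ e z - 2 * inner ℝ e w))
      rw [h8, n2] at a1
      rw [h7, n1] at a2
      rw [n1] at a4
      rw [hBz]
      simp only [hβ, n1]
      linarith)
    (by
      intro z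
      have h1 := mul_nonneg hMpos.le (sq_nonneg (inner ℝ e z))
      have h2 := mul_nonneg hκpos.le (sq_nonneg (inner ℝ e z))
      have h3 := mul_nonneg hMpos.le (sq_nonneg ‖z‖)
      have h4 := mul_nonneg hκpos.le (sq_nonneg ‖z‖)
      simp only [hβ]
      linarith)
    (by
      intro z
      have h1 := mul_nonneg hMpos.le (sq_nonneg (inner ℝ e z))
      have h2 := mul_nonneg hκpos.le (sq_nonneg (inner ℝ e z))
      have h4 := mul_nonneg hκpos.le (sq_nonneg ‖z‖)
      rw [hBz]
      linarith) (e := e) he1.le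
  rw [hBz, he1, hee] at h
  have h1 : inner ℝ e x₀ - inner ℝ e y₀ = r := by
    rw [← inner_sub_right, ← hz₀, hz₀e, inner_smul_right, hee, mul_one]
  have h2 : (K - 2 * κ * r) * inner ℝ e x₀ - (K - 2 * κ * r) * inner ℝ e y₀ =
      (K - 2 * κ * r) * r := by rw [← mul_sub, h1]
  simp only [_root_.smul_apply, innerSL_apply_apply, smul_eq_mul] at h
  have h3 : (K - 2 * κ * r) * r ≤ κ * r₀ ^ 2 / 2 := by
    rw [hK]
    have := mul_nonneg hκpos.le (sq_nonneg (r₀ - 2 * r))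
    linarith
  rw [hr₀sq] at h3
  have h4 : α * (u x₀ - u y₀) ≤ A := by
    have h5 : u x₀ - u y₀ ≤ 1 := by linarith [hu0 y₀, hu1 x₀]
    have := mul_le_mul_of_nonneg_left h5 hα0
    linarith
  have h5 := hosc x₀ y₀
  linarith [hα0.trans hαA]

end LipschitzEstimate

theorem UpperSemicontinuous.mul_continuous_pos {T : Type*} [TopologicalSpace T] {w c : T → ℝ}
    (hw : UpperSemicontinuous w) (hc : Continuous c) (hpos : ∀ x, 0 < c x) :
    UpperSemicontinuous fun x => w x * c x := by
  intro x t ht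
  have ht : w x < t / c x := by rwa [lt_div_iff₀ (hpos x)]
  obtain ⟨s, hs1, hs2⟩ := exists_between ht
  have h1 : ∀ᶠ z in 𝓝 x, s * c z < t := by
    have : Continuous fun z => s * c z := by fun_prop
    exact this.continuousAt.eventually (gt_mem_nhds (by rwa [lt_div_iff₀ (hpos x)] at hs2))
  filter_upwards [h1, hw x s hs1] with z h1 h2
  exact (mul_lt_mul_of_pos_right h2 (hpos z)).trans h1

theorem exists_forall_le_of_usc {E : Type*} [NormedAddCommGroup E] [ProperSpace E]
    {g : E → ℝ} (hg : UpperSemicontinuous g) {y₁ : E} (h1 : 0 < g y₁)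
    (hdec : ∀ η : ℝ, 0 < η → ∃ R : ℝ, ∀ y, R ≤ ‖y‖ → g y < η) : ∃ ŷ, ∀ y, g y ≤ g ŷ := by
  obtain ⟨R, hR⟩ := hdec _ h1
  have hy₁ : y₁ ∈ Metric.closedBall (0 : E) R := by
    rw [mem_closedBall_zero_iff]
    by_contra h
    exact lt_irrefl _ (hR y₁ (not_le.1 h).le)
  obtain ⟨ŷ, -, hmax⟩ := (hg.upperSemicontinuousOn (Metric.closedBall (0 : E) R)).exists_isMaxOn
    ⟨y₁, hy₁⟩ (isCompact_closedBall _ _)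
  refine ⟨ŷ, fun y => ?_⟩
  by_cases hy : ‖y‖ ≤ R
  · exact hmax (by simpa using hy)
  · exact (hR y (not_le.1 hy).le).le.trans (hmax hy₁)

theorem exists_gaussian_tail_lt {E : Type*} [NormedAddCommGroup E] {c : ℝ} (hc : 0 < c) (C : ℝ)
    {η : ℝ} (hη : 0 < η) :
    ∃ R : ℝ, 0 < R ∧ ∀ y : E, R ≤ ‖y‖ → C * (1 + ‖y‖ ^ 2) * Real.exp (-c * ‖y‖ ^ 2) < η := by
  have h1 : Tendsto (fun s : ℝ => s ^ 1 * Real.exp (-c * s)) atTop (𝓝 0) := by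
    simpa using tendsto_rpow_mul_exp_neg_mul_atTop_nhds_zero 1 c hc
  have h2 : Tendsto (fun s : ℝ => Real.exp (-c * s)) atTop (𝓝 0) := by
    simpa using tendsto_rpow_mul_exp_neg_mul_atTop_nhds_zero 0 c hc
  have h3 := (h2.add h1).const_mul C
  simp only [add_zero, mul_zero, pow_one] at h3
  obtain ⟨S, hS⟩ := eventually_atTop.1 (h3.eventually (gt_mem_nhds hη))
  refine ⟨max S 1, by positivity, fun y hy => ?_⟩
  have h4 : S ≤ ‖y‖ ^ 2 := by
    have h5 : 1 ≤ ‖y‖ := (le_max_right S 1).trans hy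
    have h6 : S ≤ ‖y‖ := (le_max_left S 1).trans hy
    nlinarith
  have := hS _ h4
  linarith

section MaximumPrinciples

variable {n : ℕ} {lam Lam : ℝ}

theorem sum_sq_inner_eq (v : OrthonormalBasis (Fin n) ℝ (En n)) (z : En n) :
    ∑ k, inner ℝ z (v k) ^ 2 = ‖z‖ ^ 2 := by
  rw [← v.sum_sq_norm_inner_left z]
  refine Finset.sum_congr rfl fun k _ => ?_
  rw [Real.norm_eq_abs, sq_abs]

theorem sum_mul_gaussH (γ : ℝ) (c y : En n) (v : OrthonormalBasis (Fin n) ℝ (En n))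
    (μ : Fin n → ℝ) : ∑ k, μ k * gaussH γ c y (v k) (v k) =
    Real.exp (-γ * ‖y - c‖ ^ 2) * (4 * γ ^ 2 * ∑ k, μ k * inner ℝ (y - c) (v k) ^ 2 -
      2 * γ * ∑ k, μ k) := by
  rw [Finset.mul_sum, Finset.mul_sum, ← Finset.sum_sub_distrib, Finset.mul_sum]
  refine Finset.sum_congr rfl fun k _ => ?_
  rw [gaussH_apply, real_inner_self_eq_norm_sq, v.norm_eq_one]
  ring

theorem pucci_sums (z : En n) (v : OrthonormalBasis (Fin n) ℝ (En n))
    {μ : Fin n → ℝ} (hμ : ∀ k, μ k ∈ Icc lam Lam) :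
    lam * ‖z‖ ^ 2 ≤ ∑ k, μ k * inner ℝ z (v k) ^ 2 ∧
    ∑ k, μ k * inner ℝ z (v k) ^ 2 ≤ Lam * ‖z‖ ^ 2 ∧ lam * n ≤ ∑ k, μ k ∧ ∑ k, μ k ≤ Lam * n := by
  rw [← sum_sq_inner_eq v z, Finset.mul_sum, Finset.mul_sum]
  refine ⟨Finset.sum_le_sum fun k _ => mul_le_mul_of_nonneg_right (hμ k).1 (sq_nonneg _),
    Finset.sum_le_sum fun k _ => mul_le_mul_of_nonneg_right (hμ k).2 (sq_nonneg _), ?_, ?_⟩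
  · refine le_trans (by simp [mul_comm]) (Finset.sum_le_sum fun k _ => (hμ k).1)
  · refine (Finset.sum_le_sum fun k _ => (hμ k).2).trans (by simp [mul_comm])

theorem pucciLB_gauss (hlam : 0 < lam) {γ : ℝ} (hγ : 0 ≤ γ) (c y : En n) :
    PucciLB lam Lam (gaussH γ c y)
      (Real.exp (-γ * ‖y - c‖ ^ 2) * (2 * γ * (lam * n) - 4 * γ ^ 2 * (Lam * ‖y - c‖ ^ 2))) := by
  intro v μ hμ
  obtain ⟨-, h1, h2, -⟩ := pucci_sums (y - c) v hμ
  rw [sum_mul_gaussH, ← mul_neg]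
  refine mul_le_mul_of_nonneg_left ?_ (Real.exp_pos _).le
  have h3 := mul_le_mul_of_nonneg_left h1 (by positivity : 0 ≤ 4 * γ ^ 2)
  have h4 := mul_le_mul_of_nonneg_left h2 (by positivity : 0 ≤ 2 * γ)
  linarith

theorem pucciLB_neg_gauss (hlam : 0 < lam) {γ : ℝ} (hγ : 0 ≤ γ) (c y : En n) :
    PucciLB lam Lam (-gaussH γ c y)
      (Real.exp (-γ * ‖y - c‖ ^ 2) * (4 * γ ^ 2 * (lam * ‖y - c‖ ^ 2) - 2 * γ * (Lam * n))) := by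
  intro v μ hμ
  obtain ⟨h1, -, -, h2⟩ := pucci_sums (y - c) v hμ
  simp only [_root_.neg_apply, mul_neg, Finset.sum_neg_distrib, neg_neg]
  rw [sum_mul_gaussH]
  refine mul_le_mul_of_nonneg_left ?_ (Real.exp_pos _).le
  have h3 := mul_le_mul_of_nonneg_left h1 (by positivity : 0 ≤ 4 * γ ^ 2)
  have h4 := mul_le_mul_of_nonneg_left h2 (by positivity : 0 ≤ 2 * γ)
  linarith

theorem PSub.mono {α : ℝ} {f f' w : En n → ℝ} (h : PSub lam Lam α f w)
    (hf : ∀ y, f y ≤ f' y) : PSub lam Lam α f' w :=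
  fun y p X hX hj m hm => (h y p X hX hj m hm).trans (hf y)

theorem PSub.strong_max (hlam : 0 < lam) (hle : lam ≤ Lam) {α : ℝ} (hα : 0 ≤ α)
    {w : En n → ℝ} (hw : PSub lam Lam α (fun _ => 0) w) (husc : UpperSemicontinuous w)
    (hw0 : ∀ y, w y ≤ 0) : (∀ y, w y = 0) ∨ ∀ y, w y < 0 := by
  by_contra! hcon
  obtain ⟨⟨x₂, hx₂⟩, ⟨z₁, hz₁⟩⟩ := hcon
  have hx₂ : w x₂ < 0 := lt_of_le_of_ne (hw0 _) hx₂
  set Z : Set (En n) := {y | 0 ≤ w y} with hZ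
  have hZc : IsClosed Z := by
    have := husc.isClosed_preimage 0
    exact this
  obtain ⟨z, hzZ, hzd⟩ := hZc.exists_infDist_eq_dist ⟨z₁, hz₁⟩ x₂
  have hzmin : ∀ y ∈ Z, dist x₂ z ≤ dist x₂ y := fun y hy => hzd ▸ Metric.infDist_le_dist_of_mem hy
  have hwz : w z = 0 := le_antisymm (hw0 z) hzZ
  have hne : x₂ ≠ z := fun h => by rw [h, hwz] at hx₂; exact lt_irrefl _ hx₂
  set x₁ := midpoint ℝ x₂ z with hx₁
  set R := dist x₂ z / 2 with hR
  have hRpos : 0 < R := by have := dist_pos.2 hne; positivity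
  have hx₁z : ‖z - x₁‖ = R := by
    rw [← dist_eq_norm, dist_comm, hx₁, dist_midpoint_right]
    simp [hR]
    ring
  have huniq : ∀ y, ‖y - x₁‖ ≤ R → y ≠ z → w y < 0 := by
    intro y hy hyz
    by_contra hcon
    have hyZ : y ∈ Z := not_lt.1 hcon
    have h1 := hzmin y hyZ
    have h2 : (y - x₁) + (z - x₁) = y - x₂ := by
      have : x₁ + x₁ = x₂ + z := by rw [hx₁, midpoint_add_self]
      rw [sub_add_sub_comm, this]
      abel
    have h3 := parallelogram_law_with_norm ℝ (y - x₁) (z - x₁)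
    rw [h2, ← dist_eq_norm y x₂, dist_comm y x₂, sub_sub_sub_cancel_right, hx₁z] at h3
    have h4 : 2 * R ≤ dist x₂ y := by rw [hR]; linarith
    have h5 : 0 < ‖y - z‖ := norm_pos_iff.2 (sub_ne_zero.2 hyz)
    have h6 := mul_self_le_mul_self (norm_nonneg _) hy
    have h7 := mul_self_le_mul_self (by positivity) h4
    have h8 := mul_pos h5 h5
    linarith
  obtain ⟨η, hηpos, hη⟩ : ∃ η > 0, ∀ y, ‖y - z‖ = R / 2 → ‖y - x₁‖ ≤ R → w y ≤ -η := by
    have hK : IsCompact (Metric.sphere z (R / 2) ∩ Metric.closedBall x₁ R) :=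
      (isCompact_sphere _ _).inter_right Metric.isClosed_closedBall
    rcases (Metric.sphere z (R / 2) ∩ Metric.closedBall x₁ R).eq_empty_or_nonempty with he | hne
    · refine ⟨1, one_pos, fun y h1 h2 => ?_⟩
      have : y ∈ Metric.sphere z (R / 2) ∩ Metric.closedBall x₁ R :=
        ⟨mem_sphere_iff_norm.2 h1, mem_closedBall_iff_norm.2 h2⟩
      simp [he] at this
    · obtain ⟨ŷ, hŷ, hmax⟩ := (husc.upperSemicontinuousOn
        (Metric.sphere z (R / 2) ∩ Metric.closedBall x₁ R)).exists_isMaxOn hne hK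
      refine ⟨-w ŷ, neg_pos.2 (huniq ŷ (mem_closedBall_iff_norm.1 hŷ.2) ?_), fun y h1 h2 => ?_⟩
      · rintro rfl
        have := hŷ.1
        rw [mem_sphere_iff_norm, sub_self, norm_zero] at this
        linarith
      · rw [neg_neg]
        exact hmax ⟨mem_sphere_iff_norm.2 h1, mem_closedBall_iff_norm.2 h2⟩
  set Q : ℝ := 2 * (Lam * n) + 3 / 2 * R * (‖z‖ + R / 2) with hQ
  have hLam : 0 < Lam := hlam.trans_le hle
  have hQ0 : 0 ≤ Q := by positivity
  set γ : ℝ := (Q + 1) / (lam * R ^ 2) with hγ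
  have hγpos : 0 < γ := by positivity
  have hγR : γ * (lam * R ^ 2) = Q + 1 := by rw [hγ]; field_simp
  set φ : En n → ℝ := fun y =>
    (-(η / 2)) * (Real.exp (-γ * ‖y - x₁‖ ^ 2) - Real.exp (-γ * R ^ 2)) with hφ
  have hφc : Continuous φ := by fun_prop
  have hmem : z ∈ Metric.closedBall z (R / 2) := Metric.mem_closedBall_self (by positivity)
  obtain ⟨y, hyD, hmax⟩ := ((husc.add_continuous hφc.neg).upperSemicontinuousOn
    (Metric.closedBall z (R / 2))).exists_isMaxOn ⟨z, hmem⟩ (isCompact_closedBall _ _)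
  have hz0 : 0 ≤ w y + -φ y := by
    have h1 : w z + -φ z ≤ w y + -φ y := hmax hmem
    have h2 : φ z = 0 := by simp [hφ, hx₁z]
    rwa [h2, hwz, neg_zero, add_zero] at h1
  have hyint : ‖y - z‖ < R / 2 := by
    refine lt_of_le_of_ne (mem_closedBall_iff_norm.1 hyD) fun h1 => ?_
    rcases le_or_gt ‖y - x₁‖ R with h2 | h2
    · have h3 := hη y h1 h2
      have h4 : Real.exp (-γ * ‖y - x₁‖ ^ 2) ≤ 1 := by
        rw [Real.exp_le_one_iff, neg_mul, neg_nonpos]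
        positivity
      have h5 : 0 < Real.exp (-γ * R ^ 2) := Real.exp_pos _
      have h6 : η / 2 * (Real.exp (-γ * ‖y - x₁‖ ^ 2) - Real.exp (-γ * R ^ 2)) ≤ η / 2 * 1 :=
        mul_le_mul_of_nonneg_left (by linarith) (by positivity)
      simp only [hφ] at hz0
      linarith
    · have h3 : Real.exp (-γ * ‖y - x₁‖ ^ 2) < Real.exp (-γ * R ^ 2) := by
        rw [Real.exp_lt_exp, neg_mul, neg_mul, neg_lt_neg_iff]
        exact mul_lt_mul_of_pos_left (pow_lt_pow_left₀ h2 hRpos.le two_ne_zero) hγpos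
      have h4 := mul_pos (half_pos hηpos) (sub_pos.2 h3)
      have h5 := hw0 y
      simp only [hφ] at hz0
      linarith
  have hloc : IsLocalMax (fun y => w y - φ y) y := by
    filter_upwards [Metric.isOpen_ball.mem_nhds (mem_ball_iff_norm.2 hyint)] with x hx
    have : w x + -φ x ≤ w y + -φ y := hmax (Metric.ball_subset_closedBall hx)
    linarith
  have h1 := hw.touch hlam (φ := φ) (φ' := fun z => (-(η / 2)) • gaussD γ x₁ z)
    (H := (-(η / 2)) • gaussH γ x₁ y) (fun a b => by simp [gaussH_symm γ x₁ y a b])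
    (Eventually.of_forall fun z => ((hasFDerivAt_gauss γ x₁ z).sub_const _).const_mul _)
    ((hasFDerivAt_gaussD γ x₁ y).const_smul (-(η / 2))) hloc (m := η / 2 * (Real.exp (-γ * ‖y - x₁‖ ^ 2) *
      (4 * γ ^ 2 * (lam * ‖y - x₁‖ ^ 2) - 2 * γ * (Lam * n)))) (by
        have := (pucciLB_neg_gauss (Lam := Lam) hlam hγpos.le x₁ y).smul (half_pos hηpos).le
        refine this.congr (fun x => ?_) hlam.le
        simp)
  simp only [_root_.smul_apply, gaussD_apply, smul_eq_mul] at h1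
  have h2 : 0 ≤ α * -w y := mul_nonneg hα (neg_nonneg.2 (hw0 y))
  have hexp : 0 < η / 2 * Real.exp (-γ * ‖y - x₁‖ ^ 2) * γ := by positivity
  have h3 : η / 2 * Real.exp (-γ * ‖y - x₁‖ ^ 2) * γ *
      (4 * γ * (lam * ‖y - x₁‖ ^ 2) - 2 * (Lam * n) - inner ℝ (y - x₁) y) ≤ 0 := by
    linarith
  have h4 : R / 2 ≤ ‖y - x₁‖ := by
    have := norm_sub_le_norm_sub_add_norm_sub z y x₁
    rw [hx₁z, norm_sub_rev] at this
    linarith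
  have h5 : ‖y - x₁‖ ≤ 3 / 2 * R := by
    have := norm_sub_le_norm_sub_add_norm_sub y z x₁
    rw [hx₁z] at this
    linarith
  have h6 : ‖y‖ ≤ ‖z‖ + R / 2 := by
    have := norm_le_norm_add_norm_sub z y
    rw [norm_sub_rev] at this
    linarith
  have h7 : inner ℝ (y - x₁) y ≤ 3 / 2 * R * (‖z‖ + R / 2) :=
    (real_inner_le_norm _ _).trans (mul_le_mul h5 h6 (norm_nonneg _) (by positivity))
  have h8 : (R / 2) ^ 2 ≤ ‖y - x₁‖ ^ 2 := pow_le_pow_left₀ (by positivity) h4 2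
  have h9 := mul_le_mul_of_nonneg_left h8 (by positivity : 0 ≤ 4 * γ * lam)
  have h10 : 0 < 4 * γ * (lam * ‖y - x₁‖ ^ 2) - 2 * (Lam * n) - inner ℝ (y - x₁) y := by
    linarith
  exact absurd h3 (not_le.2 (mul_pos hexp h10))

theorem PSub.nonpos_of_nonpos_on_ball (hlam : 0 < lam) {b : ℝ} (hb : b = 1 / (8 * Lam))
    (hle : lam ≤ Lam) {α : ℝ} {f w : En n → ℝ} (hw : PSub lam Lam α f w)
    (husc : UpperSemicontinuous w) {R₀ : ℝ} (hR₀ : 0 ≤ R₀) (hα : α ≤ 3 * b / 8 * R₀ ^ 2)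
    (hf : ∀ y, R₀ < ‖y‖ → f y ≤ 0) {C : ℝ}
    (hgrow : ∀ y, w y ≤ C * (1 + ‖y‖ ^ 2) * Real.exp (-b * ‖y‖ ^ 2))
    (hball : ∀ y, ‖y‖ ≤ R₀ → w y ≤ 0) (y : En n) : w y ≤ 0 := by
  have hLam : 0 < Lam := hlam.trans_le hle
  have hbpos : 0 < b := by rw [hb]; positivity
  have hbL : 8 * (b * Lam) = 1 := by rw [hb]; field_simp
  by_contra hcon
  have hcon := not_le.1 hcon
  set γ := b / 2 with hγ
  have hγpos : 0 < γ := by positivity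
  set g : En n → ℝ := fun y => w y * Real.exp (γ * ‖y‖ ^ 2) with hg
  have hgusc : UpperSemicontinuous g :=
    husc.mul_continuous_pos (by fun_prop) fun _ => Real.exp_pos _
  have hgy : 0 < g y := mul_pos hcon (Real.exp_pos _)
  obtain ⟨ŷ, hŷ⟩ := exists_forall_le_of_usc hgusc hgy (fun η hη => by
    obtain ⟨R, -, hR⟩ := exists_gaussian_tail_lt (E := En n) hγpos C hη
    refine ⟨R, fun y hy => lt_of_le_of_lt ?_ (hR y hy)⟩
    have h1 := mul_le_mul_of_nonneg_right (hgrow y) (Real.exp_pos (γ * ‖y‖ ^ 2)).le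
    refine h1.trans_eq ?_
    rw [mul_assoc, ← Real.exp_add]
    congr 2
    rw [hγ]; ring)
  set m := g ŷ with hm
  have hmpos : 0 < m := hgy.trans_le (hŷ y)
  set h : En n → ℝ := fun z => Real.exp (-γ * ‖z - 0‖ ^ 2) with hh
  have hwg : ∀ z, w z = g z * h z := fun z => by
    simp only [hg, hh, mul_assoc, ← Real.exp_add, sub_zero]
    simp
  have hwŷ : w ŷ = m * h ŷ := hwg ŷ
  have hhpos : ∀ z, 0 < h z := fun z => Real.exp_pos _
  have hŷR : R₀ < ‖ŷ‖ := by
    by_contra hc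
    have h1 := hball ŷ (not_lt.1 hc)
    rw [hwŷ] at h1
    exact absurd h1 (not_le.2 (mul_pos hmpos (hhpos ŷ)))
  have h1 := hw.touch hlam (φ := fun z => m * h z) (φ' := fun z => m • gaussD γ 0 z)
    (H := m • gaussH γ 0 ŷ) (fun a b => by simp [gaussH_symm γ 0 ŷ a b]) (y := ŷ)
    (Eventually.of_forall fun z => (hasFDerivAt_gauss γ 0 z).const_mul m)
    ((hasFDerivAt_gaussD γ 0 ŷ).const_smul m)
    (Eventually.of_forall fun z => by
      have h2 := mul_le_mul_of_nonneg_right (hŷ z) (hhpos z).le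
      rw [← hwg z] at h2
      simp only [hwŷ]
      linarith) ((pucciLB_gauss hlam hγpos.le 0 ŷ).smul hmpos.le)
  simp only [_root_.smul_apply, gaussD_apply, sub_zero, real_inner_self_eq_norm_sq,
    smul_eq_mul] at h1
  have e1 : Real.exp (-γ * ‖ŷ‖ ^ 2) = h ŷ := by simp [hh]
  rw [e1, hwŷ] at h1
  have h2 := hf ŷ hŷR
  have h3 : 0 < m * h ŷ := mul_pos hmpos (hhpos ŷ)
  have h4 : (m * h ŷ) * (2 * γ * (lam * n) - 4 * γ ^ 2 * (Lam * ‖ŷ‖ ^ 2) + γ * ‖ŷ‖ ^ 2 - α) ≤ 0 := by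
    linarith
  have h5 : 4 * γ ^ 2 * (Lam * ‖ŷ‖ ^ 2) = b / 8 * ‖ŷ‖ ^ 2 := by
    rw [hγ]
    linear_combination (b / 8 * ‖ŷ‖ ^ 2) * hbL
  have h6 : 0 ≤ 2 * γ * (lam * n) := by positivity
  have h7 : R₀ ^ 2 < ‖ŷ‖ ^ 2 := pow_lt_pow_left₀ hŷR hR₀ (by norm_num)
  have h8 := mul_lt_mul_of_pos_left h7 (by positivity : 0 < 3 * b / 8)
  have h9 : 0 < 2 * γ * (lam * n) - 4 * γ ^ 2 * (Lam * ‖ŷ‖ ^ 2) + γ * ‖ŷ‖ ^ 2 - α := by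
    rw [h5, hγ] at *
    linarith
  exact absurd h4 (not_le.2 (mul_pos h3 h9))

end MaximumPrinciples

theorem exists_le_of_usc_on_ball {E : Type*} [NormedAddCommGroup E] [ProperSpace E]
    {u : E → ℝ} (hu : UpperSemicontinuous u) (R : ℝ) :
    ∃ M : ℝ, 0 < M ∧ ∀ y, ‖y‖ ≤ R → u y ≤ M := by
  rcases lt_or_ge R 0 with hR | hR
  · exact ⟨1, one_pos, fun y hy => absurd ((norm_nonneg y).trans hy) (not_le.2 hR)⟩
  obtain ⟨z, -, hmax⟩ := (hu.upperSemicontinuousOn (Metric.closedBall (0 : E) R)).exists_isMaxOn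
    ⟨0, by simpa using hR⟩ (isCompact_closedBall _ _)
  refine ⟨max (u z) 1, by positivity, fun y hy => le_max_of_le_left (hmax (by simpa using hy))⟩

theorem exists_ge_of_lsc_on_ball {E : Type*} [NormedAddCommGroup E] [ProperSpace E]
    {v : E → ℝ} (hv : LowerSemicontinuous v) (hpos : ∀ y, 0 < v y) (R : ℝ) :
    ∃ δ : ℝ, 0 < δ ∧ ∀ y, ‖y‖ ≤ R → δ ≤ v y := by
  rcases lt_or_ge R 0 with hR | hR
  · exact ⟨1, one_pos, fun y hy => absurd ((norm_nonneg y).trans hy) (not_le.2 hR)⟩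
  obtain ⟨z, -, hmin⟩ := (hv.lowerSemicontinuousOn (Metric.closedBall (0 : E) R)).exists_isMinOn
    ⟨0, by simpa using hR⟩ (isCompact_closedBall _ _)
  exact ⟨v z, hpos z, fun y hy => hmin (by simpa using hy)⟩

section Sliding

variable {n : ℕ} {lam Lam : ℝ}

theorem exists_radius {b : ℝ} (hb : 0 < b) {α : ℝ} (hα : 0 ≤ α) :
    ∃ R : ℝ, 0 < R ∧ α ≤ 3 * b / 8 * R ^ 2 := by
  have h0 : 0 ≤ 8 * α / (3 * b) := by positivity
  refine ⟨8 * α / (3 * b) + 1, by positivity, ?_⟩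
  have h1 : α = 3 * b / 8 * (8 * α / (3 * b)) := by field_simp
  conv_lhs => rw [h1]
  refine mul_le_mul_of_nonneg_left ?_ (by positivity)
  nlinarith

theorem JSub.sliding (hlam : 0 < lam) (hle : lam ≤ Lam) {b : ℝ} (hb : b = 1 / (8 * Lam))
    {F : Mat n → ℝ} (hF : UniformlyElliptic n lam Lam F) (hFh : PositivelyHomogeneous n F)
    {α : ℝ} (hα : 0 ≤ α) {f g u v : En n → ℝ} (hu : JSub F α f u) (hv : JSup F α g v)
    (hf : Continuous f) (hg : Continuous g) (husc : UpperSemicontinuous u)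
    (hlsc : LowerSemicontinuous v) (hpos : ∀ y, 0 < v y) {C : ℝ}
    (hgrow : ∀ y, u y ≤ C * (1 + ‖y‖ ^ 2) * Real.exp (-b * ‖y‖ ^ 2)) {t₀ : ℝ} (ht₀ : 0 ≤ t₀)
    (hfg : ∀ t, t₀ ≤ t → ∀ y, f y ≤ t * g y) :
    (∀ y, u y ≤ t₀ * v y) ∨ ∃ t, t₀ < t ∧ ∀ y, u y = t * v y := by
  have hLam : 0 < Lam := hlam.trans_le hle
  have hbpos : 0 < b := by rw [hb]; positivity
  obtain ⟨R₀, hR₀, hαR⟩ := exists_radius hbpos hα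
  have hvt : ∀ t, 0 < t → LowerSemicontinuous fun y => t * v y := by
    intro t ht y s hs
    have : s / t < v y := by rwa [div_lt_iff₀' ht]
    filter_upwards [hlsc y _ this] with z hz
    exact (div_lt_iff₀' ht).1 hz
  have hwusc : ∀ t, 0 < t → UpperSemicontinuous fun y => u y - t * v y := fun t ht => by
    simp only [sub_eq_add_neg]
    exact husc.add (hvt t ht).neg_usc
  have hw : ∀ t, t₀ < t → PSub lam Lam α (fun _ => 0) fun y => u y - t * v y := fun t ht =>
    (JSub.sub_pSub hlam hle hF hu (hv.smul hFh (ht₀.trans_lt ht)) hf (by fun_prop) husc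
      (hvt t (ht₀.trans_lt ht))).mono fun y => by linarith [hfg t ht.le y]
  have hmp : ∀ t, t₀ < t → (∀ y, ‖y‖ ≤ R₀ → u y - t * v y ≤ 0) → ∀ y, u y - t * v y ≤ 0 := by
    intro t ht h
    have ht' := ht₀.trans_lt ht
    exact (hw t ht).nonpos_of_nonpos_on_ball hlam hb hle (hwusc t ht') hR₀.le hαR
      (fun _ _ => le_rfl) (fun y => (sub_le_self _ (mul_pos ht' (hpos y)).le).trans (hgrow y)) h
  set S : Set ℝ := {t | t₀ < t ∧ ∀ y, u y - t * v y ≤ 0} with hS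
  have hSne : S.Nonempty := by
    obtain ⟨M, hM, hM'⟩ := exists_le_of_usc_on_ball husc R₀
    obtain ⟨δ, hδ, hδ'⟩ := exists_ge_of_lsc_on_ball hlsc hpos R₀
    have h1 : t₀ < t₀ + M / δ := by linarith [div_pos hM hδ]
    refine ⟨t₀ + M / δ, h1, hmp _ h1 fun y hy => ?_⟩
    have h2 : M / δ * δ ≤ M / δ * v y := mul_le_mul_of_nonneg_left (hδ' y hy) (by positivity)
    rw [div_mul_cancel₀ _ hδ.ne'] at h2
    have h3 := mul_nonneg ht₀ (hpos y).le
    linarith [hM' y hy]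
  have hSb : BddBelow S := ⟨t₀, fun t ht => ht.1.le⟩
  set t := sInf S with htdef
  have ht : t₀ ≤ t := le_csInf hSne fun s hs => hs.1.le
  have hw0 : ∀ y, u y - t * v y ≤ 0 := by
    intro y
    have h1 : u y / v y ≤ t := le_csInf hSne fun s hs => by
      rw [div_le_iff₀ (hpos y)]
      linarith [hs.2 y]
    rw [div_le_iff₀ (hpos y)] at h1
    linarith
  rcases ht.eq_or_lt with h | h
  · left
    intro y
    rw [h]
    linarith [hw0 y]
  rcases (hw t h).strong_max hlam hle hα (hwusc t (ht₀.trans_lt h)) hw0 with h1 | h1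
  · exact Or.inr ⟨t, h, fun y => by linarith [h1 y]⟩
  exfalso
  obtain ⟨s₀, hs₀⟩ := exists_between h
  let ι := {s : ℝ // t₀ < s ∧ s < t}
  have : Nonempty ι := ⟨⟨s₀, hs₀⟩⟩
  obtain ⟨s, hs⟩ := (isCompact_closedBall (0 : En n) R₀).elim_directed_cover
    (fun s : ι => {y | u y - s.1 * v y < 0})
    (fun s => (hwusc s.1 (ht₀.trans_lt s.2.1)).isOpen_preimage 0)
    (fun y _ => by
      have h2 : ∀ᶠ s in 𝓝 t, u y - s * v y < 0 := by
        have hc : Continuous fun s => u y - s * v y := by fun_prop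
        exact hc.continuousAt.eventually (gt_mem_nhds (h1 y))
      have h3 : ∀ᶠ s in 𝓝[<] t, t₀ < s ∧ s < t := Ioo_mem_nhdsLT h
      obtain ⟨s, hs1, hs2⟩ := ((h2.filter_mono nhdsWithin_le_nhds).and h3).exists
      exact mem_iUnion.2 ⟨⟨s, hs2⟩, hs1⟩)
    (fun s s' => by
      have hmono : ∀ s s' : ι, s.1 ≤ s'.1 →
          {y | u y - s.1 * v y < 0} ⊆ {y | u y - s'.1 * v y < 0} := fun s s' hss y hy =>
        lt_of_le_of_lt (sub_le_sub_left (mul_le_mul_of_nonneg_right hss (hpos y).le) _) hy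
      rcases le_total s.1 s'.1 with h2 | h2
      · exact ⟨s', hmono _ _ h2, subset_rfl⟩
      · exact ⟨s, subset_rfl, hmono _ _ h2⟩)
  have h2 : s.1 ∈ S := ⟨s.2.1, hmp s.1 s.2.1 fun y hy => le_of_lt (hs (by simpa using hy))⟩
  exact absurd (csInf_le hSb h2) (not_le.2 s.2.2)

end Sliding

section Stability

variable {n : ℕ} {lam Lam : ℝ}

/-- Stability of subsolutions under half-relaxed limits. -/
theorem JSub.of_approx (hlam : 0 < lam) (hle : lam ≤ Lam) {F : Mat n → ℝ}
    (hF : UniformlyElliptic n lam Lam F) {α : ℝ} {f u : En n → ℝ} (hf : Continuous f)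
    (h : ∀ x₀ : En n, ∀ ε : ℝ, 0 < ε → ∃ (α' : ℝ) (f' v : En n → ℝ), UpperSemicontinuous v ∧
      JSub F α' f' v ∧ |α' - α| ≤ ε ∧ (∀ y, ‖y - x₀‖ ≤ 1 → |f' y - f y| ≤ ε) ∧
      (∀ y, ‖y - x₀‖ ≤ 1 → v y ≤ u y + ε) ∧ ∃ x, ‖x - x₀‖ ≤ ε ∧ u x₀ - ε ≤ v x) :
    JSub F α f u := by
  intro x₀ p X hX hj
  suffices key : ∀ κ : ℝ, 0 < κ →
      F (bmat (X + (2 * κ) • idForm n)) - 1 / 2 * p x₀ - α * u x₀ - f x₀ ≤ 0 by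
    refine le_of_forall_add_mul (c := 2 * (Lam * n)) fun κ hκ => ?_
    have h1 := key κ hκ
    have h2 := ellip_add_id_le hlam hle hF hX (by positivity : 0 ≤ 2 * κ)
    linarith
  intro κ hκ
  set Y := X + (2 * κ) • idForm n with hYdef
  have hY : ∀ a b, Y a b = Y b a := fun a b => by
    simp [hYdef, hX a b, idForm_apply, real_inner_comm]
  obtain ⟨r₀, hr₀, hball⟩ := Metric.eventually_nhds_iff_ball.1 hj
  set r := min (r₀ / 2) 1 with hr
  have hrpos : 0 < r := by positivity
  set P : En n → ℝ := fun y => u x₀ + p (y - x₀) + 1 / 2 * Y (y - x₀) (y - x₀) with hP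
  have hPc : Continuous P := by fun_prop
  have hPx₀ : P x₀ = u x₀ := by simp [hP]
  have huP : ∀ y, ‖y - x₀‖ ≤ r → u y ≤ P y - κ * ‖y - x₀‖ ^ 2 := by
    intro y hy
    have h1 := hball (y - x₀) (by
      rw [mem_ball_zero_iff]
      exact lt_of_le_of_lt (hy.trans (min_le_left _ _)) (half_lt_self hr₀))
    rw [add_sub_cancel] at h1
    simp only [hP, hYdef, _root_.add_apply, _root_.smul_apply, idForm_apply, smul_eq_mul,
      real_inner_self_eq_norm_sq]
    linarith
  set ε : ℕ → ℝ := fun k => 1 / ((k : ℝ) + 1) with hε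
  have hεpos : ∀ k, 0 < ε k := fun k => by positivity
  have hε0 : Tendsto ε atTop (𝓝 0) := tendsto_one_div_add_atTop_nhds_zero_nat
  choose α' f' v hvusc hv hα' hf' hvu x hx hxu using fun k => h x₀ (ε k) (hεpos k)
  have hmaxex : ∀ k, ∃ y ∈ Metric.closedBall x₀ r,
      ∀ z ∈ Metric.closedBall x₀ r, v k z - P z ≤ v k y - P y := by
    intro k
    obtain ⟨y, hy, hmax⟩ := (((hvusc k).add_continuous hPc.neg).upperSemicontinuousOn
      (Metric.closedBall x₀ r)).exists_isMaxOn ⟨x₀, Metric.mem_closedBall_self hrpos.le⟩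
      (isCompact_closedBall _ _)
    refine ⟨y, hy, fun z hz => ?_⟩
    have : v k z + -P z ≤ v k y + -P y := hmax hz
    linarith
  choose y hy hmax using hmaxex
  have hyr : ∀ k, ‖y k - x₀‖ ≤ r := fun k => mem_closedBall_iff_norm.1 (hy k)
  have hx0 : Tendsto x atTop (𝓝 x₀) := by
    rw [tendsto_iff_norm_sub_tendsto_zero]
    exact squeeze_zero (fun _ => norm_nonneg _) hx hε0
  set s : ℕ → ℝ := fun k => ε k + (P (x k) - u x₀) with hs
  have hs0 : Tendsto s atTop (𝓝 0) := by
    have h1 := (hPc.tendsto x₀).comp hx0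
    rw [hPx₀] at h1
    simpa using hε0.add (h1.sub_const (u x₀))
  have hlow : ∀ᶠ k in atTop, -s k ≤ v k (y k) - P (y k) := by
    filter_upwards [hε0.eventually (gt_mem_nhds hrpos)] with k hk
    have h1 := hmax k (x k) (mem_closedBall_iff_norm.2 ((hx k).trans hk.le))
    have h2 := hxu k
    simp only [hs]
    linarith
  have hup : ∀ k, v k (y k) ≤ P (y k) - κ * ‖y k - x₀‖ ^ 2 + ε k := fun k =>
    (hvu k _ ((hyr k).trans (min_le_right _ _))).trans (by linarith [huP _ (hyr k)])
  have hy0 : Tendsto y atTop (𝓝 x₀) := by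
    rw [tendsto_iff_norm_sub_tendsto_zero]
    have h1 : Tendsto (fun k => ‖y k - x₀‖ ^ 2) atTop (𝓝 0) := by
      have h2 : Tendsto (fun k => (ε k + s k) / κ) atTop (𝓝 0) := by
        simpa using (hε0.add hs0).div_const κ
      refine squeeze_zero' (Eventually.of_forall fun _ => by positivity) ?_ h2
      filter_upwards [hlow] with k hk
      rw [le_div_iff₀ hκ]
      linarith [hup k]
    have h2 := h1.sqrt
    simpa using h2
  have hPy : Tendsto (fun k => P (y k)) atTop (𝓝 (u x₀)) := by
    have h1 := (hPc.tendsto x₀).comp hy0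
    rwa [hPx₀] at h1
  have hvy : Tendsto (fun k => v k (y k)) atTop (𝓝 (u x₀)) := by
    refine tendsto_of_tendsto_of_tendsto_of_le_of_le' (g := fun k => P (y k) - s k)
      (h := fun k => P (y k) + ε k) (by simpa using hPy.sub hs0) (by simpa using hPy.add hε0) ?_ ?_
    · filter_upwards [hlow] with k hk
      linarith
    · refine Eventually.of_forall fun k => ?_
      have := hup k
      have h3 : 0 ≤ κ * ‖y k - x₀‖ ^ 2 := by positivity
      linarith
  have hfy : Tendsto (fun k => f' k (y k)) atTop (𝓝 (f x₀)) := by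
    have h1 : Tendsto (fun k => f' k (y k) - f (y k)) atTop (𝓝 0) :=
      squeeze_zero_norm (fun k => hf' k _ ((hyr k).trans (min_le_right _ _))) hε0
    simpa using h1.add ((hf.tendsto x₀).comp hy0)
  have hαy : Tendsto α' atTop (𝓝 α) := by
    have h1 : Tendsto (fun k => α' k - α) atTop (𝓝 0) := squeeze_zero_norm hα' hε0
    simpa using h1.add_const α
  have hineq : ∀ᶠ k in atTop, F (bmat Y) - 1 / 2 * (p (y k) + Y (y k - x₀) (y k)) -
      α' k * v k (y k) - f' k (y k) ≤ 0 := by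
    have hnear : ∀ᶠ k in atTop, ‖y k - x₀‖ < r := by
      have := (tendsto_iff_norm_sub_tendsto_zero.1 hy0).eventually (gt_mem_nhds hrpos)
      exact this
    filter_upwards [hnear] with k hk
    have h1 := hv k (y k) (p + Y (y k - x₀)) Y hY (by
      have h2 : ∀ᶠ d in 𝓝 (0 : En n), ‖y k + d - x₀‖ < r := by
        have hc : Continuous fun d : En n => ‖y k + d - x₀‖ := by fun_prop
        exact hc.continuousAt.eventually (gt_mem_nhds (by simpa using hk))
      filter_upwards [h2] with d hd
      have h3 := hmax k _ (mem_closedBall_iff_norm.2 hd.le)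
      have e1 : y k + d - x₀ = (y k - x₀) + d := by abel
      simp only [hP, e1, quad_expand hY, map_add p] at h3
      simp only [_root_.add_apply]
      linarith)
    simpa only [_root_.add_apply] using h1
  have hyx : Tendsto (fun k => y k - x₀) atTop (𝓝 0) := by simpa using hy0.sub_const x₀
  have hYy := ((Y.continuous.tendsto _).comp hyx).clm_apply_apply hy0
  have hpy := (p.continuous.tendsto _).comp hy0
  have hlim := ((((hpy.add hYy).const_mul (1 / 2 : ℝ)).const_sub (F (bmat Y))).sub
    (hαy.mul hvy)).sub hfy
  have := le_of_tendsto hlim hineq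
  simpa using this

end Stability

/-- The upper semicontinuous envelope of a locally bounded function. -/
def uscEnv {T : Type*} [TopologicalSpace T] (u : T → ℝ) (y : T) : ℝ :=
  sInf {c | ∀ᶠ z in 𝓝 y, u z ≤ c}

section Envelope

variable {T : Type*} [TopologicalSpace T] {u ψ : T → ℝ}

theorem uscEnv_bddBelow (y : T) : BddBelow {c | ∀ᶠ z in 𝓝 y, u z ≤ c} :=
  ⟨u y, fun _ hc => hc.self_of_nhds⟩

theorem eventually_le_add_of_le_continuous (hψ : Continuous ψ) (hu : ∀ y, u y ≤ ψ y) (y : T)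
    {ε : ℝ} (hε : 0 < ε) : ∀ᶠ z in 𝓝 y, u z ≤ ψ y + ε := by
  filter_upwards [hψ.continuousAt.eventually (gt_mem_nhds (lt_add_of_pos_right (ψ y) hε))] with z hz
  exact (hu z).trans hz.le

theorem uscEnv_le (hψ : Continuous ψ) (hu : ∀ y, u y ≤ ψ y) (y : T) : uscEnv u y ≤ ψ y :=
  le_of_forall_pos_le_add fun _ hε =>
    csInf_le (uscEnv_bddBelow y) (eventually_le_add_of_le_continuous hψ hu y hε)

theorem le_uscEnv (hψ : Continuous ψ) (hu : ∀ y, u y ≤ ψ y) (y : T) : u y ≤ uscEnv u y :=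
  le_csInf ⟨_, eventually_le_add_of_le_continuous hψ hu y one_pos⟩ fun _ hc => hc.self_of_nhds

theorem upperSemicontinuous_uscEnv (hψ : Continuous ψ) (hu : ∀ y, u y ≤ ψ y) :
    UpperSemicontinuous (uscEnv u) := by
  intro y t ht
  obtain ⟨c, hc, hct⟩ := exists_lt_of_csInf_lt (s := {c | ∀ᶠ z in 𝓝 y, u z ≤ c})
    ⟨_, eventually_le_add_of_le_continuous hψ hu y one_pos⟩ ht
  filter_upwards [eventually_eventually_nhds.2 hc] with z hz
  exact lt_of_le_of_lt (csInf_le (uscEnv_bddBelow z) hz) hct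

theorem frequently_uscEnv_sub_lt (y : T) {ε : ℝ} (hε : 0 < ε) :
    ∃ᶠ x in 𝓝 y, uscEnv u y - ε < u x := by
  intro h
  have h1 : uscEnv u y ≤ uscEnv u y - ε :=
    csInf_le (uscEnv_bddBelow y) (h.mono fun z hz => not_lt.1 hz)
  linarith

end Envelope

section Perron

variable {n : ℕ} {lam Lam : ℝ}

/-- Subsolutions lying between `0` and `ψ`. -/
def perronFamily (F : Mat n → ℝ) (α : ℝ) (f ψ : En n → ℝ) : Set (En n → ℝ) :=
  {v | UpperSemicontinuous v ∧ JSub F α f v ∧ (∀ y, 0 ≤ v y) ∧ ∀ y, v y ≤ ψ y}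

theorem exists_perron_greatest (hlam : 0 < lam) (hle : lam ≤ Lam) {F : Mat n → ℝ}
    (hF : UniformlyElliptic n lam Lam F) (hFh : PositivelyHomogeneous n F) {α : ℝ}
    {f ψ : En n → ℝ} (hf : Continuous f) (hf0 : ∀ y, 0 ≤ f y) (hψ : Continuous ψ)
    (hψ0 : ∀ y, 0 ≤ ψ y) :
    ∃ u ∈ perronFamily F α f ψ, ∀ v ∈ perronFamily F α f ψ, ∀ y, v y ≤ u y := by
  set S := perronFamily F α f ψ with hS
  have h0 : (fun _ => (0 : ℝ)) ∈ S := by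
    refine ⟨continuous_const.upperSemicontinuous, ?_, fun _ => le_rfl, hψ0⟩
    have h1 := jSup_zero (α := α) hlam hle hF.refl hFh.refl
    simp only [JSup, neg_zero, Frefl_Frefl] at h1
    exact h1.congr fun y => by linarith [hf0 y]
  have : Nonempty S := ⟨⟨_, h0⟩⟩
  set W : En n → ℝ := fun y => ⨆ v : S, v.1 y with hW
  have hbdd : ∀ y, BddAbove (range fun v : S => v.1 y) := fun y =>
    ⟨ψ y, by rintro _ ⟨v, rfl⟩; exact v.2.2.2.2 y⟩
  have hvW : ∀ v ∈ S, ∀ y, v y ≤ W y := fun v hv y => le_ciSup (hbdd y) ⟨v, hv⟩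
  have hWψ : ∀ y, W y ≤ ψ y := fun y => ciSup_le fun v => v.2.2.2.2 y
  have hWle := le_uscEnv hψ hWψ
  refine ⟨uscEnv W, ⟨upperSemicontinuous_uscEnv hψ hWψ, ?_,
    fun y => (hvW _ h0 y).trans (hWle y), uscEnv_le hψ hWψ⟩,
    fun v hv y => (hvW v hv y).trans (hWle y)⟩
  refine JSub.of_approx hlam hle hF hf fun x₀ ε hε => ?_
  obtain ⟨x, hx1, hx2⟩ := ((frequently_uscEnv_sub_lt (u := W) x₀ (half_pos hε)).and_eventually
    (Metric.closedBall_mem_nhds x₀ hε)).exists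
  obtain ⟨v, hv⟩ := exists_lt_of_lt_ciSup (show W x - ε / 2 < W x by linarith)
  refine ⟨α, f, v.1, v.2.1, v.2.2.1, by simpa using hε.le, fun y _ => by simpa using hε.le,
    fun y _ => ?_, x, mem_closedBall_iff_norm.1 hx2, ?_⟩
  · linarith [hvW v.1 v.2 y, hWle y]
  · linarith

theorem quad_shift {X : En n →L[ℝ] En n →L[ℝ] ℝ} (hX : ∀ h l, X h l = X l h)
    (p : En n →L[ℝ] ℝ) (c : ℝ) (x₀ y d : En n) :
    c + p (y + d - x₀) + 1 / 2 * X (y + d - x₀) (y + d - x₀) =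
      c + p (y - x₀) + 1 / 2 * X (y - x₀) (y - x₀) + (p + X (y - x₀)) d + 1 / 2 * X d d := by
  have e1 : y + d - x₀ = (y - x₀) + d := by abel
  rw [e1, quad_expand hX, map_add p, _root_.add_apply]
  ring

/-- Replacing a subsolution by its maximum with a quadratic subsolution in a small ball. -/
theorem JSub.max_quad (hlam : 0 < lam) (hle : lam ≤ Lam) {F : Mat n → ℝ}
    (hF : UniformlyElliptic n lam Lam F) {α : ℝ} {f u : En n → ℝ} (hu : JSub F α f u)
    (husc : UpperSemicontinuous u)
    {X : En n →L[ℝ] En n →L[ℝ] ℝ} (hX : ∀ h l, X h l = X l h) {p : En n →L[ℝ] ℝ} {c ρ ρ' : ℝ}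
    {x₀ : En n} (hρ : ρ' < ρ) {P û : En n → ℝ}
    (hP : ∀ y, P y = c + p (y - x₀) + 1 / 2 * X (y - x₀) (y - x₀))
    (hsub : ∀ y, ‖y - x₀‖ < ρ →
      F (bmat X) - 1 / 2 * (p + X (y - x₀)) y - α * P y - f y ≤ 0)
    (hout : ∀ y, ‖y - x₀‖ < ρ → ρ' < ‖y - x₀‖ → P y ≤ u y)
    (hû1 : ∀ y, ‖y - x₀‖ < ρ → û y = max (u y) (P y)) (hû2 : ∀ y, ρ ≤ ‖y - x₀‖ → û y = u y) :
    UpperSemicontinuous û ∧ JSub F α f û := by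
  have hcn : Continuous fun y : En n => ‖y - x₀‖ := by fun_prop
  have hPc : Continuous P := by
    have : P = fun y => c + p (y - x₀) + 1 / 2 * X (y - x₀) (y - x₀) := funext hP
    rw [this]
    fun_prop
  have huû : ∀ y, u y ≤ û y := fun y => by
    rcases lt_or_ge ‖y - x₀‖ ρ with h | h
    · rw [hû1 y h]; exact le_max_left _ _
    · exact (hû2 y h).ge
  constructor
  · intro y t ht
    rcases lt_or_ge ‖y - x₀‖ ρ with h | h
    · rw [hû1 y h, max_lt_iff] at ht
      filter_upwards [husc y t ht.1, hPc.continuousAt.eventually (gt_mem_nhds ht.2),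
        hcn.continuousAt.eventually (gt_mem_nhds h)] with z h1 h2 h3
      rw [hû1 z h3]
      exact max_lt h1 h2
    · rw [hû2 y h] at ht
      filter_upwards [husc y t ht, hcn.continuousAt.eventually (lt_mem_nhds (hρ.trans_le h))]
        with z h1 h2
      rcases lt_or_ge ‖z - x₀‖ ρ with h3 | h3
      · rw [hû1 z h3, max_eq_left (hout z h3 h2)]
        exact h1
      · rw [hû2 z h3]
        exact h1
  · intro y q Z hZ hj
    by_cases hc : û y = u y
    · rw [hc] at hj ⊢
      exact hu y q Z hZ (hj.mono fun d hd => (huû _).trans hd)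
    · have h : ‖y - x₀‖ < ρ := by
        by_contra h
        exact hc (hû2 y (not_lt.1 h))
      have hyP : û y = P y := by
        rw [hû1 y h] at hc ⊢
        rcases max_choice (u y) (P y) with h1 | h1
        · exact absurd h1 hc
        · exact h1
      have h1 : ∀ᶠ d in 𝓝 (0 : En n),
          (p + X (y - x₀) - q) d + 1 / 2 * (X - Z) d d ≤ 0 := by
        have h2 : ∀ᶠ d in 𝓝 (0 : En n), ‖y + d - x₀‖ < ρ := by
          have hc : Continuous fun d : En n => ‖y + d - x₀‖ := by fun_prop
          exact hc.continuousAt.eventually (gt_mem_nhds (by simpa using h))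
        filter_upwards [hj, h2] with d h3 h4
        have h5 : P (y + d) ≤ û (y + d) := by
          rw [hû1 _ h4]; exact le_max_right _ _
        have h6 := h5.trans h3
        rw [hyP, hP (y + d), quad_shift hX, ← hP y] at h6
        simp only [_root_.sub_apply]
        linarith
      have h2 := le_zero_of_jet h1
      have h3 : q y = (p + X (y - x₀)) y := by
        have := (h2 y).1
        rw [_root_.sub_apply] at this
        linarith
      have h4 := hF.le_sub hle (X := X) (Y := Z) (m := 0) hX hZ (by
        have := pucciLB_of_le (Lam := Lam) hlam (H := X - Z) le_rfl (fun x => by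
          rw [zero_mul]; exact (h2 x).2)
        simpa using this)
      have h5 := hsub y h
      rw [hyP, h3]
      linarith

/-- Perron's method: a subsolution and its lower semicontinuous envelope, a supersolution. -/
theorem exists_perron_pair (hlam : 0 < lam) (hle : lam ≤ Lam) {F : Mat n → ℝ}
    (hF : UniformlyElliptic n lam Lam F) (hFh : PositivelyHomogeneous n F) {α : ℝ}
    {f ψ : En n → ℝ} (hf : Continuous f) (hf0 : ∀ y, 0 ≤ f y) (hψ : Continuous ψ)
    (hψ0 : ∀ y, 0 ≤ ψ y) (hψs : JSup F α f ψ) :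
    ∃ u v : En n → ℝ, UpperSemicontinuous u ∧ LowerSemicontinuous v ∧ JSub F α f u ∧
      JSup F α f v ∧ (∀ y, 0 ≤ v y) ∧ (∀ y, v y ≤ u y) ∧ ∀ y, u y ≤ ψ y := by
  obtain ⟨u, ⟨husc, hu, hu0, huψ⟩, hgreat⟩ :=
    exists_perron_greatest (α := α) hlam hle hF hFh hf hf0 hψ hψ0
  have hneg : ∀ y, -u y ≤ (fun _ => (0 : ℝ)) y := fun y => neg_nonpos.2 (hu0 y)
  have hc0 : Continuous fun _ : En n => (0 : ℝ) := continuous_const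
  set v : En n → ℝ := fun y => -uscEnv (fun z => -u z) y with hv
  have hvu : ∀ y, v y ≤ u y := fun y => neg_le.1 (le_uscEnv hc0 hneg y)
  have hv0 : ∀ y, 0 ≤ v y := fun y => neg_nonneg.2 (uscEnv_le hc0 hneg y)
  have hvlsc : LowerSemicontinuous v := by
    intro y t ht
    filter_upwards [upperSemicontinuous_uscEnv hc0 hneg y (-t) (by linarith [show t < v y from ht])]
      with z hz
    simp only [hv]
    linarith
  refine ⟨u, v, husc, hvlsc, hu, ?_, hv0, hvu, huψ⟩
  rw [jSup_iff]
  intro x₀ p X hX hj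
  by_contra hcon
  have hcon := not_le.1 hcon
  have hvψ : v x₀ < ψ x₀ := by
    refine lt_of_le_of_ne ((hvu x₀).trans (huψ x₀)) fun he => ?_
    have h1 := jSup_iff.1 hψs x₀ p X hX (by
      filter_upwards [hj] with d hd
      rw [← he]
      exact hd.trans ((hvu _).trans (huψ _)))
    rw [← he] at h1
    exact absurd h1 (not_le.2 hcon)
  set E := F (bmat X) - 1 / 2 * p x₀ - α * v x₀ - f x₀ with hE
  obtain ⟨κ, hκ, hκE⟩ : ∃ κ : ℝ, 0 < κ ∧ E + 2 * κ * (Lam * n) < 0 := by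
    have hc : Continuous fun κ : ℝ => E + 2 * κ * (Lam * n) := by fun_prop
    have h1 : ∀ᶠ κ in 𝓝[>] (0 : ℝ), E + 2 * κ * (Lam * n) < 0 :=
      (hc.continuousAt.eventually (gt_mem_nhds (by simpa using hcon))).filter_mono
        nhdsWithin_le_nhds
    obtain ⟨κ, h2, h3⟩ := (h1.and self_mem_nhdsWithin).exists
    exact ⟨κ, h3, h2⟩
  set Y := X - (2 * κ) • idForm n with hYdef
  have hY : ∀ a b, Y a b = Y b a := fun a b => by
    simp [hYdef, hX a b, idForm_apply, real_inner_comm]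
  have hFY : F (bmat Y) ≤ F (bmat X) + 2 * κ * (Lam * n) := by
    have h1 := ellip_add_id_le hlam hle hF hY (by positivity : 0 ≤ 2 * κ)
    have e : Y + (2 * κ) • idForm n = X := by
      rw [hYdef]
      abel
    rwa [e] at h1
  set P : ℝ → En n → ℝ := fun δ y => v x₀ + δ + p (y - x₀) + 1 / 2 * Y (y - x₀) (y - x₀) with hP
  have hPc : Continuous fun q : ℝ × En n => P q.1 q.2 := by fun_prop
  have hPx₀ : ∀ δ, P δ x₀ = v x₀ + δ := fun δ => by simp [hP]
  have h1 : ∀ᶠ q : ℝ × En n in 𝓝 (0, x₀),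
      F (bmat Y) - 1 / 2 * (p + Y (q.2 - x₀)) q.2 - α * P q.1 q.2 - f q.2 < 0 := by
    have hc : Continuous fun q : ℝ × En n =>
        F (bmat Y) - 1 / 2 * (p + Y (q.2 - x₀)) q.2 - α * P q.1 q.2 - f q.2 := by fun_prop
    refine hc.continuousAt.eventually (gt_mem_nhds ?_)
    simp only [hPx₀, sub_self, map_zero, add_zero]
    linarith
  have h2 : ∀ᶠ q : ℝ × En n in 𝓝 (0, x₀), P q.1 q.2 < ψ q.2 := by
    refine hPc.continuousAt.eventually_lt (hψ.comp continuous_snd).continuousAt ?_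
    simpa [hPx₀] using hvψ
  obtain ⟨ρ₁, hρ₁, hball⟩ := Metric.eventually_nhds_iff_ball.1 (h1.and h2)
  obtain ⟨ρ₂, hρ₂, hjet⟩ := Metric.eventually_nhds_iff_ball.1 hj
  set ρ := min ρ₁ ρ₂ with hρ
  have hρpos : 0 < ρ := lt_min hρ₁ hρ₂
  set δ := min (ρ / 2) (κ * (ρ / 2) ^ 2) with hδ
  have hδpos : 0 < δ := by positivity
  have hb : ∀ y, ‖y - x₀‖ < ρ →
      F (bmat Y) - 1 / 2 * (p + Y (y - x₀)) y - α * P δ y - f y < 0 ∧ P δ y < ψ y := by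
    intro y hy
    refine hball (δ, y) ?_
    rw [mem_ball_iff_norm, Prod.norm_def]
    refine max_lt ?_ (hy.trans_le (min_le_left _ _))
    simp only [Prod.fst_sub, sub_zero, Real.norm_eq_abs, abs_of_pos hδpos]
    have : δ ≤ ρ / 2 := min_le_left _ _
    have : ρ ≤ ρ₁ := min_le_left _ _
    linarith
  classical
  set û : En n → ℝ := fun y => if ‖y - x₀‖ < ρ then max (u y) (P δ y) else u y with hû
  have hû1 : ∀ y, ‖y - x₀‖ < ρ → û y = max (u y) (P δ y) := fun y hy => if_pos hy
  have hû2 : ∀ y, ρ ≤ ‖y - x₀‖ → û y = u y := fun y hy => if_neg (not_lt.2 hy)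
  obtain ⟨hûusc, hûsub⟩ := hu.max_quad hlam hle hF husc hY (p := p) (c := v x₀ + δ)
    (half_lt_self hρpos) (P := P δ) (û := û) (fun y => rfl) (fun y hy => (hb y hy).1.le)
    (fun y hy1 hy2 => by
      have h3 := hjet (y - x₀) (by
        rw [mem_ball_zero_iff]
        exact hy1.trans_le (min_le_right _ _))
      rw [add_sub_cancel] at h3
      have h4 : δ ≤ κ * (ρ / 2) ^ 2 := min_le_right _ _
      have h5 : κ * (ρ / 2) ^ 2 ≤ κ * ‖y - x₀‖ ^ 2 := by gcongr
      simp only [hP, hYdef, _root_.sub_apply, _root_.smul_apply, idForm_apply, smul_eq_mul,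
        real_inner_self_eq_norm_sq]
      linarith [hvu y]) hû1 hû2
  have hmem : û ∈ perronFamily F α f ψ := by
    refine ⟨hûusc, hûsub, fun y => ?_, fun y => ?_⟩
    · rcases lt_or_ge ‖y - x₀‖ ρ with h | h
      · rw [hû1 y h]; exact le_max_of_le_left (hu0 y)
      · rw [hû2 y h]; exact hu0 y
    · rcases lt_or_ge ‖y - x₀‖ ρ with h | h
      · rw [hû1 y h]; exact max_le (huψ y) (hb y h).2.le
      · rw [hû2 y h]; exact huψ y
  have h3 : ∀ᶠ x in 𝓝 x₀, ‖x - x₀‖ < ρ ∧ v x₀ + δ / 2 < P δ x := by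
    have hc1 : Continuous fun x : En n => ‖x - x₀‖ := by fun_prop
    have hc2 : Continuous (P δ) := by fun_prop
    refine (hc1.continuousAt.eventually (gt_mem_nhds (by simpa using hρpos))).and
      (hc2.continuousAt.eventually (lt_mem_nhds ?_))
    rw [hPx₀]
    linarith
  obtain ⟨x, hx1, hx2, hx3⟩ := ((frequently_uscEnv_sub_lt (u := fun z => -u z) x₀
    (half_pos hδpos)).and_eventually h3).exists
  have h4 := hgreat û hmem x
  rw [hû1 x hx2] at h4
  have h5 := (le_max_right _ _).trans h4
  simp only [hv] at hx3
  linarith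

end Perron

section Eigen

variable {n : ℕ} {lam Lam : ℝ}

theorem JSup.add_gauss (hlam : 0 < lam) (hle : lam ≤ Lam) {b : ℝ} (hb : b = 1 / (8 * Lam))
    {F : Mat n → ℝ} (hF : UniformlyElliptic n lam Lam F) {α : ℝ} {f v : En n → ℝ}
    (h : JSup F α f v) {C : ℝ} (hC : 0 ≤ C) :
    JSup F α (fun y => f y + C * ((2 * b * (lam * n) + b / 2 * ‖y‖ ^ 2 - α) *
      Real.exp (-b * ‖y‖ ^ 2))) (fun y => v y + C * Real.exp (-b * ‖y‖ ^ 2)) := by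
  have hLam : 0 < Lam := hlam.trans_le hle
  have hbpos : 0 < b := by rw [hb]; positivity
  have hbL : 8 * (b * Lam) = 1 := by rw [hb]; field_simp
  have h1 := h.add_classical hlam hle hF (g := fun z => C * Real.exp (-b * ‖z - 0‖ ^ 2))
    (g' := fun z => C • gaussD b 0 z) (H := fun z => C • gaussH b 0 z)
    (fun z => (hasFDerivAt_gauss b 0 z).const_mul C)
    (fun z => (hasFDerivAt_gaussD b 0 z).const_smul C)
    (fun z x y => by simp [gaussH_symm b 0 z x y])
    (fun z => (pucciLB_gauss hlam hbpos.le 0 z).smul hC)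
  simp only [sub_zero] at h1
  refine h1.congr fun y => ?_
  simp only [_root_.smul_apply, gaussD_apply, sub_zero, real_inner_self_eq_norm_sq, smul_eq_mul]
  have h2 : 4 * b ^ 2 * (Lam * ‖y‖ ^ 2) = b / 2 * ‖y‖ ^ 2 := by
    linear_combination (b / 2 * ‖y‖ ^ 2) * hbL
  rw [h2]
  refine le_of_eq ?_
  ring

theorem memX.exists_bound {b : ℝ} {u : En n → ℝ} (h : memX n b u) :
    ∃ C : ℝ, ∀ y, |u y| ≤ C * (1 + ‖y‖ ^ 2) * Real.exp (-b * ‖y‖ ^ 2) := by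
  obtain ⟨C, hC⟩ := h.2
  refine ⟨C, fun y => ?_⟩
  have h1 : |u y| * Real.exp (b * ‖y‖ ^ 2) / (1 + ‖y‖ ^ 2) ≤ C := hC ⟨y, rfl⟩
  rw [div_le_iff₀ (by positivity)] at h1
  have h2 := mul_le_mul_of_nonneg_right h1 (Real.exp_pos (-b * ‖y‖ ^ 2)).le
  rwa [mul_assoc, ← Real.exp_add, neg_mul, add_neg_cancel, Real.exp_zero, mul_one,
    ← neg_mul] at h2

theorem memX_of_bound {b C : ℝ} {u : En n → ℝ} (hc : Continuous u)
    (h : ∀ y, |u y| ≤ C * Real.exp (-b * ‖y‖ ^ 2)) : memX n b u := by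
  refine ⟨hc, C, ?_⟩
  rintro _ ⟨y, rfl⟩
  have hC : 0 ≤ C := by
    have := (abs_nonneg _).trans (h y)
    exact nonneg_of_mul_nonneg_left this (Real.exp_pos _)
  have h1 := mul_le_mul_of_nonneg_right (h y) (Real.exp_pos (b * ‖y‖ ^ 2)).le
  rw [mul_assoc, ← Real.exp_add, neg_mul, neg_add_cancel, Real.exp_zero, mul_one] at h1
  rw [div_le_iff₀ (by positivity)]
  nlinarith [sq_nonneg ‖y‖]

theorem JSup.zero_or_pos (hlam : 0 < lam) (hle : lam ≤ Lam) {F : Mat n → ℝ}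
    (hF : UniformlyElliptic n lam Lam F) (hFh : PositivelyHomogeneous n F) {α : ℝ} (hα : 0 ≤ α)
    {f v : En n → ℝ} (hv : JSup F α f v) (hf : ∀ y, 0 ≤ f y) (hlsc : LowerSemicontinuous v)
    (hv0 : ∀ y, 0 ≤ v y) : (∀ y, v y = 0) ∨ ∀ y, 0 < v y := by
  have h1 : PSub lam Lam α (fun _ => 0) fun y => -v y :=
    (JSub.pSub hle hF.refl hFh.refl hv).mono fun y => neg_nonpos.2 (hf y)
  rcases h1.strong_max hlam hle hα hlsc.neg_usc (fun y => neg_nonpos.2 (hv0 y)) with h2 | h2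
  · exact Or.inl fun y => neg_eq_zero.1 (h2 y)
  · exact Or.inr fun y => neg_lt_zero.1 (h2 y)

theorem JSup.source_nonpos_of_zero {F : Mat n → ℝ} (hFh : PositivelyHomogeneous n F) {α : ℝ}
    {f : En n → ℝ} (hv : JSup F α f fun _ => 0) (y : En n) : f y ≤ 0 := by
  have h1 := jSup_iff.1 hv y 0 0 (fun _ _ => rfl) (by simp)
  have h2 : bmat (0 : En n →L[ℝ] En n →L[ℝ] ℝ) = 0 := by ext; simp [bmat]
  rw [h2, hFh.zero] at h1
  simpa using h1

theorem JSup.pos (hlam : 0 < lam) (hle : lam ≤ Lam) {F : Mat n → ℝ}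
    (hF : UniformlyElliptic n lam Lam F) (hFh : PositivelyHomogeneous n F) {α : ℝ} (hα : 0 ≤ α)
    {f v : En n → ℝ} (hv : JSup F α f v) (hf : ∀ y, 0 < f y) (hlsc : LowerSemicontinuous v)
    (hv0 : ∀ y, 0 ≤ v y) (y : En n) : 0 < v y := by
  rcases hv.zero_or_pos hlam hle hF hFh hα (fun y => (hf y).le) hlsc hv0 with h | h
  · rw [show v = fun _ => 0 from funext h] at hv
    exact absurd (hv.source_nonpos_of_zero hFh y) (not_le.2 (hf y))
  · exact h y

/-- An a priori upper bound for the exponents admitting a positive supersolution. -/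
theorem exists_exponent_bound (hlam : 0 < lam) (hle : lam ≤ Lam) :
    ∃ K : ℝ, 0 ≤ K ∧ ∀ F : Mat n → ℝ, UniformlyElliptic n lam Lam F → PositivelyHomogeneous n F →
      ∀ (α : ℝ) (φ : En n → ℝ), JSup F α (fun _ => 0) φ → Continuous φ → (∀ y, 0 < φ y) →
      α ≤ K := by
  have hLam : 0 < Lam := hlam.trans_le hle
  set B := (2 * (Lam * n) + 1) / (2 * lam) with hB
  have hBpos : 0 < B := by positivity
  have hBl : 2 * B * lam = 2 * (Lam * n) + 1 := by rw [hB]; field_simp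
  set q := 1 - Real.exp (-(B / 2)) with hq
  have hqpos : 0 < q := by
    rw [hq, sub_pos, Real.exp_lt_one_iff]
    linarith
  refine ⟨B * (2 * (Lam * n) + 1) / q, by positivity, fun F hF hFh α φ hφ hφc hpos => ?_⟩
  rw [le_div_iff₀ hqpos]
  by_contra hcon
  have hcon := not_le.1 hcon
  have hα : 0 < α := by
    have : 0 < α * q := lt_of_le_of_lt (by positivity) hcon
    exact pos_of_mul_pos_left this hqpos.le
  set g : En n → ℝ := fun y => Real.exp (-B * ‖y - 0‖ ^ 2) - Real.exp (-B) with hg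
  have hgc : Continuous g := by fun_prop
  have hquot : Continuous fun y => g y / φ y := hgc.div hφc fun y => (hpos y).ne'
  obtain ⟨ŷ, hŷ, hmax⟩ := (isCompact_closedBall (0 : En n) 1).exists_isMaxOn
    ⟨0, by simp⟩ hquot.continuousOn
  set M := g ŷ / φ ŷ with hM
  have hMpos : 0 < M := by
    have h1 : g 0 / φ 0 ≤ M := hmax (by simp)
    refine lt_of_lt_of_le (div_pos ?_ (hpos 0)) h1
    simp only [hg]
    simpa using hBpos
  have hgM : ∀ y, ‖y‖ ≤ 1 → g y / M ≤ φ y := by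
    intro y hy
    have h1 : g y / φ y ≤ M := hmax (by simpa using hy)
    rw [div_le_iff₀ (hpos y)] at h1
    rw [div_le_iff₀ hMpos]
    linarith
  have hgŷ : g ŷ / M = φ ŷ := by
    have h1 : g ŷ = M * φ ŷ := by rw [hM, div_mul_cancel₀ _ (hpos ŷ).ne']
    rw [h1]
    field_simp
  have hgpos : 0 < g ŷ := by
    have h1 : g ŷ = M * φ ŷ := by rw [hM, div_mul_cancel₀ _ (hpos ŷ).ne']
    rw [h1]
    exact mul_pos hMpos (hpos ŷ)
  have hlt : ‖ŷ‖ ^ 2 < 1 := by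
    simp only [hg, sub_zero, sub_pos, Real.exp_lt_exp] at hgpos
    by_contra h
    have := mul_le_mul_of_nonneg_left (not_lt.1 h) hBpos.le
    linarith
  have hlt' : ‖ŷ‖ < 1 := by
    by_contra h
    have := pow_le_pow_left₀ zero_le_one (not_lt.1 h) 2
    linarith
  have hps : PSub lam Lam α (fun _ => 0) fun y => -φ y := by
    have := JSub.pSub hle hF.refl hFh.refl hφ
    simpa using this
  have h1 := hps.touch hlam (φ := fun y => (-M⁻¹) * g y) (φ' := fun z => (-M⁻¹) • gaussD B 0 z)
    (H := (-M⁻¹) • gaussH B 0 ŷ) (fun x y => by simp [gaussH_symm B 0 ŷ x y]) (y := ŷ)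
    (Eventually.of_forall fun z => ((hasFDerivAt_gauss B 0 z).sub_const _).const_mul (-M⁻¹))
    ((hasFDerivAt_gaussD B 0 ŷ).const_smul (-M⁻¹))
    (by
      have hc : Continuous fun y : En n => ‖y‖ := continuous_norm
      filter_upwards [hc.continuousAt.eventually (gt_mem_nhds hlt')] with y hy
      have h2 := hgM y hy.le
      rw [div_eq_inv_mul] at h2 hgŷ
      linarith)
    (((pucciLB_neg_gauss (Lam := Lam) hlam hBpos.le 0 ŷ).smul (inv_pos.2 hMpos).le).congr
      (fun x => by simp) hlam.le)
  simp only [_root_.smul_apply, gaussD_apply, sub_zero, real_inner_self_eq_norm_sq,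
    smul_eq_mul] at h1
  set e := Real.exp (-B * ‖ŷ‖ ^ 2) with he
  have hepos : 0 < e := Real.exp_pos _
  rw [← hgŷ] at h1
  have hgdef : g ŷ = e - Real.exp (-B) := by simp [hg, he]
  have h2 : M⁻¹ * (e * (4 * B ^ 2 * (lam * ‖ŷ‖ ^ 2) - 2 * B * (Lam * n) - B * ‖ŷ‖ ^ 2) +
      α * g ŷ) ≤ 0 := by
    rw [div_eq_inv_mul (g ŷ) M] at h1
    linarith
  have h3 : e * (4 * B ^ 2 * (lam * ‖ŷ‖ ^ 2) - 2 * B * (Lam * n) - B * ‖ŷ‖ ^ 2) + α * g ŷ ≤ 0 := by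
    by_contra h
    exact absurd h2 (not_le.2 (mul_pos (inv_pos.2 hMpos) (not_le.1 h)))
  have h4 : 4 * B ^ 2 * (lam * ‖ŷ‖ ^ 2) = 2 * B * (2 * (Lam * n) + 1) * ‖ŷ‖ ^ 2 := by
    rw [← hBl]; ring
  rw [h4] at h3
  have hαg := mul_pos hα hgpos
  rcases le_or_gt (1 / 2) (‖ŷ‖ ^ 2) with h5 | h5
  · have h6 := mul_le_mul_of_nonneg_left h5 (by positivity : 0 ≤ 2 * B * (2 * (Lam * n) + 1))
    have h7 := mul_lt_mul_of_pos_left hlt hBpos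
    have h8 : 0 ≤ 2 * B * (2 * (Lam * n) + 1) * ‖ŷ‖ ^ 2 - 2 * B * (Lam * n) - B * ‖ŷ‖ ^ 2 := by
      linarith
    linarith [mul_nonneg hepos.le h8]
  · have h6 : e * q ≤ g ŷ := by
      rw [hgdef, hq, mul_sub, mul_one, he, ← Real.exp_add]
      refine sub_le_sub_left (Real.exp_le_exp.2 ?_) _
      have := mul_lt_mul_of_pos_left h5 hBpos
      linarith
    have h7 := mul_le_mul_of_nonneg_left h6 hα.le
    have h8 := mul_lt_mul_of_pos_left hcon hepos
    have h9 := mul_lt_mul_of_pos_left hlt hBpos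
    have h10 : 0 ≤ e * (2 * B * (2 * (Lam * n) + 1) * ‖ŷ‖ ^ 2) := by positivity
    have h11 := mul_lt_mul_of_pos_left h9 hepos
    linarith

end Eigen

section Exponent

variable {n : ℕ} {lam Lam : ℝ}

/-- The exponents admitting a nontrivial nonnegative supersolution. -/
def exponentSet (n : ℕ) (lam Lam : ℝ) (F : Mat n → ℝ) : Set ℝ :=
  { α : ℝ | ∃ φ : En n → ℝ, memX n (1/(8*Lam)) φ ∧ (∀ y, 0 ≤ φ y) ∧ φ ≠ 0 ∧
    ViscSupE n Set.univ (Fop n F α (fun _ => 0)) φ }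

theorem gauss_mem_exponentSet (hlam : 0 < lam) (hle : lam ≤ Lam) {F : Mat n → ℝ}
    (hF : UniformlyElliptic n lam Lam F) (hFh : PositivelyHomogeneous n F) :
    2 * (1 / (8 * Lam)) * (lam * n) ∈ exponentSet n lam Lam F := by
  have hLam : 0 < Lam := hlam.trans_le hle
  set b := 1 / (8 * Lam) with hb
  refine ⟨fun y => Real.exp (-b * ‖y‖ ^ 2), memX_of_bound (C := 1) (by fun_prop) (fun y => ?_),
    fun y => (Real.exp_pos _).le, fun h => ?_, ?_⟩
  · rw [one_mul, abs_of_pos (Real.exp_pos _)]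
  · have := congrFun h 0
    simp at this
  · rw [viscSupE_iff_jSup hlam hle hF]
    have h1 := (jSup_zero (α := 2 * b * (lam * n)) hlam hle hF hFh).add_gauss hlam hle hb hF
      zero_le_one
    simp only [zero_add, one_mul] at h1
    refine h1.congr fun y => ?_
    have : 0 ≤ (2 * b * (lam * n) + b / 2 * ‖y‖ ^ 2 - 2 * b * (lam * n)) *
        Real.exp (-b * ‖y‖ ^ 2) := by
      rw [add_sub_cancel_left]
      positivity
    linarith

theorem exponentSet_pos (hlam : 0 < lam) (hle : lam ≤ Lam) {F : Mat n → ℝ}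
    (hF : UniformlyElliptic n lam Lam F) (hFh : PositivelyHomogeneous n F) {α : ℝ} (hα : 0 ≤ α)
    (h : α ∈ exponentSet n lam Lam F) : ∃ φ : En n → ℝ, memX n (1 / (8 * Lam)) φ ∧
      (∀ y, 0 < φ y) ∧ JSup F α (fun _ => 0) φ := by
  obtain ⟨φ, hX, h0, hne, hs⟩ := h
  rw [viscSupE_iff_jSup hlam hle hF] at hs
  rcases hs.zero_or_pos hlam hle hF hFh hα (fun _ => le_rfl) hX.1.lowerSemicontinuous h0 with h | h
  · exact absurd (funext h) hne
  · exact ⟨φ, hX, h, hs⟩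

theorem exponentSet_bddAbove (hlam : 0 < lam) (hle : lam ≤ Lam) {F : Mat n → ℝ}
    (hF : UniformlyElliptic n lam Lam F) (hFh : PositivelyHomogeneous n F) :
    BddAbove (exponentSet n lam Lam F) := by
  obtain ⟨K, hK0, hK⟩ := exists_exponent_bound (n := n) hlam hle
  refine ⟨K, fun α hα => ?_⟩
  rcases le_or_gt 0 α with h | h
  · obtain ⟨φ, hX, hpos, hs⟩ := exponentSet_pos hlam hle hF hFh h hα
    exact hK F hF hFh α φ hs hX.1 hpos
  · linarith

/-- Solvability of `F(D²u) - (1/2) y·Du = α u + exp (-b |y|²)` below the critical exponent. -/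
theorem exists_resolvent (hlam : 0 < lam) (hle : lam ≤ Lam) {b : ℝ} (hb : b = 1 / (8 * Lam))
    {F : Mat n → ℝ} (hF : UniformlyElliptic n lam Lam F) (hFh : PositivelyHomogeneous n F)
    {α α' : ℝ} (hα : 0 ≤ α) (hαα' : α < α') (h : α' ∈ exponentSet n lam Lam F) :
    ∃ u : En n → ℝ, Continuous u ∧ (∀ y, 0 < u y) ∧
      JSub F α (fun y => Real.exp (-b * ‖y‖ ^ 2)) u ∧
      JSup F α (fun y => Real.exp (-b * ‖y‖ ^ 2)) u ∧
      ∃ C : ℝ, ∀ y, u y ≤ C * (1 + ‖y‖ ^ 2) * Real.exp (-b * ‖y‖ ^ 2) := by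
  have hLam : 0 < Lam := hlam.trans_le hle
  have hbpos : 0 < b := by rw [hb]; positivity
  set G : En n → ℝ := fun y => Real.exp (-b * ‖y‖ ^ 2) with hG
  have hGc : Continuous G := by fun_prop
  have hGpos : ∀ y, 0 < G y := fun y => Real.exp_pos _
  have hG1 : ∀ y, G y ≤ 1 := fun y => by
    simp only [hG, Real.exp_le_one_iff, neg_mul, neg_nonpos]
    positivity
  obtain ⟨φ, hX, hφ, hs⟩ := exponentSet_pos hlam hle hF hFh (hα.trans hαα'.le) h
  rw [← hb] at hX
  obtain ⟨R, hR, hRα⟩ := exists_radius hbpos (by positivity : 0 ≤ α + 1)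
  obtain ⟨δ, hδ, hδφ⟩ := exists_ge_of_lsc_on_ball hX.1.lowerSemicontinuous hφ R
  have hd : 0 < α' - α := sub_pos.2 hαα'
  set c := (1 + α) / ((α' - α) * δ) with hc
  have hcpos : 0 < c := by positivity
  have hcδ : c * ((α' - α) * δ) = 1 + α := div_mul_cancel₀ _ (by positivity)
  set ψ : En n → ℝ := fun y => c * φ y + G y with hψ
  have hψc : Continuous ψ := (hX.1.const_mul c).add hGc
  have hψ0 : ∀ y, 0 ≤ ψ y := fun y => (add_pos (mul_pos hcpos (hφ y)) (hGpos y)).le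
  have hψs : JSup F α G ψ := by
    have h1 : JSup F α (fun y => c * ((α' - α) * φ y)) fun y => c * φ y :=
      (hs.smul hFh hcpos).congr fun y => le_of_eq (by ring)
    have h2 := h1.add_gauss hlam hle hb hF zero_le_one
    simp only [one_mul] at h2
    refine h2.congr fun y => ?_
    suffices hsuff : 0 ≤ c * ((α' - α) * φ y) +
        (2 * b * (lam * n) + b / 2 * ‖y‖ ^ 2 - α - 1) * G y by
      simp only [hG] at hsuff ⊢
      linarith
    have h3 : 0 ≤ 2 * b * (lam * n) := by positivity
    rcases le_or_gt ‖y‖ R with hy | hy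
    · have h4 := mul_le_mul_of_nonneg_left (hδφ y hy) (by positivity : 0 ≤ c * (α' - α))
      have h5 : (1 + α) * G y ≤ (1 + α) * 1 := mul_le_mul_of_nonneg_left (hG1 y) (by positivity)
      have h6 : 0 ≤ (2 * b * (lam * n) + b / 2 * ‖y‖ ^ 2) * G y :=
        mul_nonneg (by positivity) (hGpos y).le
      linarith
    · have h4 : R ^ 2 ≤ ‖y‖ ^ 2 := pow_le_pow_left₀ hR.le hy.le 2
      have h5 := mul_le_mul_of_nonneg_left h4 (by positivity : 0 ≤ 3 * b / 8)
      have h6 : 0 ≤ b * ‖y‖ ^ 2 := by positivity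
      have h7 : 0 ≤ c * ((α' - α) * φ y) := by have := hφ y; positivity
      have h8 : 0 ≤ (2 * b * (lam * n) + b / 2 * ‖y‖ ^ 2 - α - 1) * G y :=
        mul_nonneg (by linarith) (hGpos y).le
      linarith
  obtain ⟨u, v, husc, hlsc, hu, hv, hv0, hvu, huψ⟩ :=
    exists_perron_pair hlam hle hF hFh hGc (fun y => (hGpos y).le) hψc hψ0 hψs
  have hvpos : ∀ y, 0 < v y := hv.pos hlam hle hF hFh hα hGpos hlsc hv0
  obtain ⟨C, hC⟩ := hX.exists_bound
  have hgrow : ∀ y, u y ≤ (c * C + 1) * (1 + ‖y‖ ^ 2) * Real.exp (-b * ‖y‖ ^ 2) := by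
    intro y
    have h1 := mul_le_mul_of_nonneg_left ((le_abs_self _).trans (hC y)) hcpos.le
    have h2 := huψ y
    have h3 : 0 ≤ ‖y‖ ^ 2 * G y := mul_nonneg (by positivity) (hGpos y).le
    simp only [hψ, hG] at h2 h3
    linarith
  have huv : ∀ y, u y = v y := by
    rcases hu.sliding hlam hle hb hF hFh hα hv hGc hGc husc hlsc hvpos hgrow zero_le_one
      (fun t ht y => by nlinarith [hGpos y]) with h1 | ⟨t, ht, h1⟩
    · exact fun y => le_antisymm (by simpa using h1 y) (hvu y)
    · exfalso
      have ht0 : 0 < t := one_pos.trans ht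
      have h2 : JSup F α (fun y => t * G y) u := by
        have := hv.smul hFh ht0
        rwa [show (fun y => t * v y) = u from funext fun y => (h1 y).symm] at this
      have hulsc : LowerSemicontinuous u := by
        rw [show u = fun y => t * v y from funext h1]
        intro y s hs
        have : s / t < v y := by rwa [div_lt_iff₀' ht0]
        filter_upwards [hlsc y _ this] with z hz
        exact (div_lt_iff₀' ht0).1 hz
      have h3 := hu.sub_pSub hlam hle hF h2 hGc (hGc.const_mul t) husc hulsc
      simp only [sub_self] at h3
      have h4 := h3 0 0 0 (fun _ _ => rfl) (by simp) 0 (by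
        simpa using pucciLB_of_le (Lam := Lam) hlam (H := (0 : En n →L[ℝ] En n →L[ℝ] ℝ)) le_rfl
          (fun x => by simp))
      simp only [_root_.zero_apply, mul_zero, sub_zero] at h4
      nlinarith [hGpos 0]
  have huv' : u = v := funext huv
  have hcont : Continuous u := continuous_iff_lower_upperSemicontinuous.2
    ⟨huv' ▸ hlsc, husc⟩
  exact ⟨u, hcont, huv' ▸ hvpos, hu, huv' ▸ hv, _, hgrow⟩

/-- Rescaled resolvents are uniformly bounded by a multiple of the Gaussian. -/
theorem gauss_bound (hlam : 0 < lam) (hle : lam ≤ Lam) {b : ℝ} (hb : b = 1 / (8 * Lam)) {A : ℝ}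
    (hA : 0 ≤ A) : ∃ C : ℝ, 0 < C ∧ ∀ (F : Mat n → ℝ), UniformlyElliptic n lam Lam F →
      PositivelyHomogeneous n F → ∀ (α s : ℝ) (u : En n → ℝ), α ≤ A → s ≤ 1 →
      JSub F α (fun y => s * Real.exp (-b * ‖y‖ ^ 2)) u → Continuous u → (∀ y, u y ≤ 1) →
      (∃ C' : ℝ, ∀ y, u y ≤ C' * (1 + ‖y‖ ^ 2) * Real.exp (-b * ‖y‖ ^ 2)) →
      ∀ y, u y ≤ C * Real.exp (-b * ‖y‖ ^ 2) := by
  have hLam : 0 < Lam := hlam.trans_le hle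
  have hbpos : 0 < b := by rw [hb]; positivity
  obtain ⟨R, hR, hRA⟩ := exists_radius hbpos (by positivity : 0 ≤ A + 1)
  set C := Real.exp (b * R ^ 2) with hC
  have hC1 : 1 ≤ C := Real.one_le_exp (by positivity)
  have hCpos : 0 < C := Real.exp_pos _
  refine ⟨C, hCpos, fun F hF hFh α s u hα hs hu huc hu1 ⟨C', hgrow⟩ y => ?_⟩
  set G : En n → ℝ := fun y => Real.exp (-b * ‖y‖ ^ 2) with hG
  have hGc : Continuous G := by fun_prop
  have hGpos : ∀ y, 0 < G y := fun y => Real.exp_pos _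
  have h0 := (jSup_zero (α := α) hlam hle hF hFh).add_gauss hlam hle hb hF hCpos.le
  simp only [zero_add] at h0
  have h1 := hu.sub_pSub hlam hle hF h0 (by fun_prop) (by fun_prop) huc.upperSemicontinuous
    (by fun_prop : Continuous fun y : En n => C * Real.exp (-b * ‖y‖ ^ 2)).lowerSemicontinuous
  refine sub_nonpos.1 (h1.nonpos_of_nonpos_on_ball hlam hb hle
    (by fun_prop : Continuous fun y : En n => u y - C * Real.exp (-b * ‖y‖ ^ 2)).upperSemicontinuous
    hR.le (by linarith : α ≤ 3 * b / 8 * R ^ 2) (fun y hy => ?_) (C := C') (fun y => ?_)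
    (fun y hy => ?_) y)
  · have h2 : R ^ 2 ≤ ‖y‖ ^ 2 := pow_le_pow_left₀ hR.le hy.le 2
    have h3 := mul_le_mul_of_nonneg_left h2 (by positivity : 0 ≤ 3 * b / 8)
    have h4 : 0 ≤ b * ‖y‖ ^ 2 := by positivity
    have h5 : 0 ≤ 2 * b * (lam * n) := by positivity
    have h6 : 1 ≤ 2 * b * (lam * n) + b / 2 * ‖y‖ ^ 2 - α := by linarith
    have h7 : 1 ≤ C * (2 * b * (lam * n) + b / 2 * ‖y‖ ^ 2 - α) := by nlinarith
    have h8 := mul_nonneg (by linarith : 0 ≤ C * (2 * b * (lam * n) + b / 2 * ‖y‖ ^ 2 - α) - s)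
      (hGpos y).le
    simp only [hG] at h8
    linarith
  · have := mul_pos hCpos (hGpos y)
    simp only [hG] at this
    linarith [hgrow y]
  · have h2 : 1 ≤ C * Real.exp (-b * ‖y‖ ^ 2) := by
      rw [hC, ← Real.exp_add]
      refine Real.one_le_exp ?_
      have : ‖y‖ ^ 2 ≤ R ^ 2 := pow_le_pow_left₀ (norm_nonneg _) hy 2
      have := mul_le_mul_of_nonneg_left this hbpos.le
      linarith
    linarith [hu1 y]

end Exponent

section Existence

variable {n : ℕ} {lam Lam : ℝ}

/-- Solutions below the critical exponent, normalised so that either the source is the full Gaussian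
or the maximum is one. -/
theorem exists_normalized_resolvent (hlam : 0 < lam) (hle : lam ≤ Lam) {b : ℝ}
    (hb : b = 1 / (8 * Lam)) {F : Mat n → ℝ} (hF : UniformlyElliptic n lam Lam F)
    (hFh : PositivelyHomogeneous n F) {α : ℝ} (hα : 0 ≤ α) (hlt : α < alphaPlus n lam Lam F) :
    ∃ (s : ℝ) (u : En n → ℝ), 0 < s ∧ s ≤ 1 ∧ Continuous u ∧ (∀ y, 0 < u y) ∧ (∀ y, u y ≤ 1) ∧
      JSub F α (fun y => s * Real.exp (-b * ‖y‖ ^ 2)) u ∧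
      JSup F α (fun y => s * Real.exp (-b * ‖y‖ ^ 2)) u ∧ (s = 1 ∨ ∃ y, u y = 1) ∧
      ∃ C : ℝ, ∀ y, u y ≤ C * (1 + ‖y‖ ^ 2) * Real.exp (-b * ‖y‖ ^ 2) := by
  have hLam : 0 < Lam := hlam.trans_le hle
  have hbpos : 0 < b := by rw [hb]; positivity
  obtain ⟨α', hα', hαα'⟩ := exists_lt_of_lt_csSup (s := exponentSet n lam Lam F)
    ⟨_, gauss_mem_exponentSet hlam hle hF hFh⟩ hlt
  obtain ⟨u, huc, hupos, hsub, hsup, C, hC⟩ :=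
    exists_resolvent hlam hle hb hF hFh hα hαα' hα'
  obtain ⟨x, hx⟩ := exists_forall_le_of_usc huc.upperSemicontinuous (hupos 0) fun η hη => by
    obtain ⟨R, -, hR⟩ := exists_gaussian_tail_lt (E := En n) hbpos C hη
    exact ⟨R, fun y hy => (hC y).trans_lt (hR y hy)⟩
  rcases le_or_gt (u x) 1 with h | h
  · refine ⟨1, u, one_pos, le_rfl, huc, hupos, fun y => (hx y).trans h, ?_, ?_, Or.inl rfl, C, hC⟩
    · simpa using hsub
    · simpa using hsup
  · have hpos : 0 < (u x)⁻¹ := inv_pos.2 (hupos x)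
    refine ⟨(u x)⁻¹, fun y => (u x)⁻¹ * u y, hpos, inv_le_one_of_one_le₀ h.le, by fun_prop,
      fun y => mul_pos hpos (hupos y), fun y => ?_, hsub.smul hFh hpos, hsup.smul hFh hpos,
      Or.inr ⟨x, inv_mul_cancel₀ (hupos x).ne'⟩, (u x)⁻¹ * C, fun y => ?_⟩
    · rw [inv_mul_le_one₀ (hupos x)]
      exact hx y
    · calc (u x)⁻¹ * u y ≤ (u x)⁻¹ * (C * (1 + ‖y‖ ^ 2) * Real.exp (-b * ‖y‖ ^ 2)) :=
            mul_le_mul_of_nonneg_left (hC y) hpos.le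
        _ = _ := by ring

theorem lipschitz_eventually_uniform {E ι : Type*} [NormedAddCommGroup E] [ProperSpace E]
    {l : Filter ι} [l.NeBot] {u : ι → E → ℝ} {φ : E → ℝ} {K : ℝ} (hK : 0 ≤ K)
    (hL : ∀ i x y, |u i x - u i y| ≤ K * ‖x - y‖) (hφ : ∀ y, Tendsto (fun i => u i y) l (𝓝 (φ y)))
    (R : ℝ) {ε : ℝ} (hε : 0 < ε) : ∀ᶠ i in l, ∀ y, ‖y‖ ≤ R → |u i y - φ y| ≤ ε := by
  have hLφ : ∀ x y, |φ x - φ y| ≤ K * ‖x - y‖ := fun x y =>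
    le_of_tendsto ((hφ x).sub (hφ y)).abs (Eventually.of_forall fun i => hL i x y)
  have key : ∀ᶠ i in l, ∀ y ∈ Metric.closedBall (0 : E) R, |u i y - φ y| ≤ ε := by
    refine (isCompact_closedBall (0 : E) R).induction_on
      (p := fun s => ∀ᶠ i in l, ∀ y ∈ s, |u i y - φ y| ≤ ε) ?_ ?_ ?_ ?_
    · simp
    · intro s t hst ht
      filter_upwards [ht] with i hi y hy using hi y (hst hy)
    · intro s t hs ht
      filter_upwards [hs, ht] with i h1 h2 y hy
      exact hy.elim (h1 y) (h2 y)
    · intro x _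
      refine ⟨_, mem_nhdsWithin_of_mem_nhds (Metric.ball_mem_nhds x
        (show 0 < ε / (3 * (K + 1)) by positivity)), ?_⟩
      filter_upwards [(Metric.tendsto_nhds.1 (hφ x)) (ε / 3) (by positivity)] with i hi y hy
      rw [Real.dist_eq] at hi
      rw [Metric.mem_ball, dist_eq_norm, lt_div_iff₀ (by positivity)] at hy
      have h1 := hL i y x
      have h2 := hLφ y x
      have h3 : K * ‖y - x‖ ≤ ε / 3 := by nlinarith [norm_nonneg (y - x)]
      rw [abs_le] at h1 h2 ⊢
      rw [abs_lt] at hi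
      constructor <;> linarith [h1.1, h1.2, h2.1, h2.2, hi.1, hi.2]
  filter_upwards [key] with i hi y hy using hi y (mem_closedBall_zero_iff.2 hy)

/-- Stability of subsolutions under locally uniform convergence. -/
theorem JSub.of_tendsto (hlam : 0 < lam) (hle : lam ≤ Lam) {F : Mat n → ℝ}
    (hF : UniformlyElliptic n lam Lam F) {ι : Type*} {l : Filter ι} [l.NeBot]
    {αs : ι → ℝ} {α : ℝ} {f u : ι → En n → ℝ} {f₀ φ : En n → ℝ} (hf : Continuous f₀)
    (huc : ∀ i, Continuous (u i)) (hu : ∀ i, JSub F (αs i) (f i) (u i))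
    (hα : Tendsto αs l (𝓝 α))
    (hff : ∀ R ε : ℝ, 0 < ε → ∀ᶠ i in l, ∀ y, ‖y‖ ≤ R → |f i y - f₀ y| ≤ ε)
    (huφ : ∀ R ε : ℝ, 0 < ε → ∀ᶠ i in l, ∀ y, ‖y‖ ≤ R → |u i y - φ y| ≤ ε) :
    JSub F α f₀ φ := by
  refine JSub.of_approx hlam hle hF hf fun x₀ ε hε => ?_
  obtain ⟨i, h1, h2, h3⟩ := ((hff (‖x₀‖ + 1) ε hε).and ((huφ (‖x₀‖ + 1) ε hε).and
    ((Metric.tendsto_nhds.1 hα) ε hε))).exists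
  have hball : ∀ y, ‖y - x₀‖ ≤ 1 → ‖y‖ ≤ ‖x₀‖ + 1 := fun y hy => by
    have := norm_sub_norm_le y x₀
    linarith
  rw [Real.dist_eq] at h3
  refine ⟨αs i, f i, u i, (huc i).upperSemicontinuous, hu i, h3.le, fun y hy => h1 y (hball y hy),
    fun y hy => ?_, x₀, by simpa using hε.le, ?_⟩
  · linarith [(abs_le.1 (h2 y (hball y hy))).2]
  · linarith [(abs_le.1 (h2 x₀ (hball x₀ (by simp)))).1]

theorem JSup.of_tendsto (hlam : 0 < lam) (hle : lam ≤ Lam) {F : Mat n → ℝ}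
    (hF : UniformlyElliptic n lam Lam F) {ι : Type*} {l : Filter ι} [l.NeBot]
    {αs : ι → ℝ} {α : ℝ} {f u : ι → En n → ℝ} {f₀ φ : En n → ℝ} (hf : Continuous f₀)
    (huc : ∀ i, Continuous (u i)) (hu : ∀ i, JSup F (αs i) (f i) (u i))
    (hα : Tendsto αs l (𝓝 α))
    (hff : ∀ R ε : ℝ, 0 < ε → ∀ᶠ i in l, ∀ y, ‖y‖ ≤ R → |f i y - f₀ y| ≤ ε)
    (huφ : ∀ R ε : ℝ, 0 < ε → ∀ᶠ i in l, ∀ y, ‖y‖ ≤ R → |u i y - φ y| ≤ ε) :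
    JSup F α f₀ φ := by
  refine JSub.of_tendsto hlam hle hF.refl (f := fun i y => -f i y) (u := fun i y => -u i y)
    hf.neg (fun i => (huc i).neg) hu hα (fun R ε hε => ?_) fun R ε hε => ?_
  · filter_upwards [hff R ε hε] with i hi y hy
    rw [neg_sub_neg, abs_sub_comm]
    exact hi y hy
  · filter_upwards [huφ R ε hε] with i hi y hy
    rw [neg_sub_neg, abs_sub_comm]
    exact hi y hy

theorem alphaPlus_pos (hlam : 0 < lam) (hle : lam ≤ Lam) (hn : 1 ≤ n) {F : Mat n → ℝ}
    (hF : UniformlyElliptic n lam Lam F) (hFh : PositivelyHomogeneous n F) :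
    0 < alphaPlus n lam Lam F := by
  have hLam : 0 < Lam := hlam.trans_le hle
  have hn' : (0 : ℝ) < n := by exact_mod_cast hn
  refine lt_of_lt_of_le ?_ (le_csSup (exponentSet_bddAbove hlam hle hF hFh)
    (gauss_mem_exponentSet hlam hle hF hFh))
  positivity

/-- Existence of a positive principal eigenfunction with Gaussian decay. -/
theorem exists_eigenfunction (hlam : 0 < lam) (hle : lam ≤ Lam) (hn : 1 ≤ n) {b : ℝ}
    (hb : b = 1 / (8 * Lam)) {F : Mat n → ℝ} (hF : UniformlyElliptic n lam Lam F)
    (hFh : PositivelyHomogeneous n F) :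
    ∃ φ : En n → ℝ, Continuous φ ∧ (∀ y, 0 < φ y) ∧
      JSub F (alphaPlus n lam Lam F) (fun _ => 0) φ ∧
      JSup F (alphaPlus n lam Lam F) (fun _ => 0) φ ∧
      ∃ C : ℝ, 0 < C ∧ ∀ y, φ y ≤ C * Real.exp (-b * ‖y‖ ^ 2) := by
  have hLam : 0 < Lam := hlam.trans_le hle
  have hbpos : 0 < b := by rw [hb]; positivity
  set A := alphaPlus n lam Lam F with hA
  have hApos : 0 < A := alphaPlus_pos hlam hle hn hF hFh
  obtain ⟨C, hC, hgauss⟩ := gauss_bound (n := n) hlam hle hb hApos.le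
  set G : En n → ℝ := fun y => Real.exp (-b * ‖y‖ ^ 2) with hG
  have hGc : Continuous G := by fun_prop
  have hGpos : ∀ y, 0 < G y := fun y => Real.exp_pos _
  have hG1 : ∀ y, G y ≤ 1 := fun y => by
    simp only [hG, Real.exp_le_one_iff, neg_mul, neg_nonpos]
    positivity
  set αs : ℕ → ℝ := fun k => A * (1 - 1 / ((k : ℝ) + 1)) with hαs
  have hk : ∀ k : ℕ, 0 < 1 / ((k : ℝ) + 1) ∧ 1 / ((k : ℝ) + 1) ≤ 1 := fun k =>
    ⟨by positivity, by rw [div_le_one (by positivity)]; linarith [k.cast_nonneg (α := ℝ)]⟩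
  have hα0 : ∀ k, 0 ≤ αs k := fun k => mul_nonneg hApos.le (by linarith [(hk k).2])
  have hαA : ∀ k, αs k < A := fun k => by
    have := mul_pos hApos (hk k).1
    simp only [hαs]
    linarith
  have hαlim : Tendsto αs (hyperfilter ℕ : Filter ℕ) (𝓝 A) := by
    have h1 := (tendsto_one_div_add_atTop_nhds_zero_nat (𝕜 := ℝ)).const_sub 1
    have h2 := h1.const_mul A
    rw [sub_zero, mul_one] at h2
    exact h2.mono_left (Nat.hyperfilter_le_atTop)
  choose s u hs0 hs1 huc hupos hu1 hsub hsup hmax C' hgrow using fun k =>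
    exists_normalized_resolvent hlam hle hb hF hFh (hα0 k) (hαA k)
  have huG : ∀ k y, u k y ≤ C * G y := fun k =>
    hgauss F hF hFh (αs k) (s k) (u k) (hαA k).le (hs1 k) (hsub k) (huc k) (hu1 k) ⟨C' k, hgrow k⟩
  have htail : ∀ η : ℝ, 0 < η → ∃ R : ℝ, ∀ y : En n, R ≤ ‖y‖ → C * G y < η := fun η hη => by
    obtain ⟨R, -, hR⟩ := exists_gaussian_tail_lt (E := En n) hbpos C hη
    refine ⟨R, fun y hy => lt_of_le_of_lt ?_ (hR y hy)⟩
    refine mul_le_mul_of_nonneg_right ?_ (hGpos y).le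
    nlinarith [sq_nonneg ‖y‖]
  set K := (A + 2) / lam * Real.sqrt (2 * lam) with hKdef
  have hK : 0 ≤ K := by positivity
  have hLip' : ∀ k x y, u k x - u k y ≤ K * ‖x - y‖ := fun k x y => by
    refine lipschitz_of_solution hlam hle hF (hα0 k) (hαA k).le (hsub k) (hsup k) (by fun_prop)
      (huc k) (fun y => (hupos k y).le) (hu1 k) (fun x y => ?_) (fun η hη => ?_) x y
    · have h1 : s k * G x ≤ 1 := by nlinarith [hs0 k, hs1 k, hG1 x, hGpos x]
      have h2 : 0 < s k * G y := mul_pos (hs0 k) (hGpos y)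
      simp only [hG] at h1 h2
      linarith
    · obtain ⟨R, hR⟩ := htail η hη
      exact ⟨R, fun y hy => (huG k y).trans_lt (hR y hy)⟩
  have hLip : ∀ k x y, |u k x - u k y| ≤ K * ‖x - y‖ := fun k x y => by
    rw [abs_le]
    have h1 := hLip' k y x
    rw [norm_sub_rev] at h1
    exact ⟨by linarith, hLip' k x y⟩
  have hlim : ∀ w : ℕ → ℝ, (∀ k, w k ∈ Icc (0 : ℝ) 1) →
      ∃ a ∈ Icc (0 : ℝ) 1, Tendsto w (hyperfilter ℕ : Filter ℕ) (𝓝 a) := fun w hw => by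
    obtain ⟨a, ha, h⟩ := isCompact_Icc.ultrafilter_le_nhds ((hyperfilter ℕ).map w)
      (le_principal_iff.2 (Ultrafilter.mem_map.2 (univ_mem' hw)))
    exact ⟨a, ha, h⟩
  obtain ⟨s₀, hs₀, hslim⟩ := hlim s fun k => ⟨(hs0 k).le, hs1 k⟩
  choose φ hφ hφlim using fun y => hlim (fun k => u k y) fun k => ⟨(hupos k y).le, hu1 k y⟩
  have hunif := fun R ε (hε : (0 : ℝ) < ε) =>
    lipschitz_eventually_uniform (l := (hyperfilter ℕ : Filter ℕ)) hK hLip hφlim R hε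
  have hφLip : ∀ x y, |φ x - φ y| ≤ K * ‖x - y‖ := fun x y =>
    le_of_tendsto ((hφlim x).sub (hφlim y)).abs (Eventually.of_forall fun i => hLip i x y)
  have hφc : Continuous φ :=
    (LipschitzWith.of_dist_le_mul (K := ⟨K, hK⟩) fun x y => by
      rw [Real.dist_eq, dist_eq_norm]; exact hφLip x y).continuous
  have hφG : ∀ y, φ y ≤ C * G y := fun y =>
    le_of_tendsto (hφlim y) (Eventually.of_forall fun i => huG i y)
  have hsource : ∀ R ε : ℝ, 0 < ε → ∀ᶠ k in (hyperfilter ℕ : Filter ℕ), ∀ y : En n, ‖y‖ ≤ R →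
      |s k * G y - s₀ * G y| ≤ ε := fun R ε hε => by
    filter_upwards [(Metric.tendsto_nhds.1 hslim) ε hε] with k hk y _
    rw [Real.dist_eq] at hk
    rw [← sub_mul, abs_mul, abs_of_pos (hGpos y)]
    nlinarith [hGpos y, hG1 y, abs_nonneg (s k - s₀)]
  have hφsub : JSub F A (fun y => s₀ * G y) φ :=
    JSub.of_tendsto hlam hle hF (by fun_prop) huc hsub hαlim hsource hunif
  have hφsup : JSup F A (fun y => s₀ * G y) φ :=
    JSup.of_tendsto hlam hle hF (by fun_prop) huc hsup hαlim hsource hunif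
  have hφX : memX n b φ := memX_of_bound hφc fun y => by
    rw [abs_of_nonneg (hφ y).1]
    exact hφG y
  have hs₀0 : s₀ = 0 := by
    by_contra hne
    have hs₀pos : 0 < s₀ := lt_of_le_of_ne hs₀.1 (Ne.symm hne)
    have hφpos := hφsup.pos hlam hle hF hFh hApos.le (fun y => mul_pos hs₀pos (hGpos y))
      hφc.lowerSemicontinuous fun y => (hφ y).1
    have hmem : A + s₀ / C ∈ exponentSet n lam Lam F := by
      refine ⟨φ, hb ▸ hφX, fun y => (hφ y).1, fun h => ?_, ?_⟩
      · have := hφpos 0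
        rw [h] at this
        exact lt_irrefl _ this
      · rw [viscSupE_iff_jSup hlam hle hF]
        refine hφsup.congr fun y => ?_
        have h1 : s₀ / C * φ y ≤ s₀ * G y := by
          rw [div_mul_eq_mul_div, div_le_iff₀ hC]
          nlinarith [hφG y]
        linarith
    have h1 : A + s₀ / C ≤ A := le_csSup (exponentSet_bddAbove hlam hle hF hFh) hmem
    have h2 : 0 < s₀ / C := by positivity
    linarith
  subst hs₀0
  have hφpos : ∀ y, 0 < φ y := by
    refine (hφsup.zero_or_pos hlam hle hF hFh hApos.le (fun y => by simp)
      hφc.lowerSemicontinuous fun y => (hφ y).1).resolve_left fun h0 => ?_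
    obtain ⟨R, hR⟩ := htail 1 one_pos
    obtain ⟨k, h1, h2⟩ := ((hunif R (1 / 2) (by norm_num)).and
      ((Metric.tendsto_nhds.1 hslim) 1 one_pos)).exists
    rw [Real.dist_eq, sub_zero, abs_of_pos (hs0 k)] at h2
    obtain ⟨y, hy⟩ := (hmax k).resolve_left h2.ne
    have hyR : ‖y‖ ≤ R := by
      by_contra h
      have h3 := hR y (not_le.1 h).le
      have h4 := huG k y
      linarith
    have h5 := h1 y hyR
    rw [h0 y, hy] at h5
    norm_num at h5
  refine ⟨φ, hφc, hφpos, ?_, ?_, C, hC, hφG⟩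
  · simpa using hφsub
  · simpa using hφsup

end Existence

/-- **Proposition 3.7.** There exists a unique `φ⁺ ∈ X` with `φ⁺(0) = 1` solving the eigenvalue
problem `F(D²φ⁺) - (1/2)y·Dφ⁺ = α⁺ φ⁺` in `ℝⁿ`; moreover `φ⁺ > 0` everywhere and `φ⁺ ∈ D`. -/
theorem principal_eigenfunction_allspace (n : ℕ) (hn : 1 ≤ n) (lam Lam : ℝ)
    (hlam : 0 < lam) (hLam : lam ≤ Lam)
    (F : Mat n → ℝ) (hF : UniformlyElliptic n lam Lam F) (hFh : PositivelyHomogeneous n F) :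
    (∃! φ : En n → ℝ, memX n (1/(8*Lam)) φ ∧ φ 0 = 1 ∧
      ViscSolE n Set.univ (Fop n F (alphaPlus n lam Lam F) (fun _ => 0)) φ) ∧
    (∀ φ : En n → ℝ, memX n (1/(8*Lam)) φ → φ 0 = 1 →
      ViscSolE n Set.univ (Fop n F (alphaPlus n lam Lam F) (fun _ => 0)) φ →
      (∀ y, 0 < φ y) ∧
      ∃ C : ℝ, 0 < C ∧ ∀ y : En n, φ y ≤ C * Real.exp (-(1/(8*Lam)) * ‖y‖ ^ 2)) := by
  have hLam' : 0 < Lam := hlam.trans_le hLam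
  obtain ⟨φ, hφc, hφpos, hφsub, hφsup, C, hC, hφG⟩ :=
    exists_eigenfunction hlam hLam hn rfl hF hFh
  have hApos := alphaPlus_pos hlam hLam hn hF hFh
  set A := alphaPlus n lam Lam F with hA
  have huniq : ∀ ψ : En n → ℝ, memX n (1/(8*Lam)) ψ → ψ 0 = 1 →
      ViscSolE n Set.univ (Fop n F A (fun _ => 0)) ψ → ∀ y, ψ y = (φ 0)⁻¹ * φ y := by
    intro ψ hX h0 hsol
    have hsub := (viscSubE_iff_jSub hlam hLam hF).1 hsol.1
    obtain ⟨C', hC'⟩ := hX.exists_bound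
    rcases hsub.sliding hlam hLam rfl hF hFh hApos.le hφsup continuous_const continuous_const
      hX.1.upperSemicontinuous hφc.lowerSemicontinuous hφpos
      (fun y => (le_abs_self _).trans (hC' y)) le_rfl (fun t _ y => by simp) with h | ⟨t, -, h⟩
    · have := h 0
      rw [h0, zero_mul] at this
      linarith
    · have h1 := h 0
      rw [h0] at h1
      intro y
      rw [h y, eq_inv_of_mul_eq_one_left h1.symm]
  have hinv : 0 < (φ 0)⁻¹ := inv_pos.2 (hφpos 0)
  have hpos : ∀ y, 0 < (φ 0)⁻¹ * φ y := fun y => mul_pos hinv (hφpos y)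
  have hbound : ∀ y : En n, (φ 0)⁻¹ * φ y ≤
      (φ 0)⁻¹ * C * Real.exp (-(1/(8*Lam)) * ‖y‖ ^ 2) := fun y => by
    rw [mul_assoc]
    exact mul_le_mul_of_nonneg_left (hφG y) hinv.le
  have hX₀ : memX n (1/(8*Lam)) fun y => (φ 0)⁻¹ * φ y :=
    memX_of_bound (by fun_prop) fun y => by
      rw [abs_of_pos (hpos y)]
      exact hbound y
  refine ⟨⟨fun y => (φ 0)⁻¹ * φ y, ⟨hX₀,
    inv_mul_cancel₀ (hφpos 0).ne', ?_, ?_⟩, fun ψ ⟨hX, h0, hsol⟩ => funext (huniq ψ hX h0 hsol)⟩,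
    fun ψ hX h0 hsol => ?_⟩
  · rw [viscSubE_iff_jSub hlam hLam hF]
    simpa using hφsub.smul hFh hinv
  · rw [viscSupE_iff_jSup hlam hLam hF]
    simpa using hφsup.smul hFh hinv
  · have h := huniq ψ hX h0 hsol
    refine ⟨fun y => by rw [h y]; exact hpos y, (φ 0)⁻¹ * C, mul_pos hinv hC, fun y => ?_⟩
    rw [h y]
    exact hbound y
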